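/- Every surface of degree 7 in ℙ³(ℂ) whose only singularities are ν ordinary triple points satisfies ν ≤ 17; moreover there exists a septic surface in ℙ³(ℂ) whose only singularities are exactly 16 ordinary triple points. Hence 16 ≤ μ₃(7) ≤ 17. -/

import Mathlib

open MvPolynomial

noncomputable section

/-- Iterated partial derivative of `f` along a list of variable indices. -/
def pderivList {n : ℕ} (l : List (Fin n)) (f : MvPolynomial (Fin n) ℂ) :
    MvPolynomial (Fin n) ℂ :=
  l.foldl (fun g i => MvPolynomial.pderiv i g) f

/-- All partial derivatives of `f` of order `< m` vanish at `p`
(`P` has multiplicity `≥ m` on `{f = 0}`). -/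
def MultAtLeast {n : ℕ} (f : MvPolynomial (Fin n) ℂ) (p : Fin n → ℂ) (m : ℕ) : Prop :=
  ∀ l : List (Fin n), l.length < m → MvPolynomial.eval p (pderivList l f) = 0

/-- `p` is (a representative of) a singular point of `{f = 0}`. -/
def SingularAt (f : MvPolynomial (Fin 4) ℂ) (p : Fin 4 → ℂ) : Prop :=
  MultAtLeast f p 2

/-- The partial derivatives of `c` have no common zero in `ℂⁿ ∖ {0}`. -/
def NowhereSingular {n : ℕ} (c : MvPolynomial (Fin n) ℂ) : Prop :=
  ∀ p : Fin n → ℂ, p ≠ 0 → ∃ i, MvPolynomial.eval p (MvPolynomial.pderiv i c) ≠ 0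

/-- Linear change of coordinates: `substMatrix B f` is the polynomial `x ↦ f (B.mulVec x)`. -/
def substMatrix {n : ℕ} (B : Matrix (Fin n) (Fin n) ℂ) (f : MvPolynomial (Fin n) ℂ) :
    MvPolynomial (Fin n) ℂ :=
  MvPolynomial.aeval (fun i => ∑ j, MvPolynomial.C (B i j) * MvPolynomial.X j) f

/-- `p` is (a representative of) an ordinary triple point of the degree-`d` surface `{f = 0}`:
all partials of order `≤ 2` vanish at `p`, some third-order partial does not, and after a
linear change of coordinates taking `(0,0,0,1)` to `p`, writing `f` as
`∑ⱼ x₃^(d-j) fⱼ(x₀,x₁,x₂)` with `fⱼ` homogeneous of degree `j`, the cubic `f₃` is nonsingular. -/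
def OrdinaryTriplePointAt (d : ℕ) (f : MvPolynomial (Fin 4) ℂ) (p : Fin 4 → ℂ) : Prop :=
  MultAtLeast f p 3 ∧
  (∃ l : List (Fin 4), l.length = 3 ∧ MvPolynomial.eval p (pderivList l f) ≠ 0) ∧
  ∃ B : Matrix (Fin 4) (Fin 4) ℂ, IsUnit B.det ∧ B.mulVec ![0, 0, 0, 1] = p ∧
    ∃ g : ℕ → MvPolynomial (Fin 3) ℂ,
      (∀ j, (g j).IsHomogeneous j) ∧
      substMatrix B f =
        ∑ j ∈ Finset.range (d + 1),
          (MvPolynomial.X 3) ^ (d - j) * MvPolynomial.rename Fin.castSucc (g j) ∧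
      NowhereSingular (g 3)

/-- The set of singular points of `{f = 0}` in `ℙ³(ℂ)`. -/
def SingSet (f : MvPolynomial (Fin 4) ℂ) : Set (Projectivization ℂ (Fin 4 → ℂ)) :=
  {P | SingularAt f P.rep}

/-- `{f = 0}` has `ν` ordinary triple points as its only singularities. -/
def OnlyTriplePoints (d ν : ℕ) (f : MvPolynomial (Fin 4) ℂ) : Prop :=
  (SingSet f).Finite ∧ (SingSet f).ncard = ν ∧
  ∀ P ∈ SingSet f, OrdinaryTriplePointAt d f P.rep

namespace Septic

section Translate
variable {R : Type*} [CommRing R]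

/-- The substitution `f(y) ↦ f(y + c)`. -/
def translate (c : Fin 3 → R) : MvPolynomial (Fin 3) R →ₐ[R] MvPolynomial (Fin 3) R :=
  aeval fun j => X j + C (c j)

@[simp] lemma translate_X (c : Fin 3 → R) (j : Fin 3) : translate c (X j) = X j + C (c j) := by
  simp [translate]

@[simp] lemma translate_C (c : Fin 3 → R) (r : R) : translate c (C r) = C r := by
  simp [translate]

lemma translate_translate (c d : Fin 3 → R) (f : MvPolynomial (Fin 3) R) :
    translate c (translate d f) = translate (c + d) f := by
  rw [← AlgHom.comp_apply]
  congr 1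
  ext j : 1
  simp [add_assoc]

lemma translate_zero (f : MvPolynomial (Fin 3) R) : translate 0 f = f := by
  conv_rhs => rw [← AlgHom.id_apply (R := R) f]
  congr 1
  ext j : 1
  simp

lemma translate_neg_self (c : Fin 3 → R) (f : MvPolynomial (Fin 3) R) :
    translate (-c) (translate c f) = f := by
  rw [translate_translate, neg_add_cancel, translate_zero]

lemma translate_self_neg (c : Fin 3 → R) (f : MvPolynomial (Fin 3) R) :
    translate c (translate (-c) f) = f := by
  rw [translate_translate, add_neg_cancel, translate_zero]

lemma pderiv_translate (c : Fin 3 → R) (j : Fin 3) (f : MvPolynomial (Fin 3) R) :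
    pderiv j (translate c f) = translate c (pderiv j f) := by
  induction f using MvPolynomial.induction_on with
  | C r => simp
  | add f g hf hg => simp [hf, hg]
  | mul_X f k hf =>
    simp only [map_mul, translate_X, Derivation.leibniz, hf, smul_eq_mul, map_add, pderiv_C,
      add_zero, pderiv_X]
    by_cases h : j = k <;> simp [h]

lemma map_translate {S : Type*} [CommRing S] (φ : R →+* S) (c : Fin 3 → R)
    (f : MvPolynomial (Fin 3) R) :
    map φ (translate c f) = translate (fun j => φ (c j)) (map φ f) := by
  induction f using MvPolynomial.induction_on with
  | C r => simp
  | add f g hf hg => simp [hf, hg]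
  | mul_X f k hf => simp [hf]

lemma totalDegree_translate_le (c : Fin 3 → R) (f : MvPolynomial (Fin 3) R) :
    (translate c f).totalDegree ≤ f.totalDegree := by
  rw [f.as_sum, map_sum]
  refine (totalDegree_finsetSum _ _).trans (Finset.sup_le fun a ha => ?_)
  rw [← f.as_sum, translate, aeval_monomial, algebraMap_eq]
  refine (totalDegree_mul _ _).trans ?_
  rw [totalDegree_C, zero_add, Finsupp.prod]
  refine (totalDegree_finsetProd _ _).trans ?_
  refine le_trans (Finset.sum_le_sum fun j _ => ?_) (le_totalDegree ha)
  refine (totalDegree_pow _ _).trans ?_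
  have : (X j + C (c j) : MvPolynomial (Fin 3) R).totalDegree ≤ 1 := by
    refine (totalDegree_add _ _).trans ?_
    rw [totalDegree_C]
    refine max_le ?_ (by simp)
    exact (totalDegree_monomial_le _ _).trans (by simp)
  nlinarith

/-- The `N`-th power of the maximal ideal of the point `c`. -/
def locIdeal (c : Fin 3 → R) (N : ℕ) : Ideal (MvPolynomial (Fin 3) R) :=
  (idealOfVars (Fin 3) R ^ N).comap (translate c)

lemma mem_locIdeal {c : Fin 3 → R} {N : ℕ} {f : MvPolynomial (Fin 3) R} :
    f ∈ locIdeal c N ↔ translate c f ∈ idealOfVars (Fin 3) R ^ N := Iff.rfl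

lemma locIdeal_mono (c : Fin 3 → R) {M N : ℕ} (h : M ≤ N) : locIdeal c N ≤ locIdeal c M :=
  Ideal.comap_mono (Ideal.pow_le_pow_right h)

lemma mul_mem_locIdeal {c : Fin 3 → R} {M N : ℕ} {f g : MvPolynomial (Fin 3) R}
    (hf : f ∈ locIdeal c M) (hg : g ∈ locIdeal c N) : f * g ∈ locIdeal c (M + N) := by
  rw [mem_locIdeal, map_mul, pow_add]
  exact Ideal.mul_mem_mul hf hg

lemma pow_mem_locIdeal {c : Fin 3 → R} {M : ℕ} {f : MvPolynomial (Fin 3) R}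
    (hf : f ∈ locIdeal c M) (b : ℕ) : f ^ b ∈ locIdeal c (M * b) := by
  rw [mem_locIdeal, map_pow, pow_mul]
  exact Ideal.pow_mem_pow (mem_locIdeal.1 hf) b

end Translate

section Cartier
variable (p : ℕ) [Fact p.Prime]

/-- The Cartier operator on polynomials in three variables over `ZMod p`. -/
def cartier : MvPolynomial (Fin 3) (ZMod p) →ₗ[ZMod p] MvPolynomial (Fin 3) (ZMod p) :=
  (basisMonomials (Fin 3) (ZMod p)).constr ℕ fun b =>
    if ∀ j, p ∣ b j + 1 then
      monomial (Finsupp.equivFunOnFinite.symm fun j => (b j + 1) / p - 1) 1 else 0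

lemma cartier_monomial (b : Fin 3 →₀ ℕ) (r : ZMod p) :
    cartier p (monomial b r) = if ∀ j, p ∣ b j + 1 then
      monomial (Finsupp.equivFunOnFinite.symm fun j => (b j + 1) / p - 1) r else 0 := by
  have h : (monomial b r : MvPolynomial (Fin 3) (ZMod p)) = r • basisMonomials _ _ b := by
    simp [smul_monomial]
  rw [h, map_smul, cartier, Module.Basis.constr_basis]
  split_ifs <;> simp [smul_monomial]

lemma cartier_pderiv (j : Fin 3) (g : MvPolynomial (Fin 3) (ZMod p)) :
    cartier p (pderiv j g) = 0 := by
  induction g using MvPolynomial.induction_on' with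
  | monomial b r =>
    rw [pderiv_monomial, cartier_monomial]
    split_ifs with h
    · have hj := h j
      rcases Nat.eq_zero_or_pos (b j) with h0 | h0
      · simp [h0]
      · have : b j - 1 + 1 = b j := by omega
        simp only [Finsupp.coe_tsub, Pi.sub_apply, Finsupp.single_eq_same, this] at hj
        rw [(ZMod.natCast_eq_zero_iff _ _).2 hj]
        simp
    · rfl
  | add f g hf hg => simp [hf, hg]

lemma cartier_pow_mul (h g : MvPolynomial (Fin 3) (ZMod p)) :
    cartier p (h ^ p * g) = h * cartier p g := by
  have hp : 0 < p := (Fact.out : p.Prime).pos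
  rw [← expand_zmod]
  induction h using MvPolynomial.induction_on' with
  | add h₁ h₂ h h' => simp [add_mul, h, h']
  | monomial a r =>
    induction g using MvPolynomial.induction_on' with
    | add h₁ h₂ h h' => rw [mul_add, map_add, h, h', map_add, mul_add]
    | monomial b s =>
      rw [expand_monomial, monomial_mul, cartier_monomial, cartier_monomial]
      have key : ∀ j, p ∣ (p • a + b) j + 1 ↔ p ∣ b j + 1 := fun j => by
        simp only [Finsupp.coe_add, Finsupp.coe_smul, Pi.add_apply, Pi.smul_apply, smul_eq_mul,
          add_assoc]
        exact (Nat.dvd_add_right (dvd_mul_right _ _))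
      simp only [key]
      split_ifs with hb
      · rw [monomial_mul]
        congr 2
        refine Finsupp.ext fun j => ?_
        obtain ⟨q, hq⟩ := hb j
        have hq0 : 0 < q := by
          rcases Nat.eq_zero_or_pos q with h0 | h0
          · simp [h0] at hq
          · exact h0
        simp only [Finsupp.coe_add, Finsupp.coe_smul, Pi.add_apply, Pi.smul_apply, smul_eq_mul,
          Finsupp.equivFunOnFinite_symm_apply_apply, add_assoc, hq]
        rw [← mul_add, Nat.mul_div_cancel_left _ hp, Nat.mul_div_cancel_left _ hp]
        omega
      · simp

lemma cartier_surjective (h : MvPolynomial (Fin 3) (ZMod p)) : ∃ g, cartier p g = h := by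
  have hp : 0 < p := (Fact.out : p.Prime).pos
  refine ⟨h ^ p * monomial (Finsupp.equivFunOnFinite.symm fun _ => p - 1) 1, ?_⟩
  rw [cartier_pow_mul, cartier_monomial, if_pos fun j => by simp [Nat.sub_add_cancel hp]]
  have : (Finsupp.equivFunOnFinite.symm fun j : Fin 3 =>
      ((Finsupp.equivFunOnFinite.symm fun _ : Fin 3 => p - 1) j + 1) / p - 1) = 0 := by
    ext j
    simp [Nat.sub_add_cancel hp, Nat.div_self hp]
  rw [this]
  simp

lemma totalDegree_cartier_le {g : MvPolynomial (Fin 3) (ZMod p)} {t : ℕ}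
    (hg : g.totalDegree + 4 ≤ p * (t + 4)) : (cartier p g).totalDegree ≤ t := by
  have hp : 0 < p := (Fact.out : p.Prime).pos
  rw [g.as_sum, map_sum]
  refine (totalDegree_finsetSum _ _).trans (Finset.sup_le fun b hb => ?_)
  have hb' := le_totalDegree hb
  rw [cartier_monomial]
  split_ifs with h
  · refine (totalDegree_monomial_le _ _).trans ?_
    choose q hq using h
    rw [Finsupp.sum_fintype _ _ fun _ => rfl, Fin.sum_univ_three] at hb' ⊢
    simp only [Finsupp.equivFunOnFinite_symm_apply_apply, hq, Nat.mul_div_cancel_left _ hp, id]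
      at hb' ⊢
    have h0 := hq 0
    have h1 := hq 1
    have h2 := hq 2
    have : p * (q 0 + q 1 + q 2) < p * (t + 4) := by
      rw [mul_add, mul_add, ← h0, ← h1, ← h2]; omega
    have := lt_of_mul_lt_mul_left this (Nat.zero_le p)
    have hq0 : ∀ j, 0 < q j := fun j => by
      rcases Nat.eq_zero_or_pos (q j) with h0 | h0
      · have := hq j; simp [h0] at this
      · exact h0
    have := hq0 0
    have := hq0 1
    have := hq0 2
    omega
  · simp

lemma cartier_mem_locIdeal {c : Fin 3 → ZMod p} {e N : ℕ} (hN : (e + 2) * p ≤ N + 2)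
    {g : MvPolynomial (Fin 3) (ZMod p)} (hg : g ∈ locIdeal c N) :
    cartier p g ∈ locIdeal c e := by
  have hp : 0 < p := (Fact.out : p.Prime).pos
  rw [mem_locIdeal] at hg
  rw [← translate_neg_self c g]
  generalize translate c g = h at hg
  rw [h.as_sum, map_sum, map_sum]
  refine sum_mem fun a ha => ?_
  have haN := (mem_pow_idealOfVars_iff N h).1 hg a ha
  set q : Fin 3 →₀ ℕ := Finsupp.equivFunOnFinite.symm fun j => a j / p
  set r : Fin 3 →₀ ℕ := Finsupp.equivFunOnFinite.symm fun j => a j % p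
  have hqr : a = p • q + r := by
    ext j
    simp [q, r, Nat.div_add_mod]
  have hm : (monomial a (coeff a h) : MvPolynomial (Fin 3) (ZMod p)) =
      monomial q 1 ^ p * monomial r (coeff a h) := by
    rw [monomial_pow, monomial_mul, one_pow, one_mul, ← hqr]
  rw [hm, map_mul, map_pow, cartier_pow_mul, mem_locIdeal, map_mul, translate_self_neg]
  refine Ideal.mul_mem_right _ _ ?_
  rw [monomial_mem_pow_idealOfVars_iff _ _ one_ne_zero]
  rw [hqr] at haN
  simp only [Finsupp.degree_eq_sum, Fin.sum_univ_three, Finsupp.coe_add, Finsupp.coe_smul,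
    Pi.add_apply, Pi.smul_apply, smul_eq_mul] at haN ⊢
  have hr : ∀ j, r j < p := fun j => by simpa [r] using Nat.mod_lt _ hp
  have := hr 0
  have := hr 1
  have := hr 2
  by_contra hlt
  have h1 : q 0 + q 1 + q 2 + 1 ≤ e := by omega
  have h2 := Nat.mul_le_mul_right p h1
  nlinarith

end Cartier

section Defect
variable {A : Type*} [CommRing A]

lemma pderiv_expand {p : ℕ} (hp : 0 < p) (j : Fin 3) (f : MvPolynomial (Fin 3) A) :
    pderiv j (expand p f) = C (p : A) * (X j ^ (p - 1) * expand p (pderiv j f)) := by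
  induction f using MvPolynomial.induction_on with
  | C r => simp
  | add f g hf hg => simp [hf, hg, mul_add]
  | mul_X f k hf =>
    have hX : (X j : MvPolynomial (Fin 3) A) ^ p = X j ^ (p - 1) * X j := by
      rw [← pow_succ, Nat.sub_add_cancel hp]
    by_cases h : j = k
    · subst h
      simp only [map_mul, expand_X, Derivation.leibniz, hf, smul_eq_mul, map_add, pderiv_X_self,
        pderiv_pow, map_one, map_natCast]
      rw [hX]
      ring
    · simp only [map_mul, expand_X, Derivation.leibniz, hf, smul_eq_mul,
        pderiv_X_of_ne (Ne.symm h), pderiv_pow, mul_zero, zero_add]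
      ring

lemma exists_aeval_add_C_mul (p : A) (x η : Fin 3 → MvPolynomial (Fin 3) A)
    (F : MvPolynomial (Fin 3) A) :
    ∃ E, aeval (fun j => x j + C p * η j) F =
      aeval x F + C p * ∑ j, η j * aeval x (pderiv j F) + C p ^ 2 * E := by
  induction F using MvPolynomial.induction_on with
  | C r => exact ⟨0, by simp⟩
  | add f g hf hg =>
    obtain ⟨E, hE⟩ := hf
    obtain ⟨E', hE'⟩ := hg
    refine ⟨E + E', ?_⟩
    simp only [map_add, hE, hE', mul_add, Finset.sum_add_distrib]
    ring
  | mul_X f k hf =>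
    obtain ⟨E, hE⟩ := hf
    refine ⟨E * (x k + C p * η k) + (∑ j, η j * aeval x (pderiv j f)) * η k, ?_⟩
    have h : ∑ j, η j * aeval x (pderiv j (f * X k)) =
        (∑ j, η j * aeval x (pderiv j f)) * x k + η k * aeval x f := by
      simp only [Derivation.leibniz, smul_eq_mul, map_add, map_mul, aeval_X, pderiv_X,
        mul_add, Finset.sum_add_distrib, Finset.sum_mul, Pi.single_apply]
      rw [add_comm]
      congr 1
      · refine Finset.sum_congr rfl fun j _ => by ring
      · rw [Finset.sum_eq_single k] <;> simp +contextual [eq_comm]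
    rw [map_mul, map_mul, hE, aeval_X, aeval_X, h]
    ring

lemma expand_mem_pow_idealOfVars {p m : ℕ} {F : MvPolynomial (Fin 3) A}
    (hF : F ∈ idealOfVars (Fin 3) A ^ m) : expand p F ∈ idealOfVars (Fin 3) A ^ (m * p) := by
  rw [F.as_sum, map_sum]
  refine sum_mem fun a ha => ?_
  rw [mem_pow_idealOfVars_iff] at hF
  rw [expand_monomial, mem_pow_idealOfVars_iff']
  intro x hx
  rw [coeff_monomial, if_neg]
  rintro rfl
  rw [map_nsmul, smul_eq_mul, mul_comm] at hx
  exact absurd (Nat.mul_le_mul_right p (hF a ha)) (by omega)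

variable {p : ℕ} [Fact p.Prime] {φ : A →+* ZMod p}

lemma exists_eq_C_mul (hφ : ∀ a, φ a = 0 ↔ (p : A) ∣ a) {f : MvPolynomial (Fin 3) A}
    (hf : map φ f = 0) : ∃ g, f = C (p : A) * g :=
  (C_dvd_iff_map_hom_eq_zero φ (p : A) hφ f).2 hf

lemma map_pow_sub_expand (f : MvPolynomial (Fin 3) A) : map φ (f ^ p - expand p f) = 0 := by
  rw [map_sub, map_pow, map_expand, expand_zmod, sub_self]

lemma mem_pow_idealOfVars_of_C_mul [IsDomain A] {a : A} (ha : a ≠ 0) {N : ℕ} {H : MvPolynomial (Fin 3) A}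
    (h : C a * H ∈ idealOfVars (Fin 3) A ^ N) : H ∈ idealOfVars (Fin 3) A ^ N := by
  rw [mem_pow_idealOfVars_iff'] at h ⊢
  intro x hx
  have := h x hx
  rw [coeff_C_mul] at this
  exact (mul_eq_zero.1 this).resolve_left ha

lemma map_mem_pow_idealOfVars {B : Type*} [CommRing B] (ψ : A →+* B) {N : ℕ}
    {H : MvPolynomial (Fin 3) A} (h : H ∈ idealOfVars (Fin 3) A ^ N) :
    map ψ H ∈ idealOfVars (Fin 3) B ^ N := by
  rw [mem_pow_idealOfVars_iff'] at h ⊢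
  intro x hx
  rw [coeff_map, h x hx, map_zero]

/-- The reduction modulo `p` of `(f ^ p - f(y ^ p)) / p` is a primitive of
`f ^ (p - 1) df` up to `p`-th powers of partial derivatives. -/
lemma exists_frobenius_defect [IsDomain A] (hφ : ∀ a, φ a = 0 ↔ (p : A) ∣ a) (hp0 : (p : A) ≠ 0)
    (f : MvPolynomial (Fin 3) A) :
    ∃ G : MvPolynomial (Fin 3) (ZMod p), G.totalDegree ≤ f.totalDegree * p ∧
      (∀ j, pderiv j G = map φ f ^ (p - 1) * pderiv j (map φ f) -
        pderiv j (map φ f) ^ p * X j ^ (p - 1)) ∧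
      ∀ (c : Fin 3 → A) (m : ℕ), f ∈ locIdeal c m →
        ∃ G' ∈ locIdeal (fun j => φ (c j)) (m * p), ∃ r : Fin 3 → MvPolynomial (Fin 3) (ZMod p),
          G = G' + ∑ j, pderiv j (map φ f) ^ p * r j := by
  have hp : 0 < p := (Fact.out : p.Prime).pos
  have hC : (C (p : A) : MvPolynomial (Fin 3) A) ≠ 0 :=
    (map_ne_zero_iff _ (C_injective _ _)).2 hp0
  have hCφ : map φ (C (p : A) : MvPolynomial (Fin 3) A) = 0 := by simp
  obtain ⟨G, hG⟩ := exists_eq_C_mul hφ (map_pow_sub_expand (φ := φ) f)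
  refine ⟨map φ G, ?_, fun j => ?_, fun c m hf => ?_⟩
  · have h1 : G.totalDegree ≤ (C (p : A) * G).totalDegree := by
      refine Finset.sup_mono fun x hx => ?_
      rw [mem_support_iff] at hx ⊢
      rw [coeff_C_mul]
      exact mul_ne_zero hp0 hx
    refine (Finset.sup_mono (support_map_subset _ _)).trans (h1.trans ?_)
    rw [← hG]
    refine (totalDegree_sub _ _).trans (max_le ?_ ?_)
    · exact (totalDegree_pow _ _).trans (mul_comm _ _).le
    · rw [totalDegree_expand]
  · have h := congrArg (pderiv j) hG
    rw [map_sub, pderiv_expand hp, Derivation.leibniz, pderiv_C, smul_zero, add_zero,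
      smul_eq_mul, pderiv_pow] at h
    have h2 : C (p : A) * pderiv j G =
        C (p : A) * (f ^ (p - 1) * pderiv j f - X j ^ (p - 1) * expand p (pderiv j f)) := by
      rw [← h, map_natCast]
      ring
    rw [pderiv_map, mul_left_cancel₀ hC h2]
    simp only [map_sub, map_mul, map_pow, map_X, map_expand, expand_zmod, pderiv_map]
    ring
  · set F := translate c f with hF
    rw [mem_locIdeal, ← hF] at hf
    have hη : ∀ j, ∃ η : MvPolynomial (Fin 3) A,
        (X j + C (c j)) ^ p - C (c j) - X j ^ p = C (p : A) * η := fun j => by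
      refine exists_eq_C_mul hφ ?_
      have : (X j + C (φ (c j)) : MvPolynomial (Fin 3) (ZMod p)) ^ p = X j ^ p + C (φ (c j)) := by
        rw [← expand_zmod]
        simp
      simp [this]
    choose η hη using hη
    have key : ∀ F, translate c (expand p (translate (-c) F)) =
        aeval (fun j => X j ^ p + C (p : A) * η j) F := fun F => by
      induction F using MvPolynomial.induction_on with
      | C r => simp [algebraMap_eq]
      | add F G hF hG => simp only [map_add, hF, hG]
      | mul_X F j hF =>
        rw [map_mul, map_mul, map_mul, map_mul, hF, aeval_X, ← hη, translate_X, map_add, map_add,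
          expand_X, map_pow, translate_X, Pi.neg_apply, expand_C, translate_C, C_neg]
        ring
    have hexp : translate c (expand p f) = aeval (fun j => X j ^ p + C (p : A) * η j) F := by
      rw [← key, hF, translate_neg_self]
    obtain ⟨E, hE⟩ := exists_aeval_add_C_mul (p : A) (fun j => X j ^ p) η F
    obtain ⟨H, hH⟩ := exists_eq_C_mul hφ (map_pow_sub_expand (φ := φ) F)
    have hHm : H ∈ idealOfVars (Fin 3) A ^ (m * p) := by
      refine mem_pow_idealOfVars_of_C_mul hp0 ?_
      rw [← hH]
      refine sub_mem ?_ (expand_mem_pow_idealOfVars hf)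
      rw [pow_mul]
      exact Ideal.pow_mem_pow hf p
    have hG2 : translate c G = H - ∑ j, η j * expand p (pderiv j F) - C (p : A) * E := by
      have h := congrArg (translate c) hG
      rw [map_sub, map_mul, translate_C, map_pow, ← hF, hexp, hE] at h
      refine mul_left_cancel₀ hC ?_
      rw [← h]
      have : (aeval fun j => X j ^ p) F = expand p F := rfl
      have h' : ∀ j, (aeval fun j => X j ^ p) (pderiv j F) = expand p (pderiv j F) := fun j => rfl
      simp only [this, h']
      linear_combination hH
    have hG3 := congrArg (fun x => translate (-fun j => φ (c j)) (map φ x)) hG2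
    simp only [map_translate, translate_neg_self, map_sub, map_mul, hCφ, zero_mul, sub_zero,
      map_sum, map_expand, expand_zmod, map_pow, hF, pderiv_translate] at hG3
    refine ⟨translate (-fun j => φ (c j)) (map φ H), ?_,
      fun j => - translate (-fun j => φ (c j)) (map φ (η j)), ?_⟩
    · rw [mem_locIdeal, translate_self_neg]
      exact map_mem_pow_idealOfVars φ hHm
    · rw [hG3, sub_eq_add_neg, ← Finset.sum_neg_distrib]
      congr 1
      refine Finset.sum_congr rfl fun j _ => ?_
      rw [pderiv_map]
      ring

end Defect

section LocIdeal
variable {R : Type*} [CommRing R]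

lemma locIdeal_add_le (c : Fin 3 → R) (M N : ℕ) :
    locIdeal c (M + N) ≤ locIdeal c M * locIdeal c N := by
  intro f hf
  have h : ∀ K, Ideal.map (translate (-c)) (idealOfVars (Fin 3) R ^ K) ≤ locIdeal c K := fun K => by
    rw [Ideal.map_le_iff_le_comap]
    intro g hg
    rw [Ideal.mem_comap, mem_locIdeal, translate_self_neg]
    exact hg
  rw [mem_locIdeal, pow_add] at hf
  have h2 := Ideal.mem_map_of_mem (translate (-c)) hf
  rw [Ideal.map_mul, translate_neg_self] at h2
  exact Ideal.mul_mono (h M) (h N) h2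

lemma locIdeal_zero (c : Fin 3 → R) : locIdeal c 0 = ⊤ := by
  rw [locIdeal, pow_zero, Ideal.one_eq_top, Ideal.comap_top]

lemma locIdeal_le_sup {c : Fin 3 → R} {J : Ideal (MvPolynomial (Fin 3) R)} {M : ℕ}
    (h : locIdeal c M ≤ J ⊔ locIdeal c (M + 1)) (n : ℕ) :
    locIdeal c M ≤ J ⊔ locIdeal c (M + n) := by
  induction n with
  | zero => exact le_sup_right
  | succ n ih =>
    refine ih.trans (sup_le le_sup_left ?_)
    refine (locIdeal_add_le c M n).trans ((Ideal.mul_mono h le_rfl).trans ?_)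
    refine Ideal.mul_le.2 fun f hf g hg => ?_
    obtain ⟨a, ha, b, hb, rfl⟩ := Submodule.mem_sup.1 hf
    have hbg := mul_mem_locIdeal hb hg
    rw [show M + 1 + n = M + (n + 1) by ring] at hbg
    rw [add_mul]
    exact add_mem (Ideal.mem_sup_left (Ideal.mul_mem_right _ _ ha)) (Ideal.mem_sup_right hbg)

lemma sub_homogeneousComponent_mem {n : ℕ} {g : MvPolynomial (Fin 3) R}
    (hg : g ∈ idealOfVars (Fin 3) R ^ n) :
    g - homogeneousComponent n g ∈ idealOfVars (Fin 3) R ^ (n + 1) := by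
  rw [mem_pow_idealOfVars_iff'] at hg ⊢
  intro x hx
  rw [coeff_sub, coeff_homogeneousComponent]
  split_ifs with h
  · simp
  · rw [hg x (by simp only [Finsupp.degree_eq_sum] at *; omega), sub_zero]

lemma homogeneousComponent_mem (n : ℕ) (g : MvPolynomial (Fin 3) R) :
    homogeneousComponent n g ∈ idealOfVars (Fin 3) R ^ n := by
  rw [mem_pow_idealOfVars_iff']
  intro x hx
  rw [coeff_homogeneousComponent, if_neg (by simp only [Finsupp.degree_eq_sum] at *; omega)]

end LocIdeal

section Separation
variable {k : Type*} [Field k] {ι : Type*} [Fintype ι] [DecidableEq ι]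

lemma constantCoeff_translate (c : Fin 3 → k) (f : MvPolynomial (Fin 3) k) :
    constantCoeff (translate c f) = eval c f := by
  induction f using MvPolynomial.induction_on with
  | C r => simp
  | add f g hf hg => simp [hf, hg]
  | mul_X f j hf => simp [hf]

lemma mem_locIdeal_one {c : Fin 3 → k} {f : MvPolynomial (Fin 3) k} :
    f ∈ locIdeal c 1 ↔ eval c f = 0 := by
  rw [mem_locIdeal, mem_pow_idealOfVars_iff', ← constantCoeff_translate, constantCoeff_eq]
  constructor
  · intro h
    exact h 0 (by simp)
  · intro h x hx
    rw [Nat.lt_one_iff, Finsupp.degree_eq_zero_iff] at hx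
    rw [hx, h]

lemma exists_separating {c : ι → Fin 3 → k} (hc : Function.Injective c) (M : ℕ) (i : ι) :
    ∃ h : MvPolynomial (Fin 3) k, h.totalDegree + M ≤ Fintype.card ι * M ∧
      h - 1 ∈ locIdeal (c i) 1 ∧ ∀ j, j ≠ i → h ∈ locIdeal (c j) M := by
  have hs : ∀ j, j ≠ i → ∃ s, c i s - c j s ≠ 0 := fun j hj => by
    by_contra! h
    exact hj (hc (funext fun s => (sub_eq_zero.1 (h s)).symm))
  choose! s hs using hs
  let l : ι → MvPolynomial (Fin 3) k := fun j =>
    C (c i (s j) - c j (s j))⁻¹ * (X (s j) - C (c j (s j)))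
  have hl : ∀ j, (l j).totalDegree ≤ 1 := fun j => by
    refine (totalDegree_mul _ _).trans ?_
    rw [totalDegree_C, zero_add]
    exact (totalDegree_sub_C_le _ _).trans (totalDegree_X _).le
  refine ⟨∏ j ∈ Finset.univ.erase i, l j ^ M, ?_, ?_, fun j hj => ?_⟩
  · have : (∏ j ∈ Finset.univ.erase i, l j ^ M).totalDegree ≤
        (Finset.univ.erase i).card * M := by
      refine (totalDegree_finsetProd _ _).trans ((Finset.sum_le_card_nsmul _ _ M fun j _ => ?_))
      refine (totalDegree_pow _ _).trans ?_
      have := hl j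
      nlinarith
    have hcard : (Finset.univ.erase i).card + 1 = Fintype.card ι :=
      Finset.card_erase_add_one (Finset.mem_univ i)
    rw [← hcard]
    linarith
  · rw [mem_locIdeal_one, map_sub, map_prod, map_one, sub_eq_zero]
    refine Finset.prod_eq_one fun j hj => ?_
    simp [l, inv_mul_cancel₀ (hs j (Finset.ne_of_mem_erase hj))]
  · rw [← Finset.mul_prod_erase _ _ (Finset.mem_erase.2 ⟨hj, Finset.mem_univ j⟩)]
    refine Ideal.mul_mem_right _ _ ?_
    have : l j ∈ locIdeal (c j) 1 := by
      rw [mem_locIdeal_one]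
      simp [l]
    simpa using pow_mem_locIdeal this M

/-- Functionals supported at distinct points, annihilating `J` and summing to zero in low degree,
vanish. -/
lemma eq_zero_of_sum_eq_zero {c : ι → Fin 3 → k} (hc : Function.Injective c)
    {J : Ideal (MvPolynomial (Fin 3) k)} {M : ℕ}
    (hM : ∀ i, locIdeal (c i) M ≤ J ⊔ locIdeal (c i) (M + 1))
    {T : ι → MvPolynomial (Fin 3) k →ₗ[k] k} {N : ℕ}
    (hN : ∀ i, ∀ g ∈ locIdeal (c i) N, T i g = 0) (hJ : ∀ i, ∀ g ∈ J, T i g = 0)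
    (hsum : ∀ g : MvPolynomial (Fin 3) k, g.totalDegree ≤ Fintype.card ι * M → ∑ i, T i g = 0)
    (i : ι) (g : MvPolynomial (Fin 3) k) : T i g = 0 := by
  have hTM : ∀ i, ∀ g ∈ locIdeal (c i) M, T i g = 0 := fun i g hg => by
    obtain ⟨a, ha, b, hb, rfl⟩ := Submodule.mem_sup.1 (locIdeal_le_sup (hM i) N hg)
    rw [map_add, hJ i a ha, hN i b (locIdeal_mono _ (Nat.le_add_left _ _) hb), add_zero]
  have key : ∀ n, n ≤ M → ∀ i, ∀ g ∈ locIdeal (c i) n, T i g = 0 := by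
    intro n hn
    induction hn using Nat.decreasingInduction with
    | self => exact hTM
    | of_succ n hn ih =>
      intro i g hg
      obtain ⟨h, hd, h1, hj⟩ := exists_separating hc M i
      set g₀ := translate (-(c i)) (homogeneousComponent n (translate (c i) g)) with hg₀
      have e1 : T i (g - g₀) = 0 := by
        refine ih i _ ?_
        rw [mem_locIdeal, map_sub, hg₀, translate_self_neg]
        exact sub_homogeneousComponent_mem hg
      have hg₀n : g₀ ∈ locIdeal (c i) n := by
        rw [mem_locIdeal, hg₀, translate_self_neg]
        exact homogeneousComponent_mem _ _
      have e2 : T i (g₀ * (h - 1)) = 0 := ih i _ (mul_mem_locIdeal hg₀n h1)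
      have e3 : ∑ j, T j (g₀ * h) = T i (g₀ * h) :=
        Finset.sum_eq_single i (fun j _ hji => hTM j _ (Ideal.mul_mem_left _ _ (hj j hji))) (by simp)
      have e4 : ∑ j, T j (g₀ * h) = 0 := by
        refine hsum _ ((totalDegree_mul _ _).trans ?_)
        have : g₀.totalDegree ≤ n :=
          (totalDegree_translate_le _ _).trans (homogeneousComponent_isHomogeneous _ _).totalDegree_le
        omega
      have e5 : g = (g - g₀) + g₀ * h - g₀ * (h - 1) := by ring
      rw [e5, map_sub, map_add, e1, e2, ← e3, e4]
      simp
  exact key 0 (Nat.zero_le _) i g (by rw [locIdeal_zero]; trivial)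

end Separation

section KeyModP
variable {p : ℕ} [Fact p.Prime] {ι : Type*} [Fintype ι] [DecidableEq ι]

/-- Descent on the power of `f`, with `U` killing exact forms. -/
lemma functional_eq_zero_of_exact {c : ι → Fin 3 → ZMod p} (hc : Function.Injective c)
    {f G : MvPolynomial (Fin 3) (ZMod p)} {D M N b₀ : ℕ} (hb₀ : b₀ < p)
    (hf : f.totalDegree ≤ 7) (hG : G.totalDegree ≤ 7 * p)
    (hGd : ∀ j, pderiv j G = f ^ (p - 1) * pderiv j f - pderiv j f ^ p * X j ^ (p - 1))
    (hM : ∀ i, locIdeal (c i) M ≤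
      Ideal.span (Set.range fun j => pderiv j f) ⊔ locIdeal (c i) (M + 1))
    {U : ι → MvPolynomial (Fin 3) (ZMod p) →ₗ[ZMod p] ZMod p}
    (hUd : ∀ i j g, U i (pderiv j g) = 0)
    (hUf : ∀ i g, U i (f ^ p * g) = 0)
    (hUj : ∀ i j g, U i (pderiv j f ^ p * g) = 0)
    (hN : ∀ i, ∀ g ∈ locIdeal (c i) N, U i g = 0)
    (hsum : ∀ g : MvPolynomial (Fin 3) (ZMod p), g.totalDegree ≤ D → ∑ i, U i g = 0)
    (hD : Fintype.card ι * M + 7 * b₀ + 7 * p ≤ D)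
    (hstart : ∀ i g, U i (f ^ b₀ * G * g) = 0) (i : ι) (g : MvPolynomial (Fin 3) (ZMod p)) :
    U i g = 0 := by
  have hp : 0 < p := (Fact.out : p.Prime).pos
  have lemZ : ∀ H : MvPolynomial (Fin 3) (ZMod p), Fintype.card ι * M + H.totalDegree ≤ D →
      (∀ i j g, U i (H * pderiv j f * g) = 0) → ∀ i g, U i (H * g) = 0 := by
    intro H hH hHj i g
    refine eq_zero_of_sum_eq_zero hc (T := fun i => (U i).comp (LinearMap.mulLeft (ZMod p) H))
      hM (N := N) (fun i g hg => hN i _ (Ideal.mul_mem_left _ _ hg)) (fun i g hg => ?_)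
      (fun g hg => hsum _ ?_) i g
    · induction hg using Submodule.span_induction generalizing i with
      | mem x hx =>
        obtain ⟨j, rfl⟩ := hx
        simpa using hHj i j 1
      | zero => simp
      | add x y _ _ hx hy => rw [map_add, hx, hy, add_zero]
      | smul a x hx h =>
        clear h
        refine Submodule.span_induction (p := fun x _ => ∀ a,
          ((U i).comp (LinearMap.mulLeft (ZMod p) H)) (a • x) = 0) ?_ ?_ ?_ ?_ hx a
        · rintro x ⟨j, rfl⟩ a
          have := hHj i j a
          simp only [LinearMap.comp_apply, LinearMap.mulLeft_apply, smul_eq_mul]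
          rw [← this]
          ring_nf
        · simp
        · intro x y _ _ hx hy a
          rw [smul_add, map_add, hx, hy, add_zero]
        · intro b x _ hx a
          rw [smul_smul]
          exact hx _
    · exact (totalDegree_mul _ _).trans (by omega)
  have hpow : ∀ b, (f ^ b).totalDegree ≤ 7 * b := fun b =>
    (totalDegree_pow _ _).trans (by nlinarith)
  have hne : ∀ b : ℕ, 0 < b → b < p → (b : ZMod p) ≠ 0 := fun b h0 hb h => by
    rw [ZMod.natCast_eq_zero_iff] at h
    exact absurd (Nat.le_of_dvd h0 h) (by omega)
  have hW : ∀ i g, U i (f ^ 0 * G * g) = 0 := by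
    have : ∀ b, b ≤ b₀ → ∀ i g, U i (f ^ b * G * g) = 0 := by
      intro b hb
      induction hb using Nat.decreasingInduction with
      | self => exact hstart
      | of_succ b hb ih =>
        refine lemZ (f ^ b * G) ?_ ?_
        · have := hpow b
          have := totalDegree_mul (f ^ b) G
          omega
        · intro i j g
          have h := hUd i j (f ^ (b + 1) * G * g)
          have e : pderiv j (f ^ (b + 1) * G * g) =
              ((b + 1 : ℕ) : ZMod p) • (f ^ b * G * pderiv j f * g) + f ^ p * (f ^ b * pderiv j f * g)
              - pderiv j f ^ p * (f ^ (b + 1) * X j ^ (p - 1) * g)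
              + f ^ (b + 1) * G * pderiv j g := by
            rw [Derivation.leibniz, Derivation.leibniz, pderiv_pow, hGd, Nat.add_sub_cancel]
            have : f ^ p = f ^ (p - 1) * f := by rw [← pow_succ, Nat.sub_add_cancel hp]
            rw [this, smul_eq_C_mul, map_natCast]
            simp only [smul_eq_mul]
            ring
          rw [e, map_add, map_sub, map_add, hUf, hUj, ih, map_smul, smul_eq_mul] at h
          simp only [add_zero, sub_zero] at h
          exact (mul_eq_zero.1 h).resolve_left (hne _ (by omega) (by omega))
    exact this 0 (Nat.zero_le _)
  have hV : ∀ b, b ≤ p - 1 → ∀ i g, U i (f ^ b * g) = 0 := by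
    intro b hb
    induction hb using Nat.decreasingInduction with
    | self =>
      refine lemZ (f ^ (p - 1)) ?_ ?_
      · have := hpow (p - 1)
        omega
      · intro i j g
        have h := hUd i j (f ^ 0 * G * g)
        have e : pderiv j (f ^ 0 * G * g) = f ^ (p - 1) * pderiv j f * g
            - pderiv j f ^ p * (X j ^ (p - 1) * g) + f ^ 0 * G * pderiv j g := by
          rw [pow_zero, one_mul, Derivation.leibniz, hGd]
          simp only [smul_eq_mul]
          ring
        rw [e, map_add, map_sub, hUj, hW] at h
        simpa using h
    | of_succ b hb ih =>
      refine lemZ (f ^ b) ?_ ?_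
      · have := hpow b
        omega
      · intro i j g
        have h := hUd i j (f ^ (b + 1) * g)
        have e : pderiv j (f ^ (b + 1) * g) =
            ((b + 1 : ℕ) : ZMod p) • (f ^ b * pderiv j f * g) + f ^ (b + 1) * pderiv j g := by
          rw [Derivation.leibniz, pderiv_pow, Nat.add_sub_cancel, smul_eq_C_mul, map_natCast]
          simp only [smul_eq_mul]
          ring
        rw [e, map_add, ih, map_smul, smul_eq_mul, add_zero] at h
        exact (mul_eq_zero.1 h).resolve_left (hne _ (by omega) (by omega))
  simpa using hV 0 (Nat.zero_le _) i g

variable {A : Type*} [CommRing A] [IsDomain A] {φ : A →+* ZMod p}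

/-- The semicontinuity statement modulo `p`. -/
lemma functional_eq_zero_mod_p (hφ : ∀ a, φ a = 0 ↔ (p : A) ∣ a) (hp0 : (p : A) ≠ 0)
    {f : MvPolynomial (Fin 3) A} (hf : f.totalDegree ≤ 7) {c : ι → Fin 3 → A}
    (hfc : ∀ i, f ∈ locIdeal (c i) 3) (hc : Function.Injective fun i j => φ (c i j))
    {M e t : ℕ} (he : e ≤ 3) (he0 : 0 < e) (het : 7 * e + 2 < 3 * t)
    (hp : 3 * (Fintype.card ι * M + 4) ≤ p)
    (hM : ∀ i, locIdeal (fun j => φ (c i j)) M ≤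
      Ideal.span (Set.range fun j => pderiv j (map φ f)) ⊔ locIdeal (fun j => φ (c i j)) (M + 1))
    {L : ι → MvPolynomial (Fin 3) (ZMod p) →ₗ[ZMod p] ZMod p}
    (hL : ∀ i, ∀ g ∈ locIdeal (fun j => φ (c i j)) e, L i g = 0)
    (hLj : ∀ i j g, L i (pderiv j (map φ f) * g) = 0)
    (hsum : ∀ g : MvPolynomial (Fin 3) (ZMod p), g.totalDegree ≤ t → ∑ i, L i g = 0)
    (i : ι) (g : MvPolynomial (Fin 3) (ZMod p)) : L i g = 0 := by
  obtain ⟨G, hGd, hG, hG'⟩ := exists_frobenius_defect hφ hp0 f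
  obtain ⟨g, rfl⟩ := cartier_surjective p g
  have hmap : ∀ i, map φ f ∈ locIdeal (fun j => φ (c i j)) 3 := fun i => by
    rw [mem_locIdeal, ← map_translate]
    exact map_mem_pow_idealOfVars φ (hfc i)
  obtain ⟨u, rfl⟩ : ∃ u, e = u + 1 := ⟨e - 1, by omega⟩
  have hu : u * p / 3 < p := by
    rw [Nat.div_lt_iff_lt_mul (by norm_num)]
    nlinarith
  have hu3 : u * p ≤ 3 * (u * p / 3) + 2 := by omega
  have hu4 : 3 * (u * p / 3) ≤ u * p := by omega
  have hkill : ∀ i, ∀ N, (u + 1 + 2) * p ≤ N + 2 → ∀ g ∈ locIdeal (fun j => φ (c i j)) N,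
      L i (cartier p g) = 0 := fun i N hN g hg => hL i _ (cartier_mem_locIdeal p hN hg)
  refine functional_eq_zero_of_exact hc (U := fun i => (L i).comp (cartier p)) (G := G)
    (D := p * (t + 4) - 4) (N := (u + 1 + 2) * p) hu
    ((Finset.sup_mono (support_map_subset _ _)).trans hf)
    (hGd.trans (Nat.mul_le_mul_right p hf)) hG hM ?_ ?_ ?_ ?_ ?_ ?_ ?_ i g
  · intro i j g
    rw [LinearMap.comp_apply, cartier_pderiv, map_zero]
  · intro i g
    rw [LinearMap.comp_apply, cartier_pow_mul]
    exact hL i _ (Ideal.mul_mem_right _ _ (locIdeal_mono _ he (hmap i)))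
  · intro i j g
    rw [LinearMap.comp_apply, cartier_pow_mul, hLj]
  · exact fun i g hg => hkill i _ (Nat.le_add_right _ _) g hg
  · intro g hg
    refine hsum _ (totalDegree_cartier_le p ?_)
    have := Nat.mul_le_mul_left p (show 4 ≤ t + 4 by omega)
    omega
  · have h1 : 7 * u + 10 ≤ 3 * t := by omega
    have h2 := Nat.mul_le_mul_left p h1
    have h3 : p * (t + 4) = p * t + 4 * p := by ring
    have h4 : p * (3 * t) = 3 * (p * t) := by ring
    have h5 : p * (7 * u + 10) = 7 * (u * p) + 10 * p := by ring
    omega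
  · intro i g
    obtain ⟨G', hG'm, r, hr⟩ := hG' (c i) 3 (hfc i)
    have e : map φ f ^ (u * p / 3) * G * g = map φ f ^ (u * p / 3) * G' * g +
        ∑ j, pderiv j (map φ f) ^ p * (r j * map φ f ^ (u * p / 3) * g) := by
      rw [hr, mul_add, add_mul, Finset.mul_sum, Finset.sum_mul]
      congr 1
      refine Finset.sum_congr rfl fun j _ => by ring
    rw [LinearMap.comp_apply, e, map_add, map_add, map_sum, map_sum]
    rw [Finset.sum_eq_zero fun j _ => by rw [cartier_pow_mul, hLj], add_zero]
    refine hkill i _ ?_ _ (Ideal.mul_mem_right _ _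
      (mul_mem_locIdeal (pow_mem_locIdeal (hmap i) _) hG'm))
    rw [show (u + 1 + 2) * p = u * p + 3 * p by ring]
    omega

end KeyModP

section Schur
open Polynomial

/-- A nonconstant integer polynomial has roots modulo arbitrarily large primes. -/
lemma exists_prime_dvd_eval {g : ℤ[X]} (hg : 0 < g.natDegree) (B : ℕ) :
    ∃ p : ℕ, p.Prime ∧ B < p ∧ ∃ a : ℤ, (p : ℤ) ∣ g.eval a := by
  by_cases h0 : g.eval 0 = 0
  · obtain ⟨p, hp, hpp⟩ := Nat.exists_infinite_primes (B + 1)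
    exact ⟨p, hpp, hp, 0, by rw [h0]; exact dvd_zero _⟩
  have hF : (B.factorial : ℤ) ≠ 0 := by exact_mod_cast B.factorial_ne_zero
  have hfin : ∀ v : ℤ, {m : ℤ | g.eval (g.eval 0 * B.factorial * m) = v}.Finite := fun v => by
    have hne : g - Polynomial.C v ≠ 0 := fun h => by
      rw [sub_eq_zero.1 h] at hg
      simp at hg
    refine Set.Finite.subset (Set.Finite.preimage
      (f := fun m : ℤ => g.eval 0 * B.factorial * m)
      (fun x _ y _ h => mul_left_cancel₀ (mul_ne_zero h0 hF) h)
      (g - Polynomial.C v).roots.toFinset.finite_toSet) fun m hm => ?_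
    rw [Set.mem_preimage, Finset.mem_coe, Multiset.mem_toFinset, Polynomial.mem_roots hne]
    simpa [sub_eq_zero] using hm
  obtain ⟨m, hm⟩ := (((hfin (g.eval 0)).union (hfin (-g.eval 0)))).exists_notMem
  obtain ⟨k, hk⟩ : g.eval 0 * B.factorial * m ∣ g.eval (g.eval 0 * B.factorial * m) - g.eval 0 := by
    simpa using Polynomial.sub_dvd_eval_sub (g.eval 0 * B.factorial * m) 0 g
  have hval : g.eval (g.eval 0 * B.factorial * m) = g.eval 0 * (1 + B.factorial * (m * k)) := by
    linear_combination hk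
  have hu : (1 + (B.factorial : ℤ) * (m * k)).natAbs ≠ 1 := by
    intro h
    refine hm ?_
    rcases Int.natAbs_eq_iff.1 h with h | h
    · left; simp [hval, h]
    · right; simp [hval, h]
  obtain ⟨p, hp, hpd⟩ := Nat.exists_prime_and_dvd hu
  have hpd' : (p : ℤ) ∣ 1 + (B.factorial : ℤ) * (m * k) := Int.natCast_dvd.2 hpd
  refine ⟨p, hp, ?_, _, hval ▸ dvd_mul_of_dvd_right hpd' _⟩
  by_contra! hle
  have h1 : (p : ℤ) ∣ (B.factorial : ℤ) * (m * k) :=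
    dvd_mul_of_dvd_left (by exact_mod_cast (Nat.Prime.dvd_factorial hp).2 hle) _
  have h2 : (p : ℤ) ∣ 1 := (Int.dvd_add_left h1).1 hpd'
  have h3 : p ∣ 1 := by exact_mod_cast h2
  exact hp.one_lt.ne' (Nat.dvd_one.1 h3)

lemma exists_intPolynomial_smul (P : ℚ[X]) :
    ∃ b : ℤ, b ≠ 0 ∧ ∃ g : ℤ[X], g.map (algebraMap ℤ ℚ) = Polynomial.C (b : ℚ) * P := by
  obtain ⟨b, hb, h⟩ := IsLocalization.integerNormalization_spec (nonZeroDivisors ℤ) P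
  refine ⟨b, nonZeroDivisors.ne_zero hb,
    IsLocalization.integerNormalization (nonZeroDivisors ℤ) P, ?_⟩
  rw [h]
  ext
  simp

lemma exists_padicInt_root {P : ℚ[X]} (hP : Irreducible P) (B : ℕ) :
    ∃ p : ℕ, ∃ _ : Fact p.Prime, B < p ∧ ∃ z : ℤ_[p], aeval (z : ℚ_[p]) P = 0 := by
  obtain ⟨b, hb, g, hg⟩ := exists_intPolynomial_smul P
  have hbQ : (b : ℚ) ≠ 0 := by exact_mod_cast hb
  have hsep : IsCoprime (g.map (algebraMap ℤ ℚ)) (g.map (algebraMap ℤ ℚ)).derivative := by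
    rw [hg]
    exact Separable.unit_mul (Polynomial.isUnit_C.2 hbQ.isUnit) hP.separable
  obtain ⟨u, v, huv⟩ := hsep
  obtain ⟨b₁, hb₁, U, hU⟩ := exists_intPolynomial_smul u
  obtain ⟨b₂, hb₂, V, hV⟩ := exists_intPolynomial_smul v
  have hUV : Polynomial.C b₂ * U * g + Polynomial.C b₁ * V * derivative g = Polynomial.C (b₁ * b₂) := by
    refine Polynomial.map_injective (algebraMap ℤ ℚ) (algebraMap ℤ ℚ).injective_int ?_
    simp only [Polynomial.map_add, Polynomial.map_mul, hU, hV, Polynomial.map_C, ← derivative_map]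
    simp only [eq_intCast, Int.cast_mul, Polynomial.C_mul]
    linear_combination (Polynomial.C (b₁ : ℚ) * Polynomial.C (b₂ : ℚ)) * huv
  have hdeg : 0 < g.natDegree := by
    have := congrArg natDegree hg
    rw [natDegree_C_mul hbQ, Polynomial.natDegree_map_eq_of_injective (algebraMap ℤ ℚ).injective_int] at this
    rw [this]
    exact hP.natDegree_pos
  obtain ⟨p, hp, hpB, a, ha⟩ := exists_prime_dvd_eval hdeg (B + (b₁ * b₂).natAbs)
  have : Fact p.Prime := ⟨hp⟩
  have hev : ∀ h : ℤ[X], aeval (a : ℤ_[p]) h = ((h.eval a : ℤ) : ℤ_[p]) := fun h => by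
    have := Polynomial.aeval_algebraMap_apply ℤ_[p] a h
    simpa using this
  have hd : ‖aeval (a : ℤ_[p]) (derivative g)‖ = 1 := by
    refine le_antisymm (PadicInt.norm_le_one _) (not_lt.1 fun hlt => ?_)
    rw [hev, PadicInt.norm_int_lt_one_iff_dvd] at hlt
    have h := congrArg (eval a) hUV
    simp only [Polynomial.eval_add, Polynomial.eval_mul, Polynomial.eval_C] at h
    have : (p : ℤ) ∣ b₁ * b₂ := by
      rw [← h]
      exact dvd_add (dvd_mul_of_dvd_right ha _) (dvd_mul_of_dvd_right hlt _)
    have := Nat.le_of_dvd (Int.natAbs_pos.2 (mul_ne_zero hb₁ hb₂)) (Int.natCast_dvd.1 this)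
    omega
  have hn : ‖aeval (a : ℤ_[p]) g‖ < ‖aeval (a : ℤ_[p]) (derivative g)‖ ^ 2 := by
    rw [hd, one_pow, hev, PadicInt.norm_int_lt_one_iff_dvd]
    exact ha
  obtain ⟨z, hz, -⟩ := hensels_lemma hn
  refine ⟨p, ⟨hp⟩, by omega, z, ?_⟩
  have h1 : aeval (z : ℚ_[p]) (g.map (algebraMap ℤ ℚ)) = 0 := by
    rw [Polynomial.aeval_map_algebraMap]
    have := aeval_algebraMap_apply ℚ_[p] z g
    rw [hz, map_zero] at this
    exact this
  rw [hg, map_mul, Polynomial.aeval_C] at h1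
  refine (mul_eq_zero.1 h1).resolve_left ?_
  simpa using hb

end Schur

/-- A number field embeds in `ℚ_p` for arbitrarily large `p`, with given elements integral. -/
lemma exists_ringHom_padic (K : Type*) [Field K] [Algebra ℚ K] [Module.Finite ℚ K] (T : Finset K)
    (B : ℕ) : ∃ p : ℕ, ∃ _ : Fact p.Prime, B < p ∧ ∃ ψ : K →+* ℚ_[p],
      ∀ t ∈ T, ψ t ∈ PadicInt.subring p := by
  have : CharZero K := algebraRat.charZero K
  have hden : ∀ s : K, ∃ d : ℤ, d ≠ 0 ∧ IsIntegral ℤ (d • s) := fun s => by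
    have : IsAlgebraic ℤ s := (IsFractionRing.isAlgebraic_iff ℤ ℚ K).2
      (Algebra.IsAlgebraic.isAlgebraic s)
    exact this.exists_integral_multiple
  choose d hd0 hd using hden
  let D : ℕ := ∏ s ∈ T, (d s).natAbs
  let pb := Field.powerBasisOfFiniteOfSeparable ℚ K
  obtain ⟨p, hp, hpB, z, hz⟩ := exists_padicInt_root
    (minpoly.irreducible (Algebra.IsIntegral.isIntegral (R := ℚ) pb.gen)) (B + D)
  refine ⟨p, hp, by omega, (pb.lift _ hz).toRingHom, fun y hy => ?_⟩
  generalize (pb.lift _ hz).toRingHom = ψ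
  have h1 : IsIntegral ℤ (ψ (d y • y)) := (hd y).map ψ.toIntAlgHom
  have h2 : IsIntegral ℤ_[p] (ψ (d y • y)) := h1.tower_top
  obtain ⟨w, hw⟩ := IsIntegrallyClosed.isIntegral_iff.1 h2
  have hw' : (w : ℚ_[p]) = (d y : ℚ_[p]) * ψ y := by
    rw [← zsmul_eq_mul, ← map_zsmul]
    exact hw
  have h3 : ‖(d y : ℚ_[p])‖ = 1 := by
    rw [Padic.norm_intCast_eq_one_iff, Int.isCoprime_iff_gcd_eq_one, Int.gcd,
      Int.natAbs_natCast, Nat.gcd_comm]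
    refine (Nat.Prime.coprime_iff_not_dvd hp.out).2 fun hdvd => ?_
    have h4 : (d y).natAbs ∣ D := Finset.dvd_prod_of_mem (fun s => (d s).natAbs) hy
    have hD : 0 < D := Finset.prod_pos fun s _ => Int.natAbs_pos.2 (hd0 _)
    have := Nat.le_of_dvd hD (hdvd.trans h4)
    omega
  have h5 := congrArg norm hw'
  rw [norm_mul, h3, one_mul] at h5
  exact (PadicInt.mem_subring_iff p).2 (h5 ▸ w.2)

/-- A finitely generated subring of `ℂ` maps to `ℤ_p` for arbitrarily large `p`. -/
lemma exists_ringHom_padicInt (S : Finset ℂ) (B : ℕ) :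
    ∃ p : ℕ, ∃ _ : Fact p.Prime, B < p ∧ Nonempty (Subring.closure (S : Set ℂ) →+* ℤ_[p]) := by
  classical
  let A := Algebra.adjoin ℚ (S : Set ℂ)
  have : Algebra.FiniteType ℚ A := Subalgebra.fg_iff_finiteType _ |>.1 ⟨S, rfl⟩
  obtain ⟨m, hm⟩ := Ideal.exists_maximal A
  let := Ideal.Quotient.field m
  have := finite_of_finite_type_of_isJacobsonRing ℚ (A ⧸ m)
  have hSA : ∀ s ∈ S, s ∈ A := fun s hs => Algebra.subset_adjoin hs
  have hle : Subring.closure (S : Set ℂ) ≤ A.toSubring := Subring.closure_le.2 hSA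
  obtain ⟨p, hp, hpB, ψ, hψ⟩ := exists_ringHom_padic (A ⧸ m)
    (S.attach.image fun s : S => Ideal.Quotient.mk m ⟨s, hSA s s.2⟩) B
  refine ⟨p, hp, hpB, ⟨?_⟩⟩
  let χ : Subring.closure (S : Set ℂ) →+* ℚ_[p] :=
    (ψ.comp (Ideal.Quotient.mk m)).comp (Subring.inclusion hle)
  have hχ : ∀ x, ∀ hx : x ∈ Subring.closure (S : Set ℂ), χ ⟨x, hx⟩ ∈ PadicInt.subring p := by
    intro x hx
    induction hx using Subring.closure_induction with
    | mem s hs =>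
      exact hψ _ (Finset.mem_image.2 ⟨⟨s, hs⟩, Finset.mem_attach _ _, rfl⟩)
    | zero => exact χ.map_zero.symm ▸ zero_mem _
    | one => exact χ.map_one.symm ▸ one_mem _
    | add x y hx hy h1 h2 => exact (χ.map_add ⟨x, hx⟩ ⟨y, hy⟩).symm ▸ add_mem h1 h2
    | mul x y hx hy h1 h2 => exact (χ.map_mul ⟨x, hx⟩ ⟨y, hy⟩).symm ▸ mul_mem h1 h2
    | neg x hx h => exact (χ.map_neg ⟨x, hx⟩).symm ▸ neg_mem h
  exact χ.codRestrict (PadicInt.subring p) fun x => hχ x x.2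

/-- Exponents of degree less than `e`. -/
def lowExponents (e : ℕ) : Finset (Fin 3 →₀ ℕ) :=
  (Finset.range e).biUnion fun n => Finset.univ.finsuppAntidiag n

lemma mem_lowExponents {e : ℕ} {a : Fin 3 →₀ ℕ} : a ∈ lowExponents e ↔ a.degree < e := by
  simp [lowExponents, Finset.mem_finsuppAntidiag, Finsupp.degree_eq_sum]

section Jet
variable {R : Type*} [CommRing R]

/-- The functional on jets of order less than `e` at `c` with coefficients `l`. -/
def jet (e : ℕ) (c : Fin 3 → R) (l : (Fin 3 →₀ ℕ) → R) : MvPolynomial (Fin 3) R →ₗ[R] R :=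
  ∑ a ∈ lowExponents e, l a • (lcoeff R a).comp (translate c).toLinearMap

lemma jet_apply (e : ℕ) (c : Fin 3 → R) (l : (Fin 3 →₀ ℕ) → R) (g : MvPolynomial (Fin 3) R) :
    jet e c l g = ∑ a ∈ lowExponents e, l a * coeff a (translate c g) := by
  simp [jet, LinearMap.sum_apply]

lemma map_jet {S : Type*} [CommRing S] (φ : R →+* S) (e : ℕ) (c : Fin 3 → R)
    (l : (Fin 3 →₀ ℕ) → R) (g : MvPolynomial (Fin 3) R) :
    φ (jet e c l g) = jet e (fun j => φ (c j)) (fun a => φ (l a)) (map φ g) := by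
  simp only [jet_apply, map_sum, map_mul, ← map_translate, coeff_map]

lemma jet_eq_zero_of_mem {e : ℕ} {c : Fin 3 → R} {l : (Fin 3 →₀ ℕ) → R}
    {g : MvPolynomial (Fin 3) R} (hg : g ∈ locIdeal c e) : jet e c l g = 0 := by
  rw [mem_locIdeal, mem_pow_idealOfVars_iff'] at hg
  rw [jet_apply]
  exact Finset.sum_eq_zero fun a ha => by rw [hg a (mem_lowExponents.1 ha), mul_zero]

lemma jet_translate_monomial {e : ℕ} {c : Fin 3 → R} {l : (Fin 3 →₀ ℕ) → R} {a : Fin 3 →₀ ℕ}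
    (ha : a ∈ lowExponents e) : jet e c l (translate (-c) (monomial a 1)) = l a := by
  rw [jet_apply, translate_self_neg, Finset.sum_eq_single a]
  · simp
  · intro b _ hb
    rw [coeff_monomial, if_neg hb.symm, mul_zero]
  · exact fun h => absurd ha h

/-- Modulo the partial derivatives of `f`, monomials of degree `M` at `c` have order above `M`. -/
def LocallyFinite (f : MvPolynomial (Fin 3) R) (c : Fin 3 → R) (M : ℕ) : Prop :=
  ∀ a ∈ Finset.univ.finsuppAntidiag M, ∃ q : Fin 3 → MvPolynomial (Fin 3) R,
    ∃ r ∈ idealOfVars (Fin 3) R ^ (M + 1),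
      monomial a 1 = ∑ j, q j * translate c (pderiv j f) + r

lemma LocallyFinite.locIdeal_le {f : MvPolynomial (Fin 3) R} {c : Fin 3 → R} {M : ℕ}
    (h : LocallyFinite f c M) : locIdeal c M ≤
      Ideal.span (Set.range fun j => pderiv j f) ⊔ locIdeal c (M + 1) := by
  intro g hg
  rw [mem_locIdeal, pow_idealOfVars_eq_span] at hg
  have h1 : ∀ x ∈ Ideal.span ((monomial · (1 : R)) '' Finsupp.degree ⁻¹' {M}),
      translate (-c) x ∈ Ideal.span (Set.range fun j => pderiv j f) ⊔ locIdeal c (M + 1) := by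
    intro x hx
    refine Submodule.span_induction ?_ ?_ ?_ ?_ hx
    · rintro x ⟨a, ha, rfl⟩
      obtain ⟨q, r, hr, hq⟩ := h a (by
        simpa [Finset.mem_finsuppAntidiag, Finsupp.degree_eq_sum] using ha)
      simp only [hq, map_add, map_sum, map_mul, translate_neg_self]
      refine add_mem (Ideal.mem_sup_left (sum_mem fun j _ => Ideal.mul_mem_left _ _
        (Ideal.subset_span ⟨j, rfl⟩))) (Ideal.mem_sup_right ?_)
      rw [mem_locIdeal, translate_self_neg]
      exact hr
    · simp
    · intro x y _ _ hx hy
      rw [map_add]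
      exact add_mem hx hy
    · intro a x _ hx
      rw [smul_eq_mul, map_mul]
      exact Ideal.mul_mem_left _ _ hx
  simpa [translate_neg_self] using h1 _ hg

lemma mem_pow_idealOfVars_of_map {S : Type*} [CommRing S] {φ : R →+* S}
    (hφ : Function.Injective φ) {n : ℕ} {g : MvPolynomial (Fin 3) R}
    (hg : map φ g ∈ idealOfVars (Fin 3) S ^ n) : g ∈ idealOfVars (Fin 3) R ^ n := by
  rw [mem_pow_idealOfVars_iff'] at hg ⊢
  intro x hx
  have := hg x hx
  rw [coeff_map] at this
  exact (map_eq_zero_iff φ hφ).1 this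

lemma exists_map_eq_of_surjective {S : Type*} [CommRing S] {φ : R →+* S}
    (hφ : Function.Surjective φ) (g : MvPolynomial (Fin 3) S) :
    ∃ g' : MvPolynomial (Fin 3) R, map φ g' = g ∧ g'.totalDegree ≤ g.totalDegree := by
  choose s hs using hφ
  refine ⟨∑ a ∈ g.support, monomial a (s (coeff a g)), ?_, ?_⟩
  · rw [map_sum]
    conv_rhs => rw [g.as_sum]
    exact Finset.sum_congr rfl fun a _ => by rw [map_monomial, hs]
  · refine (totalDegree_finsetSum _ _).trans (Finset.sup_le fun a ha => ?_)
    exact (totalDegree_monomial_le _ _).trans (le_totalDegree ha)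

end Jet

lemma padicInt_toZMod_eq_zero_iff {p : ℕ} [Fact p.Prime] (a : ℤ_[p]) :
    PadicInt.toZMod a = 0 ↔ (p : ℤ_[p]) ∣ a := by
  rw [← RingHom.mem_ker, PadicInt.ker_toZMod, PadicInt.maximalIdeal_eq_span_p,
    Ideal.mem_span_singleton]

lemma exists_map_subtype_eq {S : Subring ℂ} {g : MvPolynomial (Fin 3) ℂ}
    (hg : (g.coeffs : Set ℂ) ⊆ S) : ∃ g' : MvPolynomial (Fin 3) S, map S.subtype g' = g := by
  have : g ∈ Set.range (map S.subtype) := by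
    rw [mem_range_map_iff_coeffs_subset]
    simpa using hg
  exact this

lemma totalDegree_map_of_injective {R S : Type*} [CommRing R] [CommRing S] {φ : R →+* S}
    (hφ : Function.Injective φ) (g : MvPolynomial (Fin 3) R) :
    (map φ g).totalDegree = g.totalDegree := by
  rw [totalDegree, totalDegree, support_map_of_injective _ hφ]

section KeyComplex
variable {ι : Type*} [Fintype ι] [DecidableEq ι]

/-- The semicontinuity statement: jets at triple points of a septic killing the Jacobian ideal
and polynomials of low degree vanish. -/
theorem jet_eq_zero_of_sum_eq_zero {f : MvPolynomial (Fin 3) ℂ} (hf : f.totalDegree ≤ 7)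
    {c : ι → Fin 3 → ℂ} (hfc : ∀ i, f ∈ locIdeal (c i) 3) (hc : Function.Injective c)
    {M e t : ℕ} (he : e ≤ 3) (he0 : 0 < e) (het : 7 * e + 2 < 3 * t)
    (hM : ∀ i, LocallyFinite f (c i) M) {l : ι → (Fin 3 →₀ ℕ) → ℂ}
    (hlj : ∀ i j g, jet e (c i) (l i) (pderiv j f * g) = 0)
    (hsum : ∀ g : MvPolynomial (Fin 3) ℂ, g.totalDegree ≤ t → ∑ i, jet e (c i) (l i) g = 0)
    (i : ι) {a : Fin 3 →₀ ℕ} (ha : a ∈ lowExponents e) : l i a = 0 := by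
  classical
  choose! q r hr hqr using hM
  let S : Finset ℂ := f.coeffs ∪ (Finset.univ.biUnion fun i => Finset.univ.image (c i)) ∪
    (Finset.univ.biUnion fun i => Finset.univ.biUnion fun i' => Finset.univ.image fun s =>
      (c i s - c i' s)⁻¹) ∪
    (Finset.univ.biUnion fun i => (lowExponents e).image (l i)) ∪
    (Finset.univ.biUnion fun i => (lowExponents e).image fun a => (l i a)⁻¹) ∪
    (Finset.univ.biUnion fun i => (Finset.univ.finsuppAntidiag M).biUnion fun a =>
      (Finset.univ.biUnion fun j => (q i a j).coeffs) ∪ (r i a).coeffs)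
  let A := Subring.closure (S : Set ℂ)
  have hSA : ∀ s ∈ S, s ∈ A := fun s hs => Subring.subset_closure hs
  obtain ⟨f', hf'⟩ := exists_map_subtype_eq (S := A) (g := f) fun s hs => hSA s (by
    simp only [S, Finset.mem_union]; left; left; left; left; left; exact hs)
  have hcA : ∀ i s, c i s ∈ A := fun i s => hSA _ (by
    simp only [S, Finset.mem_union, Finset.mem_biUnion, Finset.mem_image]
    left; left; left; left; right; exact ⟨i, Finset.mem_univ _, s, Finset.mem_univ _, rfl⟩)
  have hdA : ∀ i i' s, (c i s - c i' s)⁻¹ ∈ A := fun i i' s => hSA _ (by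
    simp only [S, Finset.mem_union, Finset.mem_biUnion, Finset.mem_image]
    left; left; left; right
    exact ⟨i, Finset.mem_univ _, i', Finset.mem_univ _, s, Finset.mem_univ _, rfl⟩)
  have hlA : ∀ i, ∀ a ∈ lowExponents e, l i a ∈ A := fun i a ha => hSA _ (by
    simp only [S, Finset.mem_union, Finset.mem_biUnion, Finset.mem_image]
    left; left; right; exact ⟨i, Finset.mem_univ _, a, ha, rfl⟩)
  have hlA' : ∀ i, ∀ a ∈ lowExponents e, (l i a)⁻¹ ∈ A := fun i a ha => hSA _ (by
    simp only [S, Finset.mem_union, Finset.mem_biUnion, Finset.mem_image]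
    left; right; exact ⟨i, Finset.mem_univ _, a, ha, rfl⟩)
  have hq' : ∀ i, ∀ a ∈ Finset.univ.finsuppAntidiag M, ∀ j,
      ∃ g : MvPolynomial (Fin 3) A, map A.subtype g = q i a j := fun i a ha j =>
    exists_map_subtype_eq fun s hs => hSA s (by
      simp only [S, Finset.mem_union, Finset.mem_biUnion]
      right; exact ⟨i, Finset.mem_univ _, a, ha, Or.inl ⟨j, Finset.mem_univ _, hs⟩⟩)
  have hr' : ∀ i, ∀ a ∈ Finset.univ.finsuppAntidiag M,
      ∃ g : MvPolynomial (Fin 3) A, map A.subtype g = r i a := fun i a ha =>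
    exists_map_subtype_eq fun s hs => hSA s (by
      simp only [S, Finset.mem_union, Finset.mem_biUnion]
      right; exact ⟨i, Finset.mem_univ _, a, ha, Or.inr hs⟩)
  obtain ⟨p, hp, hpB, ⟨θ⟩⟩ := exists_ringHom_padicInt S (3 * (Fintype.card ι * M + 4))
  let θ' : A →+* ℤ_[p] := θ
  let c' : ι → Fin 3 → A := fun i s => ⟨c i s, hcA i s⟩
  let l' : ι → (Fin 3 →₀ ℕ) → A := fun i a =>
    if h : a ∈ lowExponents e then ⟨l i a, hlA i a h⟩ else 0
  let φ : A →+* ZMod p := PadicInt.toZMod.comp θ'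
  have hinj : Function.Injective A.subtype := Subtype.val_injective
  have hmapinj := map_injective (σ := Fin 3) A.subtype hinj
  have hφs : Function.Surjective φ := ZMod.ringHom_surjective φ
  have hjet : ∀ i g, (jet e (c' i) (l' i) g : ℂ) = jet e (c i) (l i) (map A.subtype g) := by
    intro i g
    have h := map_jet A.subtype e (c' i) (l' i) g
    rw [jet_apply e _ (fun a => A.subtype (l' i a))] at h
    rw [jet_apply e (c i)]
    refine h.trans (Finset.sum_congr rfl fun a ha => ?_)
    simp [l', ha, c']
  have hff : map (PadicInt.toZMod (p := p)) (map θ' f') = map φ f' := by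
    rw [map_map]
  have hfdeg : (map θ' f').totalDegree ≤ 7 := by
    refine (Finset.sup_mono (support_map_subset _ _)).trans ?_
    rw [← hf', totalDegree_map_of_injective hinj] at hf
    exact hf
  have hlf : ∀ i, LocallyFinite (map φ f') (fun s => φ (c' i s)) M := by
    intro i a ha
    choose g hg using hq' i a ha
    obtain ⟨k, hk⟩ := hr' i a ha
    have h1 : monomial a 1 = ∑ j, g j * translate (c' i) (pderiv j f') + k := by
      refine hmapinj ?_
      rw [map_add, map_sum, hk, map_monomial, map_one, hqr i a ha]
      congr 1
      refine Finset.sum_congr rfl fun j _ => ?_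
      rw [map_mul, hg, map_translate, ← pderiv_map, hf']
      rfl
    refine ⟨fun j => map φ (g j), map φ k, map_mem_pow_idealOfVars φ
      (mem_pow_idealOfVars_of_map hinj (hk ▸ hr i a ha)), ?_⟩
    have h2 := congrArg (map φ) h1
    rw [map_monomial, map_one, map_add, map_sum] at h2
    rw [h2]
    congr 1
    refine Finset.sum_congr rfl fun j _ => ?_
    rw [map_mul, map_translate, pderiv_map]
  have hzero : ∀ i, jet e (fun s => φ (c' i s)) (fun a => φ (l' i a)) = 0 := by
    intro i
    refine LinearMap.ext fun g => ?_
    refine functional_eq_zero_mod_p (p := p) (φ := PadicInt.toZMod) (f := map θ' f')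
      (c := fun i s => θ' (c' i s)) padicInt_toZMod_eq_zero_iff
      (by exact_mod_cast hp.out.ne_zero) hfdeg ?_ ?_ he he0 het hpB.le ?_
      (L := fun i => jet e (fun s => φ (c' i s)) (fun a => φ (l' i a))) ?_ ?_ ?_ i g
    · intro i
      rw [mem_locIdeal, ← map_translate]
      refine map_mem_pow_idealOfVars _ (mem_pow_idealOfVars_of_map hinj ?_)
      rw [map_translate, hf']
      exact hfc i
    · intro i i' h
      by_contra hne
      obtain ⟨s, hs⟩ := Function.ne_iff.1 (hc.ne hne)
      have h1 : (c' i s - c' i' s) * ⟨_, hdA i i' s⟩ = 1 := by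
        refine Subtype.ext ?_
        exact mul_inv_cancel₀ (sub_ne_zero.2 hs)
      have h2 := congrArg φ h1
      have h3 : φ (c' i s) = φ (c' i' s) := congrFun h s
      rw [map_mul, map_sub, h3, sub_self, zero_mul, map_one] at h2
      exact zero_ne_one h2
    · intro i
      rw [hff]
      exact (hlf i).locIdeal_le
    · exact fun i g hg => jet_eq_zero_of_mem hg
    · intro i j g
      obtain ⟨g', rfl⟩ := map_surjective φ hφs g
      rw [hff, pderiv_map, ← map_mul, ← map_jet]
      have : jet e (c' i) (l' i) (pderiv j f' * g') = 0 := by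
        refine hinj ?_
        rw [map_zero]
        refine (hjet i _).trans ?_
        rw [map_mul, ← pderiv_map, hf', hlj]
      rw [this, map_zero]
    · intro g hg
      obtain ⟨g', rfl, hd⟩ := exists_map_eq_of_surjective hφs g
      simp only [← map_jet, ← map_sum]
      have : ∑ i, jet e (c' i) (l' i) g' = 0 := by
        refine hinj ?_
        rw [map_zero, map_sum]
        refine (Finset.sum_congr rfl fun i _ => hjet i _).trans (hsum _ ?_)
        rw [totalDegree_map_of_injective hinj]
        exact hd.trans hg
      rw [this, map_zero]
  by_contra hne
  have h1 := jet_translate_monomial (R := ZMod p) (c := fun s => φ (c' i s))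
    (l := fun a => φ (l' i a)) ha
  rw [hzero, LinearMap.zero_apply] at h1
  have h2 : l' i a * ⟨_, hlA' i a ha⟩ = 1 := by
    refine Subtype.ext ?_
    simp only [l', ha, dif_pos]
    exact mul_inv_cancel₀ hne
  have h3 := congrArg φ h2
  rw [map_mul, ← h1, zero_mul, map_one] at h3
  exact zero_ne_one h3

end KeyComplex

/-- A derivation-type identity for a symmetric trilinear form without isotropic vectors of
order two is trivial. -/
theorem end_eq_zero_of_trilinear {V : Type*} [AddCommGroup V] [Module ℂ V]
    [FiniteDimensional ℂ V] (hV : Module.finrank ℂ V = 3) {T : V →ₗ[ℂ] V →ₗ[ℂ] V →ₗ[ℂ] ℂ}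
    (hT : ∀ v, T v v = 0 → v = 0) {L : Module.End ℂ V}
    (hL : ∀ a b c, T (L a) b c + T a (L b) c + T a b (L c) = 0) : L = 0 := by
  have step : ∀ μ, L.HasEigenvalue μ → L.HasEigenvalue (-2 * μ) := by
    intro μ hμ
    obtain ⟨v, hv⟩ := hμ.exists_hasEigenvector
    have hξ : T v v ≠ 0 := fun h => hv.2 (hT v h)
    rw [Module.End.hasEigenvalue_iff]
    intro hbot
    rw [Module.End.eigenspace_def, LinearMap.ker_eq_bot,
      LinearMap.injective_iff_surjective] at hbot
    refine hξ (LinearMap.ext fun c => ?_)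
    obtain ⟨d, rfl⟩ := hbot c
    have h := hL v v d
    rw [hv.apply_eq_smul] at h
    simp only [map_smul, LinearMap.smul_apply, LinearMap.sub_apply, map_sub, smul_eq_mul,
      LinearMap.zero_apply] at h ⊢
    linear_combination h
  have hzero : ∀ μ, L.HasEigenvalue μ → μ = 0 := by
    intro μ hμ
    by_contra h0
    have hall : ∀ n : ℕ, L.HasEigenvalue ((-2) ^ n * μ) := by
      intro n
      induction n with
      | zero => simpa using hμ
      | succ n ih =>
        have := step _ ih
        rwa [← mul_assoc, ← pow_succ'] at this
    have hinj : Function.Injective fun n : ℕ => ((-2 : ℂ)) ^ n * μ := by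
      intro m n h
      have h1 := congrArg norm (mul_right_cancel₀ h0 h)
      simp only [norm_pow, norm_neg, Complex.norm_ofNat] at h1
      exact Nat.pow_right_injective le_rfl (by exact_mod_cast h1)
    exact Set.infinite_of_injective_forall_mem hinj hall L.finite_hasEigenvalue
  have hL3 : L ^ 3 = 0 := by
    have hsp : L.charpoly.Splits := IsAlgClosed.splits _
    have hr : L.charpoly.roots = Multiset.replicate 3 0 := by
      rw [Multiset.eq_replicate]
      refine ⟨?_, fun μ hμ => hzero μ ?_⟩
      · rw [← hsp.natDegree_eq_card_roots, L.charpoly_natDegree, hV]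
      · exact Module.End.hasEigenvalue_iff_isRoot_charpoly _ _ |>.2
          (Polynomial.isRoot_of_mem_roots hμ)
    have h := L.aeval_self_charpoly
    rw [hsp.eq_prod_roots_of_monic L.charpoly_monic, hr] at h
    simpa [pow_succ, mul_assoc] using h
  have hL3' : ∀ x, L (L (L x)) = 0 := fun x => by
    have := LinearMap.congr_fun hL3 x
    simpa [pow_succ] using this
  have hL2 : ∀ x, L (L x) = 0 := fun x => by
    refine hT _ (LinearMap.ext fun c => ?_)
    have h1 := hL (L x) (L x) (L c)
    have h2 := hL (L x) x (L (L c))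
    have h3 := hL x (L x) (L (L c))
    have h4 := hL (L (L x)) (L x) c
    have h5 := hL (L x) (L (L x)) c
    have h6 := hL (L (L x)) x (L c)
    have h7 := hL x (L (L x)) (L c)
    simp only [hL3', map_zero, LinearMap.zero_apply] at *
    linear_combination (2 * h4 + h5 - h1 + h2 - h6) / 3
  ext x
  refine hT _ (LinearMap.ext fun c => ?_)
  have h1 := hL x (L x) c
  have h2 := hL (L x) x c
  have h3 := hL x x (L c)
  simp only [hL2, map_zero, LinearMap.zero_apply] at *
  linear_combination (h1 + h2 - h3) / 2

/-- The third-order partial derivatives of a polynomial at the origin. -/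
def thirdDeriv (C : MvPolynomial (Fin 3) ℂ) (i j k : Fin 3) : ℂ :=
  constantCoeff (pderiv i (pderiv j (pderiv k C)))

/-- The symmetric trilinear form attached to a cubic form. -/
def cubicForm (C : MvPolynomial (Fin 3) ℂ) :
    (Fin 3 → ℂ) →ₗ[ℂ] (Fin 3 → ℂ) →ₗ[ℂ] (Fin 3 → ℂ) →ₗ[ℂ] ℂ :=
  ∑ i, ∑ j, ∑ k, thirdDeriv C i j k • (LinearMap.proj i).smulRight
    ((LinearMap.proj j).smulRight (LinearMap.proj k : (Fin 3 → ℂ) →ₗ[ℂ] ℂ))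

lemma cubicForm_apply (C : MvPolynomial (Fin 3) ℂ) (x y z : Fin 3 → ℂ) :
    cubicForm C x y z = ∑ i, ∑ j, ∑ k, thirdDeriv C i j k * (x i * (y j * z k)) := by
  simp [cubicForm, LinearMap.sum_apply]

lemma pderiv_comm {n : ℕ} (i j : Fin n) (f : MvPolynomial (Fin n) ℂ) :
    pderiv i (pderiv j f) = pderiv j (pderiv i f) := by
  have h : ⁅pderiv (R := ℂ) i, pderiv (R := ℂ) j⁆ = 0 := by
    refine derivation_ext fun k => ?_
    rw [Derivation.commutator_apply, pderiv_X, pderiv_X, Pi.single_apply, Pi.single_apply]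
    split_ifs <;> simp
  have := Derivation.congr_fun h f
  rwa [Derivation.commutator_apply, Derivation.zero_apply, sub_eq_zero] at this

lemma eq_C_constantCoeff_of_isHomogeneous_zero {g : MvPolynomial (Fin 3) ℂ}
    (hg : g.IsHomogeneous 0) : g = C (constantCoeff g) := by
  rw [constantCoeff_eq]
  exact totalDegree_eq_zero_iff_eq_C.1 (Nat.le_zero.1 hg.totalDegree_le)

lemma two_mul_eval_pderiv {C : MvPolynomial (Fin 3) ℂ} (hC : C.IsHomogeneous 3)
    (v : Fin 3 → ℂ) (k : Fin 3) :
    2 * eval v (pderiv k C) = cubicForm C v v (Pi.single k 1) := by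
  have h1 := (hC.pderiv (i := k)).sum_X_mul_pderiv
  have h2 := fun j => ((hC.pderiv (i := k)).pderiv (i := j)).sum_X_mul_pderiv
  have h3 := fun j i => eq_C_constantCoeff_of_isHomogeneous_zero
    ((((hC.pderiv (i := k)).pderiv (i := j)).pderiv (i := i)))
  have e1 := congrArg (eval v) h1
  have e2 := fun j => congrArg (eval v) (h2 j)
  have e3 := fun j i => congrArg (eval v) (h3 j i)
  simp only [map_sum, map_mul, eval_X, eval_C, Nat.add_one_sub_one, nsmul_eq_mul, Nat.cast_ofNat,
    map_ofNat, Nat.cast_one, one_mul] at e1 e2 e3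
  rw [cubicForm_apply, ← e1]
  simp only [← e2, e3, Fin.sum_univ_three, thirdDeriv]
  fin_cases k <;> simp <;> ring

/-- A nonsingular ternary cubic has no linear syzygies among its partial derivatives. -/
theorem linear_syzygy_eq_zero {C : MvPolynomial (Fin 3) ℂ} (hC : C.IsHomogeneous 3)
    (hns : NowhereSingular C) {L : Fin 3 → Fin 3 → ℂ}
    (hL : ∑ j, (∑ k, MvPolynomial.C (L j k) * X k) * pderiv j C = 0) : L = 0 := by
  have h := end_eq_zero_of_trilinear (V := Fin 3 → ℂ) (by simp) (T := cubicForm C)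
    (L := Matrix.toLin' (Matrix.of L)) ?_ ?_
  · have : Matrix.of L = 0 := by simpa using h
    exact this
  · intro v hv
    by_contra hv0
    obtain ⟨k, hk⟩ := hns v hv0
    apply hk
    have := two_mul_eval_pderiv hC v k
    rw [hv] at this
    simpa using this
  · have key : ∀ a b c, ∑ j, (L j a * thirdDeriv C j b c + L j b * thirdDeriv C a j c +
        L j c * thirdDeriv C a b j) = 0 := by
      intro a b c
      have hlin : ∀ i j, pderiv i (∑ k, MvPolynomial.C (L j k) * X k) =
          MvPolynomial.C (L j i) := fun i j => by
        simp [pderiv_X, Pi.single_apply]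
      have hlin0 : ∀ j, constantCoeff (∑ k, MvPolynomial.C (L j k) * X k) = 0 := fun j => by
        simp
      have h3 := congrArg (fun g => constantCoeff (pderiv a (pderiv b (pderiv c g)))) hL
      simp only [map_sum, Derivation.leibniz, hlin, smul_eq_mul, map_add, pderiv_C, mul_zero,
        add_zero, map_mul, hlin0, zero_mul, zero_add, map_zero, constantCoeff_C] at h3
      rw [← h3]
      refine Finset.sum_congr rfl fun j _ => ?_
      simp only [thirdDeriv]
      rw [pderiv_comm j b, pderiv_comm j c]
      ring
    intro x y z
    simp only [cubicForm_apply, Matrix.toLin'_apply, Matrix.mulVec, dotProduct, Matrix.of_apply]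
    have : ∑ a, ∑ b, ∑ c, x a * y b * z c * ∑ j, (L j a * thirdDeriv C j b c +
        L j b * thirdDeriv C a j c + L j c * thirdDeriv C a b j) = 0 := by
      simp [key]
    rw [← this]
    simp only [Fin.sum_univ_three]
    ring

lemma pderiv_mem_pow_idealOfVars {R : Type*} [CommRing R] {n : ℕ} {g : MvPolynomial (Fin 3) R}
    (hg : g ∈ idealOfVars (Fin 3) R ^ (n + 1)) (j : Fin 3) :
    pderiv j g ∈ idealOfVars (Fin 3) R ^ n := by
  rw [mem_pow_idealOfVars_iff'] at hg ⊢
  intro x hx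
  rw [coeff_pderiv, hg, zero_mul]
  simpa using hx

lemma pderiv_mem_locIdeal {R : Type*} [CommRing R] {n : ℕ} {g : MvPolynomial (Fin 3) R}
    {c : Fin 3 → R} (hg : g ∈ locIdeal c (n + 1)) (j : Fin 3) : pderiv j g ∈ locIdeal c n := by
  rw [mem_locIdeal, ← pderiv_translate]
  exact pderiv_mem_pow_idealOfVars hg j

lemma eq_zero_of_isHomogeneous_of_mem {n : ℕ} {g : MvPolynomial (Fin 3) ℂ}
    (hg : g.IsHomogeneous n) (h : g ∈ idealOfVars (Fin 3) ℂ ^ (n + 1)) : g = 0 := by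
  rw [mem_pow_idealOfVars_iff'] at h
  ext x
  rw [coeff_zero]
  by_cases hx : x.degree = n
  · exact h x (by omega)
  · exact hg.coeff_eq_zero hx

lemma mem_idealOfVars_of_constantCoeff {g : MvPolynomial (Fin 3) ℂ} (hg : constantCoeff g = 0) :
    g ∈ idealOfVars (Fin 3) ℂ := by
  rw [← pow_one (idealOfVars (Fin 3) ℂ), mem_pow_idealOfVars_iff']
  intro x hx
  rw [(Finsupp.degree_eq_zero_iff x).1 (by omega)]
  exact hg

lemma sub_constantCoeff_mem (g : MvPolynomial (Fin 3) ℂ) :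
    g - C (constantCoeff g) ∈ idealOfVars (Fin 3) ℂ :=
  mem_idealOfVars_of_constantCoeff (by simp)

lemma homogeneousComponent_one (g : MvPolynomial (Fin 3) ℂ) :
    homogeneousComponent 1 g = ∑ k, C (coeff (Finsupp.single k 1) g) * X k := by
  have h := homogeneousComponent_isHomogeneous 1 g
  have h1 := h.sum_X_mul_pderiv
  rw [one_smul] at h1
  rw [← h1]
  refine Finset.sum_congr rfl fun k _ => ?_
  rw [eq_C_constantCoeff_of_isHomogeneous_zero (h.pderiv (i := k)), constantCoeff_eq,
    coeff_pderiv, coeff_homogeneousComponent, mul_comm]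
  simp

/-- Jacobian syzygies at an ordinary triple point. -/
theorem local_syzygy {f : MvPolynomial (Fin 3) ℂ} (hf : f ∈ idealOfVars (Fin 3) ℂ ^ 3)
    (hns : NowhereSingular (homogeneousComponent 3 f)) {α : MvPolynomial (Fin 3) ℂ}
    {β : Fin 3 → MvPolynomial (Fin 3) ℂ}
    (h : 7 * α * f + ∑ j, β j * pderiv j f = 0) :
    (∀ j, constantCoeff (β j) = 0) ∧ ∀ j k, coeff (Finsupp.single k 1) (β j) =
      if j = k then -(7 / 3) * constantCoeff α else 0 := by
  set I := idealOfVars (Fin 3) ℂ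
  set Q := homogeneousComponent 3 f
  have hQ : Q.IsHomogeneous 3 := homogeneousComponent_isHomogeneous 3 f
  have hfQ : f - Q ∈ I ^ 4 := sub_homogeneousComponent_mem hf
  have hdQ : ∀ j, pderiv j f - pderiv j Q ∈ I ^ 3 := fun j => by
    rw [← map_sub]
    exact pderiv_mem_pow_idealOfVars hfQ j
  have hQ2 : ∀ j, pderiv j Q ∈ I ^ 2 := fun j =>
    pderiv_mem_pow_idealOfVars (homogeneousComponent_mem 3 f) j
  have hns' := fun L => linear_syzygy_eq_zero (L := L) hQ hns
  have h0 : ∑ j, C (constantCoeff (β j)) * pderiv j Q = 0 := by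
    refine eq_zero_of_isHomogeneous_of_mem (n := 2) ?_ ?_
    · refine IsHomogeneous.sum _ _ _ fun j _ => ?_
      simpa using (isHomogeneous_C _ (constantCoeff (β j))).mul (hQ.pderiv (i := j))
    · have e : ∑ j, C (constantCoeff (β j)) * pderiv j Q = -(7 * α * f) -
          ∑ j, ((β j - C (constantCoeff (β j))) * pderiv j Q +
            β j * (pderiv j f - pderiv j Q)) := by
        rw [eq_comm, ← sub_eq_zero, ← neg_eq_zero, ← h, ← sub_eq_zero]
        simp only [Fin.sum_univ_three]
        ring
      rw [e]
      refine sub_mem (neg_mem (Ideal.mul_mem_left _ _ hf)) (sum_mem fun j _ => add_mem ?_ ?_)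
      · rw [show (2 + 1) = 1 + 2 from rfl, pow_add, pow_one]
        exact Ideal.mul_mem_mul (sub_constantCoeff_mem _) (hQ2 j)
      · exact Ideal.mul_mem_left _ _ (hdQ j)
  have hβ0 : ∀ j, constantCoeff (β j) = 0 := by
    have := hns' (fun j k => if k = 0 then constantCoeff (β j) else 0) (by
      rw [← mul_zero (X 0), ← h0, Finset.mul_sum]
      refine Finset.sum_congr rfl fun j _ => ?_
      simp only [Fin.sum_univ_three]
      simp
      ring)
    intro j
    simpa using congrFun (congrFun this j) 0
  refine ⟨hβ0, ?_⟩
  have hβ1 : ∀ j, β j ∈ I ^ 1 := fun j => by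
    rw [pow_one]
    exact mem_idealOfVars_of_constantCoeff (hβ0 j)
  have h1 : 7 * C (constantCoeff α) * Q + ∑ j, homogeneousComponent 1 (β j) * pderiv j Q = 0 := by
    refine eq_zero_of_isHomogeneous_of_mem (n := 3) ?_ ?_
    · refine IsHomogeneous.add ?_ (IsHomogeneous.sum _ _ _ fun j _ => ?_)
      · have : (7 * C (constantCoeff α) : MvPolynomial (Fin 3) ℂ) = C (7 * constantCoeff α) := by
          rw [C_mul, map_ofNat C 7]
        rw [this]
        simpa using (isHomogeneous_C _ (7 * constantCoeff α)).mul hQ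
      · exact (homogeneousComponent_isHomogeneous 1 (β j)).mul (hQ.pderiv (i := j))
    · have e : 7 * C (constantCoeff α) * Q + ∑ j, homogeneousComponent 1 (β j) * pderiv j Q =
          -(7 * ((α - C (constantCoeff α)) * Q) + 7 * α * (f - Q) +
          ∑ j, ((β j - homogeneousComponent 1 (β j)) * pderiv j Q +
            β j * (pderiv j f - pderiv j Q))) := by
        rw [eq_comm, ← sub_eq_zero, ← neg_eq_zero, ← h, ← sub_eq_zero]
        simp only [Fin.sum_univ_three]
        ring
      rw [e]
      refine neg_mem (add_mem (add_mem (Ideal.mul_mem_left _ _ ?_) (Ideal.mul_mem_left _ _ hfQ))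
        (sum_mem fun j _ => add_mem ?_ ?_))
      · rw [show (3 + 1) = 1 + 3 from rfl, pow_add, pow_one]
        exact Ideal.mul_mem_mul (sub_constantCoeff_mem _) (homogeneousComponent_mem 3 f)
      · rw [show (3 + 1) = 2 + 2 from rfl, pow_add]
        exact Ideal.mul_mem_mul (sub_homogeneousComponent_mem (hβ1 j)) (hQ2 j)
      · rw [show (3 + 1) = 1 + 3 from rfl, pow_add]
        exact Ideal.mul_mem_mul (hβ1 j) (hdQ j)
  have hE : ∑ j, X j * pderiv j Q = 3 * Q := by
    rw [hQ.sum_X_mul_pderiv, nsmul_eq_mul, Nat.cast_ofNat]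
  have hL := hns' (fun j k => coeff (Finsupp.single k 1) (β j) +
    if j = k then 7 / 3 * constantCoeff α else 0) (by
      have e : C (7 / 3 * constantCoeff α) * (3 : MvPolynomial (Fin 3) ℂ) =
          7 * C (constantCoeff α) := by
        rw [← map_ofNat C 3, ← map_ofNat C 7, ← C_mul, ← C_mul]
        congr 1
        ring
      rw [← h1, mul_assoc 7, ← mul_assoc, ← e, mul_assoc, ← hE, Finset.mul_sum,
        ← Finset.sum_add_distrib]
      refine Finset.sum_congr rfl fun j _ => ?_
      rw [homogeneousComponent_one]
      simp only [map_add, add_mul, Finset.sum_add_distrib]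
      rw [add_comm]
      congr 1
      rw [Finset.sum_eq_single j]
      · simp
        ring
      · intro b _ hb
        simp [hb.symm]
      · simp)
  intro j k
  have := congrFun (congrFun hL j) k
  simp only [Pi.zero_apply] at this
  split_ifs with hjk
  · rw [if_pos hjk] at this
    linear_combination this
  · rwa [if_neg hjk, add_zero] at this

lemma card_lowExponents (e : ℕ) : (lowExponents e).card = (e + 2).choose 3 := by
  rw [lowExponents, Finset.card_biUnion]
  · simp only [Finset.card_finsuppAntidiag_nat_eq_choose, Finset.card_univ, Fintype.card_fin]
    induction e with
    | zero => rfl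
    | succ e ih =>
      rw [Finset.sum_range_succ, ih, show e + 1 + 2 = (e + 2) + 1 from rfl,
        Nat.choose_succ_succ (e + 2) 2, add_comm]
      congr 1
      rw [show 3 + e - 1 = e + 2 by omega, Nat.choose_symm_add]
  · intro m _ n _ hmn
    rw [Function.onFun, Finset.disjoint_left]
    intro a ha hb
    rw [Finset.mem_finsuppAntidiag] at ha hb
    exact hmn (ha.1.symm.trans hb.1)

lemma finrank_restrictTotalDegree (m : ℕ) :
    Module.finrank ℂ (restrictTotalDegree (Fin 3) ℂ m) = (m + 3).choose 3 := by
  rw [restrictTotalDegree, Module.finrank_eq_nat_card_basis (basisRestrictSupport ℂ _),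
    ← card_lowExponents (m + 1)]
  exact Nat.subtype_card _ fun a => by
    rw [mem_lowExponents, Nat.lt_succ_iff]
    rfl

/-- The functional on jets as a linear function of its coefficients. -/
def jetHom (e : ℕ) (c : Fin 3 → ℂ) :
    (lowExponents e → ℂ) →ₗ[ℂ] MvPolynomial (Fin 3) ℂ →ₗ[ℂ] ℂ :=
  ∑ a, (LinearMap.proj a).smulRight ((lcoeff ℂ a.1).comp (translate c).toLinearMap)

/-- Extension by zero of a family of coefficients. -/
def extendCoeff {e : ℕ} (l : lowExponents e → ℂ) (a : Fin 3 →₀ ℕ) : ℂ :=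
  if h : a ∈ lowExponents e then l ⟨a, h⟩ else 0

lemma jetHom_apply {e : ℕ} (c : Fin 3 → ℂ) (l : lowExponents e → ℂ)
    (g : MvPolynomial (Fin 3) ℂ) : jetHom e c l g = jet e c (extendCoeff l) g := by
  rw [jet_apply, ← Finset.sum_coe_sort]
  simp [jetHom, LinearMap.sum_apply, extendCoeff]

section
variable {ι : Type*} [Fintype ι] [DecidableEq ι]

theorem exists_ne_zero_map_eq_zero {f : MvPolynomial (Fin 3) ℂ}
    (hf : f.totalDegree ≤ 7) {c : ι → Fin 3 → ℂ} (hfc : ∀ i, f ∈ locIdeal (c i) 3)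
    (hc : Function.Injective c) {M e t : ℕ} (he : e ≤ 3) (he0 : 0 < e) (het : 7 * e + 2 < 3 * t)
    (hM : ∀ i, LocallyFinite f (c i) M) (K : Submodule ℂ (ι → lowExponents e → ℂ))
    (hK : ∀ l ∈ K, ∀ i j g, jetHom e (c i) (l i) (pderiv j f * g) = 0)
    {U : Type*} [AddCommGroup U] [Module ℂ U] [FiniteDimensional ℂ U]
    (Z : U →ₗ[ℂ] MvPolynomial (Fin 3) ℂ) (hZt : ∀ u, (Z u).totalDegree ≤ t)
    (hZ : ∀ u, ∀ l ∈ K, ∀ i, jetHom e (c i) (l i) (Z u) = 0)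
    (hdim : (t + 3).choose 3 < Module.finrank ℂ U + Module.finrank ℂ K) :
    ∃ u, u ≠ 0 ∧ Z u = 0 := by
  by_contra! hinj
  set Z' : U →ₗ[ℂ] restrictTotalDegree (Fin 3) ℂ t :=
    Z.codRestrict _ fun u => (mem_restrictTotalDegree _ _ _).2 (hZt u)
  have hZ' : Function.Injective Z' := by
    rw [← LinearMap.ker_eq_bot, LinearMap.ker_eq_bot']
    intro u hu
    by_contra h0
    exact hinj u h0 (congrArg Subtype.val hu)
  set Ψ : K →ₗ[ℂ] Module.Dual ℂ (restrictTotalDegree (Fin 3) ℂ t) :=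
    ((LinearMap.lcomp ℂ ℂ (restrictTotalDegree (Fin 3) ℂ t).subtype).comp
      (∑ i, (jetHom e (c i)).comp (LinearMap.proj i))).comp K.subtype
  have hΨ : ∀ l g, Ψ l g = ∑ i, jetHom e (c i) (l.1 i) g.1 := fun l g => by
    simp [Ψ, LinearMap.sum_apply]
  have hΨinj : Function.Injective Ψ := by
    rw [← LinearMap.ker_eq_bot, LinearMap.ker_eq_bot']
    intro l hl
    ext i a
    have := jet_eq_zero_of_sum_eq_zero hf hfc hc he he0 het hM
      (l := fun i => extendCoeff (l.1 i)) (fun i j g => by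
        rw [← jetHom_apply]; exact hK l.1 l.2 i j g) (fun g hg => by
        have h1 := hΨ l ⟨g, (mem_restrictTotalDegree _ _ _).2 hg⟩
        rw [hl] at h1
        simp only [← jetHom_apply]
        exact h1.symm) i a.2
    simpa [extendCoeff] using this
  have hrange : LinearMap.range Ψ ≤ (LinearMap.range Z').dualAnnihilator := by
    rintro _ ⟨l, rfl⟩
    rw [Submodule.mem_dualAnnihilator]
    rintro _ ⟨u, rfl⟩
    rw [hΨ]
    exact Finset.sum_eq_zero fun i _ => hZ u l.1 l.2 i
  have h1 := Submodule.finrank_mono hrange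
  have h2 := Subspace.finrank_add_finrank_dualAnnihilator_eq (LinearMap.range Z')
  rw [LinearMap.finrank_range_of_inj hΨinj] at h1
  rw [LinearMap.finrank_range_of_inj hZ', finrank_restrictTotalDegree] at h2
  omega

/-- The triple points of a septic are not too coplanar. -/
theorem eq_zero_of_eval_eq_zero (hι : Fintype.card ι = 17) {f : MvPolynomial (Fin 3) ℂ}
    (hf : f.totalDegree ≤ 7) {c : ι → Fin 3 → ℂ} (hfc : ∀ i, f ∈ locIdeal (c i) 3)
    (hc : Function.Injective c) {M : ℕ} (hM : ∀ i, LocallyFinite f (c i) M)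
    {h : MvPolynomial (Fin 3) ℂ} (hdeg : h.totalDegree ≤ 1) (hh : ∀ i, eval (c i) h = 0) :
    h = 0 := by
  by_contra h0
  have hvan : ∀ i (l : lowExponents 1 → ℂ), ∀ g ∈ locIdeal (c i) 1, jetHom 1 (c i) l g = 0 :=
    fun i l g hg => by rw [jetHom_apply, jet_eq_zero_of_mem hg]
  obtain ⟨u, hu, hu0⟩ := exists_ne_zero_map_eq_zero (e := 1) (t := 4) hf hfc hc (by norm_num)
    (by norm_num) (by norm_num) hM ⊤
    (fun l _ i j g => hvan i _ _ (Ideal.mul_mem_right _ _ (locIdeal_mono _ (by norm_num)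
      (pderiv_mem_locIdeal (hfc i) j))))
    ((LinearMap.mulLeft ℂ h).comp (restrictTotalDegree (Fin 3) ℂ 3).subtype)
    (fun u => by
      refine (totalDegree_mul _ _).trans ?_
      have := (mem_restrictTotalDegree _ _ _).1 u.2
      simp only [Submodule.subtype_apply]
      omega)
    (fun u l _ i => hvan i _ _ (Ideal.mul_mem_right _ _ (mem_locIdeal_one.2 (hh i))))
    (by
      rw [finrank_restrictTotalDegree, finrank_top, Module.finrank_pi_fintype]
      simp [hι, card_lowExponents, Nat.choose])
  simp only [LinearMap.comp_apply, LinearMap.mulLeft_apply, Submodule.subtype_apply, mul_eq_zero,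
    h0, false_or] at hu0
  exact hu (Subtype.ext hu0)
end

lemma totalDegree_pderiv_le {g : MvPolynomial (Fin 3) ℂ} {n : ℕ} (hg : g.totalDegree ≤ n + 1)
    (k : Fin 3) : (pderiv k g).totalDegree ≤ n := by
  refine Finset.sup_le fun a ha => ?_
  rw [mem_support_iff, coeff_pderiv] at ha
  have h := (le_totalDegree (mem_support_iff.2 (left_ne_zero_of_mul ha))).trans hg
  rw [Finsupp.sum_fintype _ _ fun _ => rfl] at h ⊢
  simp only [Finsupp.add_apply, Finset.sum_add_distrib] at h
  have : ∑ x, (Finsupp.single k 1 : Fin 3 →₀ ℕ) x = 1 := by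
    rw [← Finsupp.degree_eq_sum, Finsupp.degree_single]
  omega

lemma totalDegree_euler_le {f : MvPolynomial (Fin 3) ℂ} {n : ℕ} (hf : f.totalDegree ≤ n + 1) :
    ((n + 1) • f - ∑ j, X j * pderiv j f).totalDegree ≤ n := by
  have h : (n + 1) • f - ∑ j, X j * pderiv j f =
      ∑ a ∈ f.support, monomial a ((n + 1 - a.degree : ℂ) * coeff a f) := by
    conv_lhs => rw [f.as_sum]
    simp only [map_sum, Finset.mul_sum, X_mul_pderiv_monomial, Finset.smul_sum]
    rw [Finset.sum_comm, ← Finset.sum_sub_distrib]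
    refine Finset.sum_congr rfl fun a _ => ?_
    rw [← Finset.sum_smul, ← Finsupp.degree_eq_sum, sub_mul, map_sub, ← nsmul_eq_mul,
      ← map_nsmul]
    congr 2
    · rw [nsmul_eq_mul]
      push_cast
      rfl
    · exact (map_nsmul _ _ _).symm
  rw [h]
  refine (totalDegree_finsetSum _ _).trans (Finset.sup_le fun a ha => ?_)
  have ha' := (le_totalDegree ha).trans hf
  rw [Finsupp.sum_fintype _ _ fun _ => rfl, ← Finsupp.degree_eq_sum] at ha'
  rcases ha'.eq_or_lt with h1 | h1
  · rw [h1]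
    simp
  · refine (totalDegree_monomial_le _ _).trans ?_
    rw [Finsupp.sum_fintype _ _ fun _ => rfl]
    simp only [id, ← Finsupp.degree_eq_sum]
    omega

/-- The trapezoidal rule is exact for quadratic polynomials. -/
lemma trapezoid {g : MvPolynomial (Fin 3) ℂ} (hg : g.totalDegree ≤ 2) (c d : Fin 3 → ℂ) :
    2 * (eval d g - eval c g) =
      ∑ k, (eval c (pderiv k g) + eval d (pderiv k g)) * (d k - c k) := by
  have key : ∀ a : Fin 3 →₀ ℕ, a.degree ≤ 2 → 2 * (eval d (monomial a 1) - eval c (monomial a 1)) =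
      ∑ k, (eval c (pderiv k (monomial a 1)) + eval d (pderiv k (monomial a 1))) *
        (d k - c k) := by
    intro a ha
    rw [Finsupp.degree_eq_sum, Fin.sum_univ_three] at ha
    simp only [pderiv_monomial, eval_monomial, Finsupp.prod_fintype _ _ fun _ => pow_zero _,
      Fin.sum_univ_three, Fin.prod_univ_three, Finsupp.coe_tsub, Pi.sub_apply,
      Finsupp.single_apply]
    generalize a 0 = x at *
    generalize a 1 = y at *
    generalize a 2 = z at *
    have hx : x ≤ 2 := by omega
    have hy : y ≤ 2 := by omega
    have hz : z ≤ 2 := by omega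
    interval_cases x <;> interval_cases y <;> interval_cases z <;> first | omega | (simp; try ring_nf; try simp)
  rw [g.as_sum]
  simp only [map_sum]
  rw [← Finset.sum_sub_distrib, Finset.mul_sum]
  simp only [← Finset.sum_add_distrib, Finset.sum_mul]
  rw [Finset.sum_comm]
  refine Finset.sum_congr rfl fun a ha => ?_
  have ha' := (le_totalDegree ha).trans hg
  rw [Finsupp.sum_fintype _ _ fun _ => rfl, ← Finsupp.degree_eq_sum] at ha'
  have e : (monomial a (coeff a g) : MvPolynomial (Fin 3) ℂ) = coeff a g • monomial a 1 := by
    simp [smul_monomial]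
  rw [e]
  simp only [Derivation.map_smul, smul_eval]
  rw [← mul_sub, mul_left_comm, key a ha', Finset.mul_sum]
  exact Finset.sum_congr rfl fun k _ => by ring

lemma eq_C_of_pderiv_eq_zero {g : MvPolynomial (Fin 3) ℂ} (hg : ∀ k, pderiv k g = 0) :
    g = C (constantCoeff g) := by
  ext a
  rw [coeff_C]
  split_ifs with h
  · rw [← h, constantCoeff_eq]
  · obtain ⟨k, hk⟩ : ∃ k, a k ≠ 0 := by
      by_contra! h1
      exact h (Finsupp.ext fun k => (h1 k).symm)
    have h1 := congrArg (coeff (a - Finsupp.single k 1)) (hg k)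
    rw [coeff_pderiv, coeff_zero, Finsupp.sub_add_single_one_cancel hk] at h1
    exact (mul_eq_zero.1 h1).resolve_right (by norm_cast)

lemma eval_pderiv_eq_coeff (c : Fin 3 → ℂ) (k : Fin 3) (g : MvPolynomial (Fin 3) ℂ) :
    eval c (pderiv k g) = coeff (Finsupp.single k 1) (translate c g) := by
  rw [← constantCoeff_translate, ← pderiv_translate, constantCoeff_eq, coeff_pderiv]
  simp

section
variable {ι : Type*} [Fintype ι] [DecidableEq ι]

/-- The linear system of weights is inconsistent with nonzero `κ` at a point in the affine span
of the others. -/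
lemma weight_eq_zero {c : ι → Fin 3 → ℂ} {κ : ι → ℂ} {A : ι → Fin 3 → ℂ}
    (hR : ∀ i j, i ≠ j → ∑ k, A i k * (c i k - c j k) = (10 * κ i + 4 * κ j) / 3)
    (p : ι) (hcard : Fintype.card {i // i ≠ p} = 17) {q : {i // i ≠ p} → ℂ} (hq : ∑ i, q i = 1)
    (hqc : ∀ k, ∑ i, q i * c i k = c p k) : κ p = 0 := by
  set σ := ∑ i, q i * κ i
  have hA : ∀ i : ι, ∑ j, q j * ∑ k, A i k * (c i k - c j k) = ∑ k, A i k * (c i k - c p k) := by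
    intro i
    simp only [Finset.mul_sum]
    rw [Finset.sum_comm]
    refine Finset.sum_congr rfl fun k _ => ?_
    rw [← hqc k, mul_sub, Finset.mul_sum]
    have : A i k * c i k = ∑ j, q j * (A i k * c i k) := by rw [← Finset.sum_mul, hq, one_mul]
    rw [this, ← Finset.sum_sub_distrib]
    exact Finset.sum_congr rfl fun j _ => by ring
  have h1 : 10 * κ p + 4 * σ = 0 := by
    have h := hA p
    simp only [sub_self, mul_zero, Finset.sum_const_zero] at h
    have h' : ∑ j : {i // i ≠ p}, q j * ∑ k, A p k * (c p k - c j k) =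
        (10 * κ p * ∑ j, q j + 4 * σ) / 3 := by
      rw [Finset.mul_sum, Finset.mul_sum, ← Finset.sum_add_distrib, Finset.sum_div]
      exact Finset.sum_congr rfl fun j _ => by rw [hR p j j.2.symm]; ring
    rw [h', hq] at h
    linear_combination 3 * h
  have h2 : ∀ i, 14 * (q i * κ i) = 4 * (σ - κ p) := by
    intro i
    have h := hA i
    rw [hR i p i.2] at h
    have h' : ∑ j : {i // i ≠ p}, q j * ∑ k, A i k * (c i k - c j k) =
        ∑ j : {i // i ≠ p}, (q j * ((10 * κ i + 4 * κ j) / 3) -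
          if j = i then q i * (14 * κ i / 3) else 0) := by
      refine Finset.sum_congr rfl fun j _ => ?_
      split_ifs with hj
      · rw [hj]
        simp only [sub_self, mul_zero, Finset.sum_const_zero]
        ring
      · rw [hR i j fun h => hj (Subtype.ext h.symm), sub_zero]
    have h'' : ∑ j : {i // i ≠ p}, q j * ((10 * κ i + 4 * κ j) / 3) =
        (10 * κ i * ∑ j, q j + 4 * σ) / 3 := by
      rw [Finset.mul_sum, Finset.mul_sum, ← Finset.sum_add_distrib, Finset.sum_div]
      exact Finset.sum_congr rfl fun j _ => by ring
    rw [h', Finset.sum_sub_distrib, h'', hq, Finset.sum_ite_eq' Finset.univ i] at h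
    simp only [Finset.mem_univ, if_true] at h
    linear_combination -3 * h
  have h3 : 14 * σ = 17 * (4 * (σ - κ p)) := by
    rw [Finset.mul_sum, Finset.sum_congr rfl fun i _ => h2 i, Finset.sum_const,
      Finset.card_univ, hcard, nsmul_eq_mul]
    norm_num
  linear_combination (54 / 4 * h1 + h3) / 203

lemma exists_affine_combination {c : ι → Fin 3 → ℂ} {p : ι}
    (hspan : ∀ h : MvPolynomial (Fin 3) ℂ, h.totalDegree ≤ 1 →
      (∀ i : {i // i ≠ p}, eval (c i) h = 0) → h = 0) :
    ∃ q : {i // i ≠ p} → ℂ, ∑ i, q i = 1 ∧ ∀ k, ∑ i, q i * c i k = c p k := by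
  set w : ι → Fin 4 → ℂ := fun i => Fin.cons 1 (c i)
  have hmem : w p ∈ Submodule.span ℂ (Set.range fun i : {i // i ≠ p} => w i) := by
    by_contra hn
    obtain ⟨φ, hφ, hle⟩ := Submodule.exists_le_ker_of_notMem hn
    set h : MvPolynomial (Fin 3) ℂ := C (φ fun j => if 0 = j then 1 else 0) +
      ∑ k : Fin 3, C (φ fun j => if k.succ = j then 1 else 0) * X k
    have heval : ∀ i, eval (c i) h = φ (w i) := by
      intro i
      rw [LinearMap.pi_apply_eq_sum_univ φ (w i), Fin.sum_univ_succ]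
      simp [h, w, mul_comm]
    have hdeg : h.totalDegree ≤ 1 := by
      refine (totalDegree_add _ _).trans (max_le (by simp) ?_)
      refine (totalDegree_finsetSum _ _).trans (Finset.sup_le fun k _ => ?_)
      refine (totalDegree_mul _ _).trans ?_
      simp
    have h0 := hspan h hdeg fun i => by
      rw [heval]
      exact hle (Submodule.subset_span ⟨i, rfl⟩)
    apply hφ
    rw [← heval, h0, map_zero]
  obtain ⟨q, hq⟩ := (Submodule.mem_span_range_iff_exists_fun ℂ).1 hmem
  refine ⟨q, ?_, fun k => ?_⟩
  · simpa [w] using congrFun hq 0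
  · simpa [w] using congrFun hq k.succ

lemma eq_zero_of_gradient_eq_zero {ι : Type*} {c : ι → Fin 3 → ℂ} (i₀ : ι)
    (hspan : ∀ h : MvPolynomial (Fin 3) ℂ, h.totalDegree ≤ 1 → (∀ i, eval (c i) h = 0) → h = 0)
    {g : MvPolynomial (Fin 3) ℂ} (hg : g.totalDegree ≤ 2) (h0 : ∀ i, eval (c i) g = 0)
    (h1 : ∀ i k, eval (c i) (pderiv k g) = 0) : g = 0 := by
  have h2 := eq_C_of_pderiv_eq_zero fun k =>
    hspan _ (totalDegree_pderiv_le hg k) fun i => h1 i k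
  have h3 := h0 i₀
  rw [h2, eval_C] at h3
  rw [h2, h3, C_0]

/-- A septic has at most seventeen triple points of the type considered. -/
theorem card_ne_eighteen (hι : Fintype.card ι = 18) {f : MvPolynomial (Fin 3) ℂ}
    (hf : f.totalDegree ≤ 7) {c : ι → Fin 3 → ℂ} (hfc : ∀ i, f ∈ locIdeal (c i) 3)
    (hc : Function.Injective c) {M : ℕ} (hM : ∀ i, LocallyFinite f (c i) M)
    (hns : ∀ i, NowhereSingular (homogeneousComponent 3 (translate (c i) f))) : False := by
  have hcard : ∀ p : ι, Fintype.card {i // i ≠ p} = 17 := fun p => by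
    simp [Fintype.card_subtype_compl, hι]
  have hspan : ∀ p : ι, ∀ h : MvPolynomial (Fin 3) ℂ, h.totalDegree ≤ 1 →
      (∀ i : {i // i ≠ p}, eval (c i) h = 0) → h = 0 := fun p h hdeg hh =>
    eq_zero_of_eval_eq_zero (hcard p) hf (c := fun i : {i // i ≠ p} => c i) (fun i => hfc i)
      (hc.comp Subtype.val_injective) (fun i => hM i) hdeg hh
  obtain ⟨i₀⟩ : Nonempty ι := Fintype.card_pos_iff.1 (by omega)
  set f₀ := (6 + 1) • f - ∑ j, X j * pderiv j f
  have hf₀ : f₀.totalDegree ≤ 6 := totalDegree_euler_le hf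
  set Φ : (ι → lowExponents 3 → ℂ) →ₗ[ℂ] ι × Fin 3 → ℂ := LinearMap.pi fun x =>
    ((jetHom 3 (c x.1)).flip (pderiv x.2 f)).comp (LinearMap.proj x.1)
  have hvan : ∀ i (l : lowExponents 3 → ℂ), ∀ g ∈ locIdeal (c i) 3, jetHom 3 (c i) l g = 0 :=
    fun i l g hg => by rw [jetHom_apply, jet_eq_zero_of_mem hg]
  have hK : ∀ l ∈ LinearMap.ker Φ, ∀ i j g, jetHom 3 (c i) (l i) (pderiv j f * g) = 0 := by
    intro l hl i j g
    have h1 : jetHom 3 (c i) (l i) (pderiv j f) = 0 := congrFun hl (i, j)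
    have h2 : pderiv j f * g = eval (c i) g • pderiv j f +
        pderiv j f * (g - C (eval (c i) g)) := by
      rw [smul_eq_C_mul]
      ring
    rw [h2, map_add, map_smul, h1, smul_zero, zero_add]
    exact hvan i _ _ (mul_mem_locIdeal (M := 2) (N := 1) (pderiv_mem_locIdeal (hfc i) j)
      (mem_locIdeal_one.2 (by simp)))
  have hKdim : 126 ≤ Module.finrank ℂ (LinearMap.ker Φ) := by
    have h1 := Φ.finrank_range_add_finrank_ker
    have h2 := Submodule.finrank_le (LinearMap.range Φ)
    rw [Module.finrank_pi_fintype] at h1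
    simp [hι, card_lowExponents, Nat.choose] at h1 h2
    omega
  set Z : (Fin 4 → restrictTotalDegree (Fin 3) ℂ 2) →ₗ[ℂ] MvPolynomial (Fin 3) ℂ :=
    (LinearMap.mulLeft ℂ f₀).comp ((Submodule.subtype _).comp (LinearMap.proj 0)) +
    ∑ j : Fin 3, (LinearMap.mulLeft ℂ (pderiv j f)).comp
      ((Submodule.subtype _).comp (LinearMap.proj j.succ))
  have hZ : ∀ u, Z u = f₀ * (u 0).1 + ∑ j : Fin 3, pderiv j f * (u j.succ).1 := fun u => by
    simp [Z, LinearMap.sum_apply]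
  have hu2 : ∀ (u : Fin 4 → restrictTotalDegree (Fin 3) ℂ 2) j, (u j).1.totalDegree ≤ 2 :=
    fun u j => (mem_restrictTotalDegree _ _ _).1 (u j).2
  obtain ⟨u, hu, hZu⟩ := exists_ne_zero_map_eq_zero (e := 3) (t := 8) hf hfc hc (by norm_num)
    (by norm_num) (by norm_num) hM (LinearMap.ker Φ) hK Z
    (fun u => by
      rw [hZ]
      refine (totalDegree_add _ _).trans (max_le ((totalDegree_mul _ _).trans ?_)
        ((totalDegree_finsetSum _ _).trans (Finset.sup_le fun j _ =>
          (totalDegree_mul _ _).trans ?_)))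
      · have := hu2 u 0
        omega
      · have := hu2 u j.succ
        have := totalDegree_pderiv_le (n := 6) hf j
        omega)
    (fun u l hl i => by
      rw [hZ, map_add, map_sum, Finset.sum_eq_zero fun j _ => hK l hl i j _, add_zero, sub_mul,
        map_sub, Finset.sum_mul, map_sum, Finset.sum_eq_zero fun j _ => ?_, sub_zero]
      · exact hvan i _ _ (Ideal.mul_mem_right _ _ (nsmul_mem (hfc i) _))
      · rw [mul_comm (X j), mul_assoc]
        exact hK l hl i j _)
    (by
      rw [Module.finrank_pi_fintype]
      simp only [finrank_restrictTotalDegree, Finset.sum_const, Finset.card_univ, Fintype.card_fin]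
      simp only [Nat.choose]
      norm_num
      omega)
  set a : MvPolynomial (Fin 3) ℂ := (u 0).1
  set b : Fin 3 → MvPolynomial (Fin 3) ℂ := fun j => (u j.succ).1
  have hsyz : 7 * a * f + ∑ j, (b j - a * X j) * pderiv j f = 0 := by
    rw [← hZu, hZ]
    simp only [f₀, b, a, Fin.sum_univ_three, nsmul_eq_mul]
    push_cast
    ring
  have hloc := fun i => local_syzygy (f := translate (c i) f) (hfc i) (hns i)
    (α := translate (c i) a) (β := fun j => translate (c i) (b j - a * X j)) (by
      have := congrArg (translate (c i)) hsyz
      simpa only [map_add, map_mul, map_sum, map_zero, map_ofNat, pderiv_translate] using this)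
  have hval : ∀ i j, eval (c i) (b j) = eval (c i) a * c i j := fun i j => by
    have := (hloc i).1 j
    simp only [constantCoeff_translate, map_sub, map_mul, eval_X] at this
    exact sub_eq_zero.1 this
  have hder : ∀ i j k, eval (c i) (pderiv k (b j)) = eval (c i) (pderiv k a) * c i j +
      if j = k then -(4 / 3) * eval (c i) a else 0 := fun i j k => by
    have := (hloc i).2 j k
    rw [← eval_pderiv_eq_coeff, constantCoeff_translate] at this
    simp only [map_sub, Derivation.leibniz, pderiv_X, smul_eq_mul, map_add, map_mul, eval_X,
      Pi.single_apply] at this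
    split_ifs at this ⊢
    · simp only [map_one] at this
      linear_combination this
    · simp only [map_zero] at this
      linear_combination this
  have hR : ∀ i i', i ≠ i' → ∑ k, eval (c i) (pderiv k a) * (c i k - c i' k) =
      (10 * eval (c i) a + 4 * eval (c i') a) / 3 := by
    intro i i' hii
    obtain ⟨j, hj⟩ : ∃ j, c i j - c i' j ≠ 0 := by
      by_contra! h
      exact hii (hc (funext fun s => sub_eq_zero.1 (h s)))
    have h1 : 2 * (eval (c i) a - eval (c i') a) = _ := trapezoid (hu2 u 0) (c i') (c i)
    have h2 := trapezoid (hu2 u j.succ) (c i') (c i)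
    change 2 * (eval (c i) (b j) - eval (c i') (b j)) = ∑ k, (eval (c i') (pderiv k (b j)) +
      eval (c i) (pderiv k (b j))) * _ at h2
    simp only [hval, hder] at h2
    have h3 : ∑ k, (eval (c i') (pderiv k a) * c i' j +
        (if j = k then -(4 / 3) * eval (c i') a else 0) + (eval (c i) (pderiv k a) * c i j +
        if j = k then -(4 / 3) * eval (c i) a else 0)) * (c i k - c i' k) =
        c i' j * (∑ k, (eval (c i') (pderiv k a) + eval (c i) (pderiv k a)) * (c i k - c i' k)) +
        (c i j - c i' j) * (∑ k, eval (c i) (pderiv k a) * (c i k - c i' k)) -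
        4 / 3 * (eval (c i') a + eval (c i) a) * (c i j - c i' j) := by
      fin_cases j <;> simp [Fin.sum_univ_three] <;> ring
    rw [h3] at h2
    apply mul_left_cancel₀ hj
    linear_combination c i' j * h1 - h2
  have hκ : ∀ i, eval (c i) a = 0 := fun p => by
    obtain ⟨q, hq, hqc⟩ := exists_affine_combination (hspan p)
    exact weight_eq_zero hR p (hcard p) hq hqc
  have hA : ∀ i k, eval (c i) (pderiv k a) = 0 := by
    intro i k
    have h := hspan i (∑ k, C (eval (c i) (pderiv k a)) * (C (c i k) - X k)) ?_ ?_
    · have h1 := congrArg (pderiv k) h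
      simp only [map_sum, Derivation.leibniz, map_sub, pderiv_C, pderiv_X, smul_eq_mul, mul_zero,
        add_zero, zero_sub, Pi.single_apply] at h1
      simpa using h1
    · refine (totalDegree_finsetSum _ _).trans (Finset.sup_le fun k _ => ?_)
      refine (totalDegree_mul _ _).trans ?_
      rw [totalDegree_C, zero_add]
      exact (totalDegree_sub _ _).trans (by simp)
    · intro j
      have := hR i j j.2.symm
      simp only [hκ] at this
      simpa using this
  have hspan' : ∀ h : MvPolynomial (Fin 3) ℂ, h.totalDegree ≤ 1 →
      (∀ i, eval (c i) h = 0) → h = 0 := fun h hdeg hh => hspan i₀ h hdeg fun i => hh i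
  have ha : a = 0 := eq_zero_of_gradient_eq_zero i₀ hspan' (hu2 u 0) hκ hA
  have hb : ∀ j, b j = 0 := fun j =>
    eq_zero_of_gradient_eq_zero i₀ hspan' (hu2 u j.succ) (fun i => by
      rw [hval, hκ, zero_mul]) fun i k => by
      rw [hder, hA, hκ]
      simp
  refine hu (funext fun j => Subtype.ext ?_)
  refine Fin.cases ha hb j

end

section General
variable {σ τ : Type*}

/-- Chain rule. -/
lemma pderiv_aeval [Fintype σ] (w : σ → MvPolynomial τ ℂ) (k : τ) (f : MvPolynomial σ ℂ) :
    pderiv k (aeval w f) = ∑ i, aeval w (pderiv i f) * pderiv k (w i) := by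
  classical
  induction f using MvPolynomial.induction_on with
  | C r => simp [algHom_C]
  | add f g hf hg => simp only [map_add, hf, hg, add_mul, Finset.sum_add_distrib]
  | mul_X f j hf =>
    simp only [map_mul, aeval_X, Derivation.leibniz, hf, smul_eq_mul, map_add, pderiv_X, add_mul,
      Finset.sum_add_distrib, Pi.single_apply]
    congr 1
    · rw [Finset.sum_eq_single j (fun b _ hb => by simp [hb.symm]) (by simp)]
      simp
    · rw [Finset.mul_sum]
      exact Finset.sum_congr rfl fun i _ => by ring

lemma aeval_mem_pow_idealOfVars {w : σ → MvPolynomial τ ℂ} (hw : ∀ i, w i ∈ idealOfVars τ ℂ)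
    {m : ℕ} {f : MvPolynomial σ ℂ} (hf : f ∈ idealOfVars σ ℂ ^ m) :
    aeval w f ∈ idealOfVars τ ℂ ^ m := by
  have h := Ideal.mem_map_of_mem (aeval w : MvPolynomial σ ℂ →ₐ[ℂ] MvPolynomial τ ℂ) hf
  rw [Ideal.map_pow] at h
  refine Ideal.pow_right_mono ?_ m h
  rw [idealOfVars, Ideal.map_span, Ideal.span_le]
  rintro _ ⟨_, ⟨i, rfl⟩, rfl⟩
  simpa using hw i

lemma mem_pow_of_isHomogeneous {m : ℕ} {g : MvPolynomial σ ℂ} (hg : g.IsHomogeneous m) :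
    g ∈ idealOfVars σ ℂ ^ m := by
  rw [mem_pow_idealOfVars_iff']
  exact fun x hx => hg.coeff_eq_zero hx.ne

lemma totalDegree_aeval_le {w : σ → MvPolynomial τ ℂ} (hw : ∀ i, (w i).totalDegree ≤ 1)
    (f : MvPolynomial σ ℂ) : (aeval w f).totalDegree ≤ f.totalDegree := by
  rw [f.as_sum, map_sum]
  refine (totalDegree_finsetSum _ _).trans (Finset.sup_le fun a ha => ?_)
  rw [← f.as_sum, aeval_monomial, algebraMap_eq]
  refine (totalDegree_mul _ _).trans ?_
  rw [totalDegree_C, zero_add, Finsupp.prod]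
  refine (totalDegree_finsetProd _ _).trans ?_
  refine le_trans (Finset.sum_le_sum fun j _ => ?_) (le_totalDegree ha)
  refine (totalDegree_pow _ _).trans ?_
  have := hw j
  nlinarith

end General

lemma multAtLeast_pderiv {n : ℕ} {f : MvPolynomial (Fin n) ℂ} {p : Fin n → ℂ} {m : ℕ}
    (h : MultAtLeast f p (m + 1)) (i : Fin n) : MultAtLeast (pderiv i f) p m := fun l hl =>
  h (i :: l) (by simpa using hl)

lemma aeval_mem_of_multAtLeast {n : ℕ} {f : MvPolynomial (Fin n) ℂ} {p : Fin n → ℂ} {m : ℕ}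
    (h : MultAtLeast f p m) :
    aeval (fun i => X i + C (p i)) f ∈ idealOfVars (Fin n) ℂ ^ m := by
  induction m generalizing f with
  | zero => simp
  | succ m ih =>
    rw [mem_pow_idealOfVars_iff']
    intro x hx
    by_cases hx0 : x = 0
    · have h0 := h [] (by simp)
      simp only [pderivList, List.foldl_nil] at h0
      rw [hx0, ← constantCoeff_eq, ← h0]
      clear h0 h ih
      induction f using MvPolynomial.induction_on with
      | C r => simp [algHom_C]
      | add f g hf hg => simp only [map_add, hf, hg]
      | mul_X f k hf => simp only [map_mul, hf, aeval_X, eval_X]; simp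
    · obtain ⟨i, hi⟩ : ∃ i, x i ≠ 0 := by
        by_contra! hh
        exact hx0 (Finsupp.ext hh)
      have h1 := ih (multAtLeast_pderiv h i)
      rw [mem_pow_idealOfVars_iff'] at h1
      have h2 := h1 (x - Finsupp.single i 1) (by
        have : x = x - Finsupp.single i 1 + Finsupp.single i 1 := by
          rw [tsub_add_cancel_of_le]
          simpa [Nat.one_le_iff_ne_zero] using hi
        have := congrArg Finsupp.degree this
        rw [map_add, Finsupp.degree_single] at this
        omega)
      have h3 : MvPolynomial.pderiv i (aeval (fun i => X i + C (p i)) f) =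
          aeval (fun i => X i + C (p i)) (MvPolynomial.pderiv i f) := by
        rw [pderiv_aeval, Finset.sum_eq_single i (fun b _ hb => by simp [pderiv_X, hb]) (by simp)]
        simp [pderiv_X]
      rw [← h3, coeff_pderiv, tsub_add_cancel_of_le (by
        simpa [Nat.one_le_iff_ne_zero] using hi)] at h2
      refine (mul_eq_zero.1 h2).resolve_right ?_
      norm_cast

lemma aeval_mem_of_multAtLeast' {n : ℕ} {τ : Type*} {f : MvPolynomial (Fin n) ℂ} {p : Fin n → ℂ}
    {m : ℕ} (h : MultAtLeast f p m) {v : Fin n → MvPolynomial τ ℂ}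
    (hv : ∀ i, v i - C (p i) ∈ idealOfVars τ ℂ) : aeval v f ∈ idealOfVars τ ℂ ^ m := by
  have h1 := aeval_mem_pow_idealOfVars hv (aeval_mem_of_multAtLeast h)
  rw [← AlgHom.comp_apply] at h1
  convert h1 using 2
  ext i : 1
  simp [algHom_C]

lemma aeval_substMatrix {n : ℕ} {τ : Type*} (u : Fin n → MvPolynomial τ ℂ)
    (B : Matrix (Fin n) (Fin n) ℂ) (f : MvPolynomial (Fin n) ℂ) :
    aeval u (substMatrix B f) = aeval (fun i => ∑ j, C (B i j) * u j) f := by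
  rw [substMatrix, ← AlgHom.comp_apply]
  congr 1
  ext i : 1
  simp [algHom_C]

lemma exists_pow_le_span_pderiv {Q : MvPolynomial (Fin 3) ℂ} (hQ : NowhereSingular Q) :
    ∃ m, idealOfVars (Fin 3) ℂ ^ m ≤ Ideal.span (Set.range fun j => pderiv j Q) := by
  refine Ideal.exists_pow_le_of_le_radical_of_fg ?_ (idealOfVars_fg _ _)
  rw [← vanishingIdeal_zeroLocus_eq_radical (K := ℂ), Ideal.span_le]
  rintro _ ⟨i, rfl⟩
  rw [SetLike.mem_coe, mem_vanishingIdeal_iff]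
  intro x hx
  rw [zeroLocus_span] at hx
  have : x = 0 := by
    by_contra h0
    obtain ⟨j, hj⟩ := hQ x h0
    exact hj (by simpa [aeval_eq_eval] using hx _ ⟨j, rfl⟩)
  simp [this]

lemma homogeneousComponent_mul {m n : ℕ} (q : MvPolynomial (Fin 3) ℂ) {h : MvPolynomial (Fin 3) ℂ}
    (hh : h.IsHomogeneous n) :
    homogeneousComponent (m + n) (q * h) = homogeneousComponent m q * h := by
  induction q using MvPolynomial.induction_on' with
  | monomial u r =>
    have h1 : (monomial u r).IsHomogeneous u.degree := isHomogeneous_monomial r rfl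
    rw [homogeneousComponent_of_mem (h1.mul hh), homogeneousComponent_of_mem h1]
    by_cases h2 : m = u.degree
    · simp [h2]
    · rw [if_neg (by omega), if_neg h2, zero_mul]
  | add p q hp hq => simp only [add_mul, map_add, hp, hq]

lemma exists_locallyFinite {f : MvPolynomial (Fin 3) ℂ} {c : Fin 3 → ℂ} (hf : f ∈ locIdeal c 3)
    (hns : NowhereSingular (homogeneousComponent 3 (translate c f))) :
    ∃ m, ∀ M, m ≤ M → LocallyFinite f c M := by
  set Q := homogeneousComponent 3 (translate c f)
  obtain ⟨m, hm⟩ := exists_pow_le_span_pderiv hns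
  refine ⟨m + 2, fun M hM a ha => ?_⟩
  obtain ⟨M, rfl⟩ : ∃ N, M = N + 2 := ⟨M - 2, by omega⟩
  have hQ : Q.IsHomogeneous 3 := homogeneousComponent_isHomogeneous 3 _
  have ha' : a.degree = M + 2 := by
    rw [Finset.mem_finsuppAntidiag] at ha
    rw [Finsupp.degree_eq_sum]
    exact ha.1
  have hmon : (monomial a (1 : ℂ)).IsHomogeneous (M + 2) := isHomogeneous_monomial _ ha'
  have hmem : monomial a (1 : ℂ) ∈ Ideal.span (Set.range fun j => pderiv j Q) :=
    hm (Ideal.pow_le_pow_right (by omega) (mem_pow_of_isHomogeneous hmon))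
  rw [Ideal.mem_span_range_iff_exists_fun] at hmem
  obtain ⟨q, hq⟩ := hmem
  have hq' : ∑ j, homogeneousComponent M (q j) * pderiv j Q = monomial a 1 := by
    have h := homogeneousComponent_of_mem (m := M + 2) hmon
    rw [if_pos rfl, ← hq, map_sum] at h
    rw [← hq, ← h]
    exact Finset.sum_congr rfl fun j _ => (homogeneousComponent_mul _ hQ.pderiv).symm
  refine ⟨fun j => homogeneousComponent M (q j),
    -∑ j, homogeneousComponent M (q j) * pderiv j (translate c f - Q),
    neg_mem (sum_mem fun j _ => ?_), ?_⟩
  · rw [show M + 2 + 1 = M + 3 from rfl, pow_add]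
    exact Ideal.mul_mem_mul (mem_pow_of_isHomogeneous (homogeneousComponent_isHomogeneous _ _))
      (pderiv_mem_pow_idealOfVars (sub_homogeneousComponent_mem hf) j)
  · rw [← hq', ← sub_eq_add_neg, ← Finset.sum_sub_distrib]
    refine Finset.sum_congr rfl fun j _ => ?_
    rw [map_sub, pderiv_translate]
    ring

lemma initial_forms_eq_zero {F : MvPolynomial (Fin 4) ℂ} {p : Fin 4 → ℂ} (hm : MultAtLeast F p 3)
    {B : Matrix (Fin 4) (Fin 4) ℂ} (hBp : B.mulVec ![0, 0, 0, 1] = p)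
    {g : ℕ → MvPolynomial (Fin 3) ℂ} (hg : ∀ j, (g j).IsHomogeneous j)
    (hsub : substMatrix B F = ∑ j ∈ Finset.range (7 + 1), X 3 ^ (7 - j) * rename Fin.castSucc (g j))
    {j : ℕ} (hj : j < 3) : g j = 0 := by
  have hp : ∀ i, p i = B i 3 := fun i => by
    rw [← hBp]
    simp [Matrix.mulVec, dotProduct, Fin.sum_univ_four]
  have hX : ∀ i, (X i : MvPolynomial (Fin 3) ℂ) ∈ idealOfVars (Fin 3) ℂ :=
    fun i => Ideal.subset_span ⟨i, rfl⟩
  have h1 : aeval ![X 0, X 1, X 2, 1] (substMatrix B F) = ∑ j ∈ Finset.range 8, g j := by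
    rw [hsub, map_sum]
    refine Finset.sum_congr rfl fun j _ => ?_
    have h2 : ![X 0, X 1, X 2, 1] ∘ Fin.castSucc = (X : Fin 3 → MvPolynomial (Fin 3) ℂ) := by
      ext i : 1
      fin_cases i <;> rfl
    rw [map_mul, map_pow, aeval_X, aeval_rename, h2, aeval_X_left]
    simp
  have h2 : ∑ j ∈ Finset.range 8, g j ∈ idealOfVars (Fin 3) ℂ ^ 3 := by
    rw [← h1, aeval_substMatrix]
    refine aeval_mem_of_multAtLeast' hm fun i => ?_
    have : ∑ j, C (B i j) * (![X 0, X 1, X 2, 1] : Fin 4 → MvPolynomial (Fin 3) ℂ) j - C (p i) =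
        C (B i 0) * X 0 + C (B i 1) * X 1 + C (B i 2) * X 2 := by
      simp [Fin.sum_univ_four, hp]
    rw [this]
    exact add_mem (add_mem (Ideal.mul_mem_left _ _ (hX _)) (Ideal.mul_mem_left _ _ (hX _)))
      (Ideal.mul_mem_left _ _ (hX _))
  rw [mem_pow_idealOfVars_iff'] at h2
  ext x
  rw [coeff_zero]
  by_cases hx : x.degree = j
  · rw [← h2 x (by omega), coeff_sum, Finset.sum_eq_single j]
    · exact fun i _ hi => (hg i).coeff_eq_zero (by omega)
    · simp
      omega
  · exact (hg j).coeff_eq_zero hx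

lemma nowhereSingular_substMatrix {n : ℕ} {g : MvPolynomial (Fin n) ℂ} (hg : NowhereSingular g)
    {N : Matrix (Fin n) (Fin n) ℂ} (hdet : N.det ≠ 0) {a : ℂ} (ha : a ≠ 0) :
    NowhereSingular (C a * substMatrix N g) := by
  intro y hy
  obtain ⟨i, hi⟩ := hg (N.mulVec y) fun h0 =>
    hdet (Matrix.exists_mulVec_eq_zero_iff.1 ⟨y, hy, h0⟩)
  by_contra! hall
  refine hdet (Matrix.exists_vecMul_eq_zero_iff.1
    ⟨fun i => eval (N.mulVec y) (pderiv i g), fun h0 => hi (congrFun h0 i), ?_⟩)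
  ext k
  have h1 := hall k
  rw [pderiv_C_mul, substMatrix, pderiv_aeval, map_mul, eval_C, mul_eq_zero, or_iff_right ha,
    map_sum] at h1
  rw [Pi.zero_apply, ← h1]
  change ∑ i, eval (N.mulVec y) (pderiv i g) * N i k = _
  refine Finset.sum_congr rfl fun i _ => ?_
  rw [map_mul]
  congr 1
  · rw [← coe_aeval_eq_eval, ← coe_aeval_eq_eval]
    change aeval _ _ = aeval y (aeval _ _)
    rw [← AlgHom.comp_apply]
    congr 1
    ext i : 1
    simp [Matrix.mulVec, dotProduct]
  · simp [pderiv_X, Pi.single_apply]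

lemma affine_form {n : ℕ} {B : Matrix (Fin n) (Fin n) ℂ} {Λ N : Matrix (Fin n) (Fin 3) ℂ}
    (h : B * N = Λ) (v : Fin n → ℂ) (i : Fin n) :
    ∑ j, C (B i j) * (C (v j) + ∑ k, C (N j k) * X k) =
      C (B.mulVec v i) + ∑ k, C (Λ i k) * (X k : MvPolynomial (Fin 3) ℂ) := by
  simp only [mul_add, Finset.sum_add_distrib, ← h, Matrix.mul_apply, map_sum, Finset.sum_mul,
    Finset.mul_sum, map_mul, Matrix.mulVec, dotProduct]
  rw [Finset.sum_comm (s := (Finset.univ : Finset (Fin n)))]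
  simp only [mul_assoc]

lemma sum_sub_pow_mul_mem {A : Type*} [CommRing A] {I : Ideal A} {a b l : A} (hb : b = a ^ 4) (hl : l ∈ I)
    {G : ℕ → A} (hG : ∀ j, G j ∈ I ^ j) (h : ∀ j < 3, G j = 0) :
    ∑ j ∈ Finset.range 8, (a + l) ^ (7 - j) * G j - b * G 3 ∈ I ^ 4 := by
  have h1 : ∑ j ∈ Finset.range 8, (a + l) ^ (7 - j) * G j - b * G 3 =
      l * (((a + l) + a) * ((a + l) ^ 2 + a ^ 2)) * G 3 +
        ∑ j ∈ Finset.Ico 4 8, (a + l) ^ (7 - j) * G j := by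
    simp only [Finset.sum_range_succ, Finset.sum_range_zero, h 0 (by norm_num),
      h 1 (by norm_num), h 2 (by norm_num), Finset.sum_Ico_eq_sum_range]
    rw [hb]
    norm_num
    ring
  rw [h1]
  refine add_mem ?_ (sum_mem fun j hj => Ideal.mul_mem_left _ _
    (Ideal.pow_le_pow_right (Finset.mem_Ico.1 hj).1 (hG j)))
  rw [show 4 = 1 + 3 from rfl, pow_add I, pow_one I]
  exact Ideal.mul_mem_mul (Ideal.mul_mem_right _ _ hl) (hG 3)

/-- Local analysis of an ordinary triple point in an affine chart. -/
lemma affine_triple_point {F : MvPolynomial (Fin 4) ℂ} {p : Fin 4 → ℂ}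
    (h : OrdinaryTriplePointAt 7 F p) {Λ : Matrix (Fin 4) (Fin 3) ℂ} {κ : ℂ} (hκ : κ ≠ 0)
    (hΛ : ∀ y (t : ℂ), Λ.mulVec y = t • p → y = 0) {f : MvPolynomial (Fin 3) ℂ}
    (hf : f = aeval (fun i => C (κ * p i) + ∑ k, C (Λ i k) * X k) F) :
    f ∈ idealOfVars (Fin 3) ℂ ^ 3 ∧ NowhereSingular (homogeneousComponent 3 f) := by
  obtain ⟨hm, -, B, hB, hBp, g, hg, hsub, hns⟩ := h
  have hg0 : ∀ j < 3, g j = 0 := fun j => initial_forms_eq_zero hm hBp hg hsub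
  obtain ⟨N, hBN⟩ : ∃ N, B * N = Λ := ⟨B⁻¹ * Λ, by
    rw [← Matrix.mul_assoc, Matrix.mul_nonsing_inv B hB, Matrix.one_mul]⟩
  set N' : Matrix (Fin 3) (Fin 3) ℂ := N.submatrix Fin.castSucc id with hN'
  obtain ⟨l, hl, hlI⟩ : ∃ l : MvPolynomial (Fin 3) ℂ, l = ∑ k, C (N 3 k) * X k ∧
      l ∈ idealOfVars (Fin 3) ℂ :=
    ⟨_, rfl, sum_mem fun k _ => Ideal.mul_mem_left _ _ (Ideal.subset_span ⟨k, rfl⟩)⟩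
  obtain ⟨G, hGdef⟩ : ∃ G : ℕ → MvPolynomial (Fin 3) ℂ, ∀ j, G j = substMatrix N' (g j) :=
    ⟨_, fun _ => rfl⟩
  have hG : ∀ j, (G j).IsHomogeneous j := fun j => by
    have := (hg j).aeval (fun i => ∑ j, C (N' i j) * X j) (n := 1) fun i =>
      IsHomogeneous.sum _ _ _ fun k _ => by
        simpa using (isHomogeneous_C _ (N' i k)).mul (isHomogeneous_X ℂ k)
    rw [one_mul] at this
    rw [hGdef]
    exact this
  have hfG : f = ∑ j ∈ Finset.range 8, (C κ + l) ^ (7 - j) * G j := by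
    have h1 : aeval (fun j => C ((![0, 0, 0, κ] : Fin 4 → ℂ) j) + ∑ k, C (N j k) * X k)
        (substMatrix B F) = f := by
      rw [aeval_substMatrix, hf]
      congr 2
      ext1 i
      rw [affine_form hBN]
      congr 2
      rw [← hBp]
      simp [Matrix.mulVec, dotProduct, Fin.sum_univ_four, mul_comm]
    rw [← h1, hsub, map_sum]
    refine Finset.sum_congr rfl fun j _ => ?_
    rw [map_mul, map_pow, aeval_X, aeval_rename, hGdef, hl, substMatrix]
    congr 3
    ext1 i
    fin_cases i <;> simp [hN']
  have hdiff : f - C (κ ^ 4) * G 3 ∈ idealOfVars (Fin 3) ℂ ^ 4 := by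
    have hG0 : ∀ j < 3, G j = 0 := fun j hj => by simp [hGdef, hg0 j hj, substMatrix]
    rw [hfG]
    exact sum_sub_pow_mul_mem (C_pow κ 4) hlI (fun j => mem_pow_of_isHomogeneous (hG j)) hG0
  have hG3 : (C (κ ^ 4) * G 3).IsHomogeneous 3 := by
    have := (isHomogeneous_C (Fin 3) (κ ^ 4)).mul (hG 3)
    rwa [zero_add] at this
  refine ⟨?_, ?_⟩
  · rw [← sub_add_cancel f (C (κ ^ 4) * G 3)]
    exact add_mem (Ideal.pow_le_pow_right (by norm_num) hdiff) (mem_pow_of_isHomogeneous hG3)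
  have hcomp : homogeneousComponent 3 f = C (κ ^ 4) * G 3 := by
    have h1 : homogeneousComponent 3 (C (κ ^ 4) * G 3) = C (κ ^ 4) * G 3 := by
      rw [homogeneousComponent_of_mem hG3, if_pos rfl]
    rw [← sub_eq_zero, ← h1, ← map_sub]
    ext x
    rw [coeff_homogeneousComponent, coeff_zero]
    split_ifs with hx
    · rw [mem_pow_idealOfVars_iff'] at hdiff
      exact hdiff x (by omega)
    · rfl
  rw [hcomp, hGdef]
  refine nowhereSingular_substMatrix hns ?_ (pow_ne_zero 4 hκ)
  intro h0
  obtain ⟨y, hy, hNy⟩ := Matrix.exists_mulVec_eq_zero_iff.2 h0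
  refine hy (hΛ y (N.mulVec y 3) ?_)
  rw [← hBN, ← Matrix.mulVec_mulVec]
  have : N.mulVec y = (N.mulVec y 3) • ![0, 0, 0, 1] := by
    ext i
    refine Fin.lastCases ?_ (fun i => ?_) i
    · simp [show Fin.last 3 = 3 from rfl]
    · have := congrFun hNy i
      change N.mulVec y i.castSucc = 0 at this
      rw [this]
      fin_cases i <;> simp
  conv_lhs => rw [this]
  rw [Matrix.mulVec_smul, hBp]

/-- A linear form on the moment curve that vanishes at none of finitely many points. -/
lemma exists_moment_ne_zero {ι : Type*} [Fintype ι] {p : ι → Fin 4 → ℂ} (hp : ∀ i, p i ≠ 0) :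
    ∃ s : ℂ, ∀ i, p i 0 + s * p i 1 + s ^ 2 * p i 2 + s ^ 3 * p i 3 ≠ 0 := by
  classical
  let Q : ι → Polynomial ℂ := fun i => ∑ j : Fin 4, Polynomial.monomial (j : ℕ) (p i j)
  have hQ : ∀ i, Q i ≠ 0 := fun i h => hp i <| funext fun j => by
    have := congrArg (fun q => Polynomial.coeff q (j : ℕ)) h
    simp only [Q, Polynomial.finsetSum_coeff, Polynomial.coeff_monomial, Fin.val_inj,
      Finset.sum_ite_eq', Finset.mem_univ, if_true, Polynomial.coeff_zero] at this
    exact this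
  obtain ⟨s, hs⟩ := Infinite.exists_notMem_finset (∏ i, Q i).roots.toFinset
  refine ⟨s, fun i h => hs ?_⟩
  rw [Multiset.mem_toFinset, Polynomial.mem_roots (Finset.prod_ne_zero_iff.2 fun i _ => hQ i),
    Polynomial.IsRoot, Polynomial.eval_prod]
  refine Finset.prod_eq_zero (Finset.mem_univ i) ?_
  rw [← h]
  simp [Q, Fin.sum_univ_four, Polynomial.eval_monomial]
  ring

theorem card_triple_points_ne {ι : Type*} [Fintype ι] (hι : Fintype.card ι = 18)
    {F : MvPolynomial (Fin 4) ℂ} (hF : F.IsHomogeneous 7)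
    {P : ι → Projectivization ℂ (Fin 4 → ℂ)} (hP : Function.Injective P)
    (h : ∀ i, OrdinaryTriplePointAt 7 F (P i).rep) : False := by
  classical
  obtain ⟨s, hs⟩ := exists_moment_ne_zero fun i => (P i).rep_nonzero
  obtain ⟨p, hp⟩ : ∃ p : ι → Fin 4 → ℂ, ∀ i, p i = (P i).rep := ⟨_, fun _ => rfl⟩
  simp only [← hp] at hs h
  obtain ⟨κ, hκ⟩ : ∃ κ : ι → ℂ, ∀ i, κ i = (p i 0 + s * p i 1 + s ^ 2 * p i 2 + s ^ 3 * p i 3)⁻¹ :=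
    ⟨_, fun _ => rfl⟩
  have hκ0 : ∀ i, κ i ≠ 0 := fun i => by
    rw [hκ]
    exact inv_ne_zero (hs i)
  have hκp : ∀ i, κ i * p i 0 = 1 - s * (κ i * p i 1) - s ^ 2 * (κ i * p i 2) -
      s ^ 3 * (κ i * p i 3) := fun i => by
    have : κ i * (p i 0 + s * p i 1 + s ^ 2 * p i 2 + s ^ 3 * p i 3) = 1 := by
      rw [hκ]
      exact inv_mul_cancel₀ (hs i)
    linear_combination this
  let Λ : Matrix (Fin 4) (Fin 3) ℂ := !![-s, -s ^ 2, -s ^ 3; 1, 0, 0; 0, 1, 0; 0, 0, 1]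
  let v : Fin 4 → MvPolynomial (Fin 3) ℂ :=
    ![1 - C s * X 0 - C (s ^ 2) * X 1 - C (s ^ 3) * X 2, X 0, X 1, X 2]
  let c : ι → Fin 3 → ℂ := fun i j => κ i * p i j.succ
  have hv : ∀ j, (v j).totalDegree ≤ 1 := by
    have hX : ∀ (a : ℂ) (j : Fin 3), (C a * X j).totalDegree ≤ 1 := fun a j =>
      (totalDegree_mul _ _).trans (by simp)
    intro j
    fin_cases j
    · refine (totalDegree_sub _ _).trans (max_le ((totalDegree_sub _ _).trans
        (max_le ((totalDegree_sub _ _).trans (max_le ?_ (hX _ _))) (hX _ _))) (hX _ _))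
      simp
    · simp [v]
    · simp [v]
    · simp [v]
  have htr : ∀ i, translate (c i) (aeval v F) =
      aeval (fun j => C (κ i * p i j) + ∑ k, C (Λ j k) * X k) F := fun i => by
    rw [← AlgHom.comp_apply]
    congr 1
    ext j : 1
    rw [AlgHom.comp_apply, aeval_X, aeval_X]
    fin_cases j
    · simp only [v, Fin.zero_eta, Matrix.cons_val_zero, hκp, c, Λ, Fin.sum_univ_three]
      simp
      ring
    · simp [v, c, Λ, Fin.sum_univ_three, add_comm]
    · simp [v, c, Λ, Fin.sum_univ_three, add_comm]
    · simp [v, c, Λ, Fin.sum_univ_three, add_comm]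
  have hΛ : ∀ i y (t : ℂ), Λ.mulVec y = t • p i → y = 0 := fun i y t hy => by
    have e := fun j => congrFun hy j
    have e0 := e 0
    have e1 := e 1
    have e2 := e 2
    have e3 := e 3
    simp [Λ, Matrix.mulVec, dotProduct, Fin.sum_univ_three] at e0 e1 e2 e3
    have ht : t = 0 := by
      refine (mul_eq_zero.1 ?_).resolve_right (hs i)
      linear_combination -e0 - s * e1 - s ^ 2 * e2 - s ^ 3 * e3
    rw [ht, zero_mul] at e1 e2 e3
    ext j
    fin_cases j <;> simpa
  have haff := fun i => affine_triple_point (h i) (hκ0 i) (hΛ i) (htr i)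
  have hM := fun i => exists_locallyFinite (haff i).1 (haff i).2
  choose m hm using hM
  refine card_ne_eighteen hι (f := aeval v F) (c := c) (M := Finset.univ.sup m)
    ((totalDegree_aeval_le hv F).trans hF.totalDegree_le) (fun i => (haff i).1) (fun i i' hii => ?_)
    (fun i => hm i _ (Finset.le_sup (Finset.mem_univ i))) fun i => (haff i).2
  have e : ∀ j : Fin 3, κ i * p i j.succ = κ i' * p i' j.succ := fun j => congrFun hii j
  apply hP
  rw [← (P i).mk_rep, ← (P i').mk_rep, Projectivization.mk_eq_mk_iff']
  refine ⟨κ i' / κ i, ?_⟩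
  rw [← hp, ← hp]
  have e' : ∀ j, κ i * p i j = κ i' * p i' j := by
    refine Fin.cases ?_ e
    rw [hκp, hκp, show (1 : Fin 4) = Fin.succ 0 from rfl, show (2 : Fin 4) = Fin.succ 1 from rfl,
      show (3 : Fin 4) = Fin.succ 2 from rfl, e, e, e]
  ext j
  rw [Pi.smul_apply, smul_eq_mul, div_mul_eq_mul_div, ← e', mul_div_cancel_left₀ _ (hκ0 i)]

theorem card_triple_points_le {ν : ℕ} {F : MvPolynomial (Fin 4) ℂ} (hF : F.IsHomogeneous 7)
    (h : OnlyTriplePoints 7 ν F) : ν ≤ 17 := by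
  obtain ⟨hfin, rfl, hP⟩ := h
  by_contra! hlt
  obtain ⟨t, ht, hcard⟩ := Finset.exists_subset_card_eq (s := hfin.toFinset) (n := 18) (by
    rw [← Set.ncard_eq_toFinset_card _ hfin]
    omega)
  exact card_triple_points_ne (ι := t) (by simpa using hcard) hF (P := fun x => x)
    Subtype.val_injective fun i => hP _ (hfin.mem_toFinset.1 (ht i.2))

/-- A symmetric septic with 16 ordinary triple points. -/
def symmetricSeptic : MvPolynomial (Fin 4) ℂ :=
  let s := esymm (Fin 4) ℂ 1
  let q := esymm (Fin 4) ℂ 2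
  let r := esymm (Fin 4) ℂ 3
  let t := esymm (Fin 4) ℂ 4
  s * q ^ 3 + s ^ 2 * q * r - s ^ 3 * t - q ^ 2 * r - s * r ^ 2 - 2 * s * q * t + r * t

lemma rename_symmetricSeptic (σ : Equiv.Perm (Fin 4)) :
    rename σ symmetricSeptic = symmetricSeptic := by
  simp only [symmetricSeptic, map_add, map_sub, map_mul, map_pow, map_ofNat, rename_esymm]

lemma isHomogeneous_symmetricSeptic : symmetricSeptic.IsHomogeneous 7 := by
  have h : ∀ k, (esymm (Fin 4) ℂ k).IsHomogeneous k := fun k =>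
    IsHomogeneous.sum _ _ _ fun A hA => by
      have := IsHomogeneous.prod A (X : Fin 4 → MvPolynomial (Fin 4) ℂ) (fun _ => 1)
        fun i _ => isHomogeneous_X ℂ i
      rwa [Finset.sum_const, smul_eq_mul, mul_one, (Finset.mem_powersetCard.1 hA).2] at this
  have h2 : (2 : MvPolynomial (Fin 4) ℂ).IsHomogeneous 0 := isHomogeneous_C _ (2 : ℂ)
  unfold symmetricSeptic
  refine (((((IsHomogeneous.add ?_ ?_).sub ?_).sub ?_).sub ?_).sub ?_).add ?_
  · exact (h 1).mul ((h 2).pow 3)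
  · exact (((h 1).pow 2).mul (h 2)).mul (h 3)
  · exact ((h 1).pow 3).mul (h 4)
  · exact ((h 2).pow 2).mul (h 3)
  · exact (h 1).mul ((h 3).pow 2)
  · exact ((h2.mul (h 1)).mul (h 2)).mul (h 4)
  · exact (h 3).mul (h 4)

lemma esymm_fin_four_one : esymm (Fin 4) ℂ 1 = X 0 + X 1 + X 2 + X 3 := by
  rw [esymm_one, Fin.sum_univ_four]

lemma esymm_fin_four_two :
    esymm (Fin 4) ℂ 2 = X 0 * X 1 + X 0 * X 2 + X 0 * X 3 + X 1 * X 2 + X 1 * X 3 + X 2 * X 3 := by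
  rw [esymm, show Finset.powersetCard 2 (Finset.univ : Finset (Fin 4)) =
    {{0, 1}, {0, 2}, {0, 3}, {1, 2}, {1, 3}, {2, 3}} by decide]
  repeat rw [Finset.sum_insert (by decide)]
  simp
  ring

lemma esymm_fin_four_three :
    esymm (Fin 4) ℂ 3 =
      X 0 * X 1 * X 2 + X 0 * X 1 * X 3 + X 0 * X 2 * X 3 + X 1 * X 2 * X 3 := by
  rw [esymm, show Finset.powersetCard 3 (Finset.univ : Finset (Fin 4)) =
    {{0, 1, 2}, {0, 1, 3}, {0, 2, 3}, {1, 2, 3}} by decide]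
  repeat rw [Finset.sum_insert (by decide)]
  simp
  ring

lemma esymm_fin_four_four : esymm (Fin 4) ℂ 4 = X 0 * X 1 * X 2 * X 3 := by
  rw [esymm, show Finset.powersetCard 4 (Finset.univ : Finset (Fin 4)) =
    {Finset.univ} by decide, Finset.sum_singleton, Fin.prod_univ_four]

lemma symmetricSeptic_eq : symmetricSeptic =
    (X 0 + X 1 + X 2 + X 3) *
      (X 0 * X 1 + X 0 * X 2 + X 0 * X 3 + X 1 * X 2 + X 1 * X 3 + X 2 * X 3) ^ 3 +
    (X 0 + X 1 + X 2 + X 3) ^ 2 *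
      (X 0 * X 1 + X 0 * X 2 + X 0 * X 3 + X 1 * X 2 + X 1 * X 3 + X 2 * X 3) *
      (X 0 * X 1 * X 2 + X 0 * X 1 * X 3 + X 0 * X 2 * X 3 + X 1 * X 2 * X 3) -
    (X 0 + X 1 + X 2 + X 3) ^ 3 * (X 0 * X 1 * X 2 * X 3) -
    (X 0 * X 1 + X 0 * X 2 + X 0 * X 3 + X 1 * X 2 + X 1 * X 3 + X 2 * X 3) ^ 2 *
      (X 0 * X 1 * X 2 + X 0 * X 1 * X 3 + X 0 * X 2 * X 3 + X 1 * X 2 * X 3) -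
    (X 0 + X 1 + X 2 + X 3) *
      (X 0 * X 1 * X 2 + X 0 * X 1 * X 3 + X 0 * X 2 * X 3 + X 1 * X 2 * X 3) ^ 2 -
    2 * (X 0 + X 1 + X 2 + X 3) *
      (X 0 * X 1 + X 0 * X 2 + X 0 * X 3 + X 1 * X 2 + X 1 * X 3 + X 2 * X 3) *
      (X 0 * X 1 * X 2 * X 3) +
    (X 0 * X 1 * X 2 + X 0 * X 1 * X 3 + X 0 * X 2 * X 3 + X 1 * X 2 * X 3) *
      (X 0 * X 1 * X 2 * X 3) := by
  simp only [symmetricSeptic, esymm_fin_four_one, esymm_fin_four_two, esymm_fin_four_three,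
    esymm_fin_four_four]

/-- The partial derivative of `symmetricSeptic` in the direction of a coordinate with value `x`,
in terms of the elementary symmetric functions of the coordinates. -/
def septicGrad (s q r t x : ℂ) : ℂ :=
  (q ^ 3 + 2 * s * q * r - 3 * s ^ 2 * t - r ^ 2 - 2 * q * t) +
  (3 * s * q ^ 2 + s ^ 2 * r - 2 * q * r - 2 * s * t) * (s - x) +
  (s ^ 2 * q - q ^ 2 - 2 * s * r + t) * (q - x * s + x ^ 2) +
  (-s ^ 3 - 2 * s * q + r) * (r - x * q + x ^ 2 * s - x ^ 3)

lemma eval_pderiv_symmetricSeptic (p : Fin 4 → ℂ) (i : Fin 4) :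
    eval p (pderiv i symmetricSeptic) =
      septicGrad (p 0 + p 1 + p 2 + p 3)
        (p 0 * p 1 + p 0 * p 2 + p 0 * p 3 + p 1 * p 2 + p 1 * p 3 + p 2 * p 3)
        (p 0 * p 1 * p 2 + p 0 * p 1 * p 3 + p 0 * p 2 * p 3 + p 1 * p 2 * p 3)
        (p 0 * p 1 * p 2 * p 3) (p i) := by
  have h2 : ∀ i, pderiv i (2 : MvPolynomial (Fin 4) ℂ) = 0 := fun i => pderiv_C (a := (2 : ℂ))
  rw [symmetricSeptic_eq]
  fin_cases i <;>
  · simp [pderiv_X, Derivation.leibniz, Derivation.leibniz_pow, h2, septicGrad]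
    ring

lemma pderivList_isHomogeneous {n d : ℕ} {f : MvPolynomial (Fin n) ℂ} (hf : f.IsHomogeneous d)
    (l : List (Fin n)) : (pderivList l f).IsHomogeneous (d - l.length) := by
  induction l generalizing d f with
  | nil => exact hf
  | cons i l ih =>
    have := ih (hf.pderiv (i := i))
    rwa [Nat.sub_sub, Nat.add_comm] at this

lemma eval_smul_of_isHomogeneous {n d : ℕ} {f : MvPolynomial (Fin n) ℂ} (hf : f.IsHomogeneous d)
    (c : ℂ) (p : Fin n → ℂ) : eval (c • p) f = c ^ d * eval p f := by
  rw [eval_eq, eval_eq, Finset.mul_sum]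
  refine Finset.sum_congr rfl fun m hm => ?_
  have hd : ∑ i ∈ m.support, m i = d := by
    have := hf (mem_support_iff.1 hm)
    simpa only [Finsupp.weight_apply, Finsupp.sum, smul_eq_mul, Pi.one_apply, mul_one] using this
  simp only [Pi.smul_apply, smul_eq_mul, mul_pow, Finset.prod_mul_distrib,
    Finset.prod_pow_eq_pow_sum, hd]
  ring

lemma substMatrix_smul {n d : ℕ} {f : MvPolynomial (Fin n) ℂ} (hf : f.IsHomogeneous d)
    (c : ℂ) (B : Matrix (Fin n) (Fin n) ℂ) :
    substMatrix (c • B) f = C (c ^ d) * substMatrix B f := by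
  refine funext fun x => ?_
  have key : ∀ A : Matrix (Fin n) (Fin n) ℂ, eval x (substMatrix A f) = eval (A.mulVec x) f := by
    intro A
    rw [substMatrix, map_aeval, eval]
    congr 1
    · ext <;> simp [Matrix.mulVec, dotProduct]
  rw [map_mul, key, key, eval_C, Matrix.smul_mulVec, eval_smul_of_isHomogeneous hf]

lemma multAtLeast_smul {n d m : ℕ} {f : MvPolynomial (Fin n) ℂ} (hf : f.IsHomogeneous d)
    {p : Fin n → ℂ} (h : MultAtLeast f p m) (c : ℂ) : MultAtLeast f (c • p) m := fun l hl => by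
  rw [eval_smul_of_isHomogeneous (pderivList_isHomogeneous hf l), h l hl, mul_zero]

lemma ordinaryTriplePointAt_smul {d : ℕ} {f : MvPolynomial (Fin 4) ℂ} (hf : f.IsHomogeneous d)
    {p : Fin 4 → ℂ} (h : OrdinaryTriplePointAt d f p) {c : ℂ} (hc : c ≠ 0) :
    OrdinaryTriplePointAt d f (c • p) := by
  obtain ⟨h1, ⟨l, hl, hl'⟩, B, hB, hBp, g, hg, hgf, hg3⟩ := h
  refine ⟨multAtLeast_smul hf h1 c, ⟨l, hl, ?_⟩, c • B, ?_, ?_, fun j => C (c ^ d) * g j,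
    fun j => ?_, ?_, ?_⟩
  · rw [eval_smul_of_isHomogeneous (pderivList_isHomogeneous hf l)]
    exact mul_ne_zero (pow_ne_zero _ hc) hl'
  · rw [Matrix.det_smul]
    exact ((isUnit_iff_ne_zero.2 hc).pow _).mul hB
  · rw [Matrix.smul_mulVec, hBp]
  · have := (isHomogeneous_C (Fin 3) (c ^ d)).mul (hg j)
    rwa [zero_add] at this
  · rw [substMatrix_smul hf, hgf, Finset.mul_sum]
    refine Finset.sum_congr rfl fun j _ => ?_
    rw [map_mul, rename_C]
    ring
  · intro p hp
    obtain ⟨i, hi⟩ := hg3 p hp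
    refine ⟨i, ?_⟩
    rw [pderiv_C_mul, map_mul, eval_C]
    exact mul_ne_zero (pow_ne_zero _ hc) hi

lemma rename_pderivList {n : ℕ} (σ : Equiv.Perm (Fin n)) (l : List (Fin n))
    (f : MvPolynomial (Fin n) ℂ) :
    rename σ (pderivList l f) = pderivList (l.map σ) (rename σ f) := by
  induction l generalizing f with
  | nil => rfl
  | cons i l ih =>
    change rename σ (pderivList l (pderiv i f)) =
      pderivList (l.map σ) (pderiv (σ i) (rename σ f))
    rw [ih, pderiv_rename σ.injective]

lemma eval_comp_pderivList {n : ℕ} {σ : Equiv.Perm (Fin n)} {f : MvPolynomial (Fin n) ℂ}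
    (hf : rename σ f = f) (p : Fin n → ℂ) (l : List (Fin n)) :
    eval (p ∘ σ) (pderivList l f) = eval p (pderivList (l.map σ) f) := by
  rw [← eval_rename, rename_pderivList, hf]

lemma multAtLeast_comp {n m : ℕ} {σ : Equiv.Perm (Fin n)} {f : MvPolynomial (Fin n) ℂ}
    (hf : rename σ f = f) {p : Fin n → ℂ} (h : MultAtLeast f p m) :
    MultAtLeast f (p ∘ σ) m := fun l hl => by
  rw [eval_comp_pderivList hf]
  exact h _ (by rwa [List.length_map])

lemma ordinaryTriplePointAt_comp {d : ℕ} {σ : Equiv.Perm (Fin 4)} {f : MvPolynomial (Fin 4) ℂ}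
    (hf : rename σ f = f) {p : Fin 4 → ℂ} (h : OrdinaryTriplePointAt d f p) :
    OrdinaryTriplePointAt d f (p ∘ σ) := by
  obtain ⟨h1, ⟨l, hl, hl'⟩, B, hB, hBp, g, hg, hgf, hg3⟩ := h
  refine ⟨multAtLeast_comp hf h1, ⟨l.map σ.symm, by rwa [List.length_map], ?_⟩,
    B.submatrix σ id, ?_, ?_, g, hg, ?_, hg3⟩
  · rw [eval_comp_pderivList hf, List.map_map]
    simpa using hl'
  · rw [Matrix.det_permute]
    exact ((Units.isUnit _).map (Int.castRingHom ℂ)).mul hB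
  · ext i
    exact congrFun hBp (σ i)
  · rw [← hgf]
    nth_rw 2 [← hf]
    simp only [substMatrix, aeval_rename]
    rfl

lemma SingularAt.pderiv_eq_zero {f : MvPolynomial (Fin 4) ℂ} {p : Fin 4 → ℂ}
    (h : SingularAt f p) (i : Fin 4) : eval p (pderiv i f) = 0 :=
  h [i] (by simp)

lemma OrdinaryTriplePointAt.singularAt {d : ℕ} {f : MvPolynomial (Fin 4) ℂ} {p : Fin 4 → ℂ}
    (h : OrdinaryTriplePointAt d f p) : SingularAt f p :=
  fun l hl => h.1 l (hl.trans (by norm_num))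

/-- A term in three variables. -/
def ternaryTerm (c : ℤ) (i j k : ℕ) : MvPolynomial (Fin 3) ℂ :=
  (c : MvPolynomial (Fin 3) ℂ) * X 0 ^ i * X 1 ^ j * X 2 ^ k

lemma isHomogeneous_ternaryTerm (c : ℤ) {i j k n : ℕ} (h : i + j + k = n) :
    (ternaryTerm c i j k).IsHomogeneous n := by
  have h1 := (((isHomogeneous_C (Fin 3) (c : ℂ)).mul (isHomogeneous_X_pow (R := ℂ) (0 : Fin 3) i)).mul
    (isHomogeneous_X_pow (1 : Fin 3) j)).mul (isHomogeneous_X_pow (2 : Fin 3) k)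
  rwa [zero_add, h, map_intCast] at h1

lemma rename_ternaryTerm (c : ℤ) (i j k : ℕ) : rename Fin.castSucc (ternaryTerm c i j k) =
    (c : MvPolynomial (Fin 4) ℂ) * X 0 ^ i * X 1 ^ j * X 2 ^ k := by
  simp only [ternaryTerm, map_mul, map_pow, map_intCast, rename_X]
  rfl

/-- The homogeneous parts of `symmetricSeptic` at the point `(0, 0, 0, 1)`. -/
def vertexExpansion : ℕ → MvPolynomial (Fin 3) ℂ
  | 3 => ternaryTerm 1 3 0 0 + ternaryTerm 4 2 1 0 + ternaryTerm 4 2 0 1 + ternaryTerm 4 1 2 0 +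
      ternaryTerm 8 1 1 1 + ternaryTerm 4 1 0 2 + ternaryTerm 1 0 3 0 + ternaryTerm 4 0 2 1 +
      ternaryTerm 4 0 1 2 + ternaryTerm 1 0 0 3
  | 4 => ternaryTerm 1 4 0 0 + ternaryTerm 8 3 1 0 + ternaryTerm 8 3 0 1 + ternaryTerm 14 2 2 0 +
      ternaryTerm 28 2 1 1 + ternaryTerm 14 2 0 2 + ternaryTerm 8 1 3 0 + ternaryTerm 28 1 2 1 +
      ternaryTerm 28 1 1 2 + ternaryTerm 8 1 0 3 + ternaryTerm 1 0 4 0 + ternaryTerm 8 0 3 1 +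
      ternaryTerm 14 0 2 2 + ternaryTerm 8 0 1 3 + ternaryTerm 1 0 0 4
  | 5 => ternaryTerm 4 4 1 0 + ternaryTerm 4 4 0 1 + ternaryTerm 14 3 2 0 +
      ternaryTerm 28 3 1 1 + ternaryTerm 14 3 0 2 + ternaryTerm 14 2 3 0 + ternaryTerm 48 2 2 1 +
      ternaryTerm 48 2 1 2 + ternaryTerm 14 2 0 3 + ternaryTerm 4 1 4 0 + ternaryTerm 28 1 3 1 +
      ternaryTerm 48 1 2 2 + ternaryTerm 28 1 1 3 + ternaryTerm 4 1 0 4 + ternaryTerm 4 0 4 1 +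
      ternaryTerm 14 0 3 2 + ternaryTerm 14 0 2 3 + ternaryTerm 4 0 1 4
  | 6 => ternaryTerm 4 4 2 0 + ternaryTerm 8 4 1 1 + ternaryTerm 4 4 0 2 + ternaryTerm 8 3 3 0 +
      ternaryTerm 28 3 2 1 + ternaryTerm 28 3 1 2 + ternaryTerm 8 3 0 3 + ternaryTerm 4 2 4 0 +
      ternaryTerm 28 2 3 1 + ternaryTerm 48 2 2 2 + ternaryTerm 28 2 1 3 + ternaryTerm 4 2 0 4 +
      ternaryTerm 8 1 4 1 + ternaryTerm 28 1 3 2 + ternaryTerm 28 1 2 3 + ternaryTerm 8 1 1 4 +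
      ternaryTerm 4 0 4 2 + ternaryTerm 8 0 3 3 + ternaryTerm 4 0 2 4
  | 7 => ternaryTerm 1 4 3 0 + ternaryTerm 4 4 2 1 + ternaryTerm 4 4 1 2 + ternaryTerm 1 4 0 3 +
      ternaryTerm 1 3 4 0 + ternaryTerm 8 3 3 1 + ternaryTerm 14 3 2 2 + ternaryTerm 8 3 1 3 +
      ternaryTerm 1 3 0 4 + ternaryTerm 4 2 4 1 + ternaryTerm 14 2 3 2 + ternaryTerm 14 2 2 3 +
      ternaryTerm 4 2 1 4 + ternaryTerm 4 1 4 2 + ternaryTerm 8 1 3 3 + ternaryTerm 4 1 2 4 +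
      ternaryTerm 1 0 4 3 + ternaryTerm 1 0 3 4
  | _ => 0

lemma isHomogeneous_vertexExpansion : ∀ j, (vertexExpansion j).IsHomogeneous j
  | 0 => isHomogeneous_zero _ _ _
  | 1 => isHomogeneous_zero _ _ _
  | 2 => isHomogeneous_zero _ _ _
  | 3 | 4 | 5 | 6 | 7 => by
    unfold vertexExpansion
    repeat' apply IsHomogeneous.add
    all_goals exact isHomogeneous_ternaryTerm _ rfl
  | _ + 8 => isHomogeneous_zero _ _ _

lemma substMatrix_one_symmetricSeptic : substMatrix 1 symmetricSeptic =
    ∑ j ∈ Finset.range (7 + 1), X 3 ^ (7 - j) * rename Fin.castSucc (vertexExpansion j) := by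
  rw [symmetricSeptic_eq]
  simp [substMatrix, Finset.sum_range_succ, Matrix.one_apply, vertexExpansion,
    rename_ternaryTerm]
  ring

lemma nowhereSingular_vertexExpansion : NowhereSingular (vertexExpansion 3) := by
  intro p hp
  by_contra! h
  have h2 : ∀ i, pderiv i (4 : MvPolynomial (Fin 3) ℂ) = 0 := fun i => pderiv_C (a := (4 : ℂ))
  have h8 : ∀ i, pderiv i (8 : MvPolynomial (Fin 3) ℂ) = 0 := fun i => pderiv_C (a := (8 : ℂ))
  have key : ∀ i, p i ^ 2 = 4 * (p 0 + p 1 + p 2) ^ 2 := by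
    intro i
    have hi := h i
    rw [← sub_eq_zero, ← neg_eq_zero, ← hi]
    fin_cases i <;>
    · simp [vertexExpansion, ternaryTerm, pderiv_X, Derivation.leibniz, Derivation.leibniz_pow,
        h2, h8]
      ring
  have hx : p 0 = 0 := by
    have k0 := key 0
    have h1 := sq_eq_sq_iff_eq_or_eq_neg.1 ((key 1).trans k0.symm)
    have h2 := sq_eq_sq_iff_eq_or_eq_neg.1 ((key 2).trans k0.symm)
    rw [← sq_eq_zero_iff]
    rcases h1 with h1 | h1 <;> rcases h2 with h2 | h2 <;> rw [h1, h2] at k0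
    · linear_combination -k0 / 35
    · linear_combination -k0 / 3
    · linear_combination -k0 / 3
    · linear_combination -k0 / 3
  refine hp (funext fun i => ?_)
  have : p i ^ 2 = 0 := by rw [key i, ← key 0, hx, zero_pow two_ne_zero]
  exact sq_eq_zero_iff.1 this

/-- A change of coordinates taking `(0, 0, 0, 1)` to `(1, 1, -1, 0)`. -/
def rootMatrix : Matrix (Fin 4) (Fin 4) ℂ :=
  !![1, 0, 0, 1; 0, 1, 0, 1; 0, 0, 0, -1; 0, 0, 1, 0]

/-- The homogeneous parts of `symmetricSeptic` at the point `(1, 1, -1, 0)`, in the coordinates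
given by `rootMatrix`. -/
def rootExpansion : ℕ → MvPolynomial (Fin 3) ℂ
  | 3 => ternaryTerm (-4) 2 1 0 + ternaryTerm (-4) 1 2 0 + ternaryTerm (-8) 1 1 1 +
      ternaryTerm 1 0 0 3
  | 4 => ternaryTerm (-4) 3 1 0 + ternaryTerm (-14) 2 2 0 + ternaryTerm (-12) 2 1 1 +
      ternaryTerm (-4) 1 3 0 + ternaryTerm (-12) 1 2 1 + ternaryTerm 4 1 1 2 +
      ternaryTerm 4 1 0 3 + ternaryTerm 4 0 1 3 + ternaryTerm 1 0 0 4
  | 5 => ternaryTerm (-1) 4 1 0 + ternaryTerm (-8) 3 2 0 + ternaryTerm (-4) 3 1 1 +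
      ternaryTerm (-8) 2 3 0 + ternaryTerm 18 2 1 2 + ternaryTerm 6 2 0 3 +
      ternaryTerm (-1) 1 4 0 + ternaryTerm (-4) 1 3 1 + ternaryTerm 18 1 2 2 +
      ternaryTerm 20 1 1 3 + ternaryTerm 3 1 0 4 + ternaryTerm 6 0 2 3 + ternaryTerm 3 0 1 4
  | 6 => ternaryTerm (-1) 4 2 0 + ternaryTerm 12 3 2 1 + ternaryTerm 16 3 1 2 +
      ternaryTerm 4 3 0 3 + ternaryTerm (-1) 2 4 0 + ternaryTerm 12 2 3 1 +
      ternaryTerm 36 2 2 2 + ternaryTerm 24 2 1 3 + ternaryTerm 3 2 0 4 + ternaryTerm 16 1 3 2 +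
      ternaryTerm 24 1 2 3 + ternaryTerm 8 1 1 4 + ternaryTerm 4 0 3 3 + ternaryTerm 3 0 2 4
  | 7 => ternaryTerm 1 4 3 0 + ternaryTerm 4 4 2 1 + ternaryTerm 4 4 1 2 + ternaryTerm 1 4 0 3 +
      ternaryTerm 1 3 4 0 + ternaryTerm 8 3 3 1 + ternaryTerm 14 3 2 2 + ternaryTerm 8 3 1 3 +
      ternaryTerm 1 3 0 4 + ternaryTerm 4 2 4 1 + ternaryTerm 14 2 3 2 + ternaryTerm 14 2 2 3 +
      ternaryTerm 4 2 1 4 + ternaryTerm 4 1 4 2 + ternaryTerm 8 1 3 3 + ternaryTerm 4 1 2 4 +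
      ternaryTerm 1 0 4 3 + ternaryTerm 1 0 3 4
  | _ => 0

lemma isHomogeneous_rootExpansion : ∀ j, (rootExpansion j).IsHomogeneous j
  | 0 => isHomogeneous_zero _ _ _
  | 1 => isHomogeneous_zero _ _ _
  | 2 => isHomogeneous_zero _ _ _
  | 3 | 4 | 5 | 6 | 7 => by
    unfold rootExpansion
    repeat' apply IsHomogeneous.add
    all_goals exact isHomogeneous_ternaryTerm _ rfl
  | _ + 8 => isHomogeneous_zero _ _ _

lemma substMatrix_rootMatrix_symmetricSeptic : substMatrix rootMatrix symmetricSeptic =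
    ∑ j ∈ Finset.range (7 + 1), X 3 ^ (7 - j) * rename Fin.castSucc (rootExpansion j) := by
  rw [symmetricSeptic_eq, substMatrix]
  simp only [map_add, map_sub, map_mul, map_pow, map_ofNat, aeval_X]
  simp [rootMatrix, Finset.sum_range_succ, Fin.sum_univ_four, rootExpansion,
    rename_ternaryTerm]
  ring

lemma nowhereSingular_rootExpansion : NowhereSingular (rootExpansion 3) := by
  intro p hp
  by_contra! h
  have h2 : ∀ i, pderiv i (4 : MvPolynomial (Fin 3) ℂ) = 0 := fun i => pderiv_C (a := (4 : ℂ))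
  have h8 : ∀ i, pderiv i (8 : MvPolynomial (Fin 3) ℂ) = 0 := fun i => pderiv_C (a := (8 : ℂ))
  have k0 : p 1 * (2 * p 0 + p 1 + 2 * p 2) = 0 := by
    have hi := h 0
    simp [rootExpansion, ternaryTerm, pderiv_X, Derivation.leibniz, Derivation.leibniz_pow,
      h2, h8] at hi
    linear_combination -hi / 4
  have k1 : p 0 * (p 0 + 2 * p 1 + 2 * p 2) = 0 := by
    have hi := h 1
    simp [rootExpansion, ternaryTerm, pderiv_X, Derivation.leibniz, Derivation.leibniz_pow,
      h2, h8] at hi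
    linear_combination -hi / 4
  have k2 : 3 * p 2 ^ 2 = 8 * (p 0 * p 1) := by
    have hi := h 2
    simp [rootExpansion, ternaryTerm, pderiv_X, Derivation.leibniz, Derivation.leibniz_pow,
      h2, h8] at hi
    linear_combination hi
  suffices p 0 = 0 ∧ p 1 = 0 ∧ p 2 = 0 by
    refine hp (funext fun i => ?_)
    fin_cases i
    exacts [this.1, this.2.1, this.2.2]
  rcases mul_eq_zero.1 k0 with h1 | h1
  · have hz : p 2 = 0 := by
      rw [← sq_eq_zero_iff]
      linear_combination k2 / 3 + 8 / 3 * p 0 * h1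
    refine ⟨?_, h1, hz⟩
    rw [← sq_eq_zero_iff]
    linear_combination k1 - 2 * p 0 * h1 - 2 * p 0 * hz
  · rcases mul_eq_zero.1 k1 with h0 | h0
    · have hz : p 2 = 0 := by
        rw [← sq_eq_zero_iff]
        linear_combination k2 / 3 + 8 / 3 * p 1 * h0
      exact ⟨h0, by linear_combination h1 - 2 * h0 - 2 * hz, hz⟩
    · have e1 : p 1 = p 0 := by linear_combination h0 - h1
      have e2 : p 2 = -(3 / 2) * p 0 := by linear_combination h1 / 2 - e1 / 2
      have e0 : p 0 = 0 := by
        rw [← sq_eq_zero_iff]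
        rw [e1, e2] at k2
        linear_combination -4 / 5 * k2
      exact ⟨e0, e1.trans e0, by rw [e2, e0, mul_zero]⟩

lemma pderiv_esymm_one (i : Fin 4) : pderiv i (esymm (Fin 4) ℂ 1) = 1 := by
  simp [pderiv_X, Pi.single_apply]

lemma pderiv_esymm_two (i : Fin 4) :
    pderiv i (esymm (Fin 4) ℂ 2) = esymm (Fin 4) ℂ 1 - X i := by
  rw [esymm_fin_four_one, esymm_fin_four_two]
  fin_cases i <;> simp [-esymm_one, pderiv_X, Derivation.leibniz] <;> ring

lemma pderiv_esymm_three (i : Fin 4) :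
    pderiv i (esymm (Fin 4) ℂ 3) = esymm (Fin 4) ℂ 2 - X i * (esymm (Fin 4) ℂ 1 - X i) := by
  rw [esymm_fin_four_one, esymm_fin_four_two, esymm_fin_four_three]
  fin_cases i <;>
  · simp [-esymm_one, pderiv_X, Derivation.leibniz]
    ring

lemma pderiv_esymm_four (i : Fin 4) :
    pderiv i (esymm (Fin 4) ℂ 4) =
      esymm (Fin 4) ℂ 3 - X i * (esymm (Fin 4) ℂ 2 - X i * (esymm (Fin 4) ℂ 1 - X i)) := by
  rw [esymm_fin_four_one, esymm_fin_four_two, esymm_fin_four_three, esymm_fin_four_four]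
  fin_cases i <;>
  · simp [-esymm_one, pderiv_X, Derivation.leibniz]
    ring

lemma eval_esymm_vertex : eval ![0, 0, 0, 1] (esymm (Fin 4) ℂ 1) = 1 ∧
    eval ![0, 0, 0, 1] (esymm (Fin 4) ℂ 2) = 0 ∧ eval ![0, 0, 0, 1] (esymm (Fin 4) ℂ 3) = 0 ∧
    eval ![0, 0, 0, 1] (esymm (Fin 4) ℂ 4) = 0 := by
  simp [-esymm_one, esymm_fin_four_one, esymm_fin_four_two, esymm_fin_four_three, esymm_fin_four_four]

lemma eval_esymm_root : eval ![1, 1, -1, 0] (esymm (Fin 4) ℂ 1) = 1 ∧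
    eval ![1, 1, -1, 0] (esymm (Fin 4) ℂ 2) = -1 ∧
    eval ![1, 1, -1, 0] (esymm (Fin 4) ℂ 3) = -1 ∧
    eval ![1, 1, -1, 0] (esymm (Fin 4) ℂ 4) = 0 := by
  simp [-esymm_one, esymm_fin_four_one, esymm_fin_four_two, esymm_fin_four_three, esymm_fin_four_four]

lemma multAtLeast_three {f : MvPolynomial (Fin 4) ℂ} {p : Fin 4 → ℂ} (h0 : eval p f = 0)
    (h1 : ∀ i, eval p (pderiv i f) = 0) (h2 : ∀ i j, eval p (pderiv j (pderiv i f)) = 0) :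
    MultAtLeast f p 3
  | [], _ => h0
  | [i], _ => h1 i
  | [i, j], _ => h2 i j
  | _ :: _ :: _ :: _, h => by simp only [List.length_cons] at h; omega

lemma pderiv_symmetricSeptic (i : Fin 4) :
    pderiv i symmetricSeptic =
      let s := esymm (Fin 4) ℂ 1
      let q := esymm (Fin 4) ℂ 2
      let r := esymm (Fin 4) ℂ 3
      let t := esymm (Fin 4) ℂ 4
      (q ^ 3 + 2 * s * q * r - 3 * s ^ 2 * t - r ^ 2 - 2 * q * t) +
      (3 * s * q ^ 2 + s ^ 2 * r - 2 * q * r - 2 * s * t) * (s - X i) +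
      (s ^ 2 * q - q ^ 2 - 2 * s * r + t) * (q - X i * s + X i ^ 2) +
      (-s ^ 3 - 2 * s * q + r) * (r - X i * q + X i ^ 2 * s - X i ^ 3) := by
  have h2 : pderiv i (2 : MvPolynomial (Fin 4) ℂ) = 0 := pderiv_C (a := (2 : ℂ))
  simp [-esymm_one, symmetricSeptic, Derivation.leibniz, Derivation.leibniz_pow, h2, pderiv_esymm_one,
    pderiv_esymm_two, pderiv_esymm_three, pderiv_esymm_four]
  ring

lemma ordinaryTriplePointAt_vertex :
    OrdinaryTriplePointAt 7 symmetricSeptic ![0, 0, 0, 1] := by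
  obtain ⟨h1, h2, h3, h4⟩ := eval_esymm_vertex
  have d2 : ∀ i, pderiv i (2 : MvPolynomial (Fin 4) ℂ) = 0 := fun i => pderiv_C (a := (2 : ℂ))
  have d3 : ∀ i, pderiv i (3 : MvPolynomial (Fin 4) ℂ) = 0 := fun i => pderiv_C (a := (3 : ℂ))
  refine ⟨multAtLeast_three ?_ ?_ ?_, ⟨[0, 0, 0], rfl, ?_⟩, 1, by simp, by simp,
    vertexExpansion, isHomogeneous_vertexExpansion, substMatrix_one_symmetricSeptic,
    nowhereSingular_vertexExpansion⟩
  · simp [-esymm_one, symmetricSeptic, h1, h2, h3, h4]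
  · intro i
    fin_cases i <;> simp [-esymm_one, pderiv_symmetricSeptic, h1, h2, h3, h4]
  · intro i j
    fin_cases i <;> fin_cases j <;>
    · simp [-esymm_one, pderiv_symmetricSeptic, pderiv_esymm_one, pderiv_esymm_two, pderiv_esymm_three,
        pderiv_esymm_four, Derivation.leibniz, Derivation.leibniz_pow, pderiv_X, d2, d3,
        h1, h2, h3, h4]
      try norm_num
  · change eval _ (pderiv 0 (pderiv 0 (pderiv 0 symmetricSeptic))) ≠ 0
    simp [-esymm_one, pderiv_symmetricSeptic, pderiv_esymm_one, pderiv_esymm_two, pderiv_esymm_three,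
      pderiv_esymm_four, Derivation.leibniz, Derivation.leibniz_pow, pderiv_X, d2, d3,
      h1, h2, h3, h4]
    norm_num

set_option maxHeartbeats 2000000 in
lemma ordinaryTriplePointAt_root :
    OrdinaryTriplePointAt 7 symmetricSeptic ![1, 1, -1, 0] := by
  obtain ⟨h1, h2, h3, h4⟩ := eval_esymm_root
  have d2 : ∀ i, pderiv i (2 : MvPolynomial (Fin 4) ℂ) = 0 := fun i => pderiv_C (a := (2 : ℂ))
  have d3 : ∀ i, pderiv i (3 : MvPolynomial (Fin 4) ℂ) = 0 := fun i => pderiv_C (a := (3 : ℂ))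
  refine ⟨multAtLeast_three ?_ ?_ ?_, ⟨[3, 3, 3], rfl, ?_⟩, rootMatrix, ?_, ?_,
    rootExpansion, isHomogeneous_rootExpansion, substMatrix_rootMatrix_symmetricSeptic,
    nowhereSingular_rootExpansion⟩
  · simp [-esymm_one, symmetricSeptic, h1, h2, h3, h4]
    norm_num
  · intro i
    fin_cases i <;>
    · simp [-esymm_one, pderiv_symmetricSeptic, h1, h2, h3, h4]
      try norm_num
  · intro i j
    fin_cases i <;> fin_cases j <;>
    · simp [-esymm_one, pderiv_symmetricSeptic, pderiv_esymm_one, pderiv_esymm_two, pderiv_esymm_three,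
        pderiv_esymm_four, Derivation.leibniz, Derivation.leibniz_pow, pderiv_X, d2, d3,
        h1, h2, h3, h4]
      try norm_num
  · change eval _ (pderiv 3 (pderiv 3 (pderiv 3 symmetricSeptic))) ≠ 0
    simp [-esymm_one, pderiv_symmetricSeptic, pderiv_esymm_one, pderiv_esymm_two, pderiv_esymm_three,
      pderiv_esymm_four, Derivation.leibniz, Derivation.leibniz_pow, pderiv_X, d2, d3,
      h1, h2, h3, h4]
    norm_num
  · simp [-esymm_one, rootMatrix, Matrix.det_succ_row_zero, Fin.sum_univ_succ, Fin.succAbove]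
  · ext i
    fin_cases i <;> simp [-esymm_one, rootMatrix, Matrix.mulVec, dotProduct, Fin.sum_univ_four]

/-- The gradient of `symmetricSeptic` vanishes at `p`. -/
def IsCritical (p : Fin 4 → ℂ) : Prop :=
  ∀ i, eval p (pderiv i symmetricSeptic) = 0

lemma IsCritical.septicGrad_eq_zero {p : Fin 4 → ℂ} (h : IsCritical p) (i : Fin 4) :
    septicGrad (p 0 + p 1 + p 2 + p 3)
        (p 0 * p 1 + p 0 * p 2 + p 0 * p 3 + p 1 * p 2 + p 1 * p 3 + p 2 * p 3)
        (p 0 * p 1 * p 2 + p 0 * p 1 * p 3 + p 0 * p 2 * p 3 + p 1 * p 2 * p 3)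
        (p 0 * p 1 * p 2 * p 3) (p i) = 0 := by
  rw [← eval_pderiv_symmetricSeptic, h i]

lemma IsCritical.comp {p : Fin 4 → ℂ} (h : IsCritical p) (σ : Equiv.Perm (Fin 4)) :
    IsCritical (p ∘ σ) := fun i => by
  have := eval_comp_pderivList (rename_symmetricSeptic σ) p [i]
  exact this.trans (h (σ i))

lemma IsCritical.smul {p : Fin 4 → ℂ} (h : IsCritical p) (c : ℂ) : IsCritical (c • p) :=
  fun i => by
    rw [eval_smul_of_isHomogeneous isHomogeneous_symmetricSeptic.pderiv, h i, mul_zero]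

/-- `p` is, up to scaling and a permutation of the coordinates, one of `(0, 0, 0, 1)` and
`(1, 1, -1, 0)`. -/
def IsSpecial (p : Fin 4 → ℂ) : Prop :=
  ∃ (c : ℂ) (σ : Equiv.Perm (Fin 4)), p = c • (![0, 0, 0, 1] ∘ σ) ∨ p = c • (![1, 1, -1, 0] ∘ σ)

lemma IsSpecial.of_comp {p : Fin 4 → ℂ} {σ : Equiv.Perm (Fin 4)} (h : IsSpecial (p ∘ σ)) :
    IsSpecial p := by
  obtain ⟨c, τ, h⟩ := h
  refine ⟨c, τ * σ⁻¹, h.imp (fun h => ?_) fun h => ?_⟩ <;>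
  · funext i
    simpa using congrFun h (σ⁻¹ i)

lemma not_injective_of_isCritical {p : Fin 4 → ℂ} (h : IsCritical p) :
    ¬ Function.Injective p := by
  intro hp
  have hx := h.septicGrad_eq_zero
  set s := p 0 + p 1 + p 2 + p 3 with hs
  set q := p 0 * p 1 + p 0 * p 2 + p 0 * p 3 + p 1 * p 2 + p 1 * p 3 + p 2 * p 3 with hq
  set r := p 0 * p 1 * p 2 + p 0 * p 1 * p 3 + p 0 * p 2 * p 3 + p 1 * p 2 * p 3 with hr
  set t := p 0 * p 1 * p 2 * p 3 with ht
  set fs := q ^ 3 + 2 * s * q * r - 3 * s ^ 2 * t - r ^ 2 - 2 * q * t with hfs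
  set fq := 3 * s * q ^ 2 + s ^ 2 * r - 2 * q * r - 2 * s * t with hfq
  set fr := s ^ 2 * q - q ^ 2 - 2 * s * r + t with hfr
  set ft := -s ^ 3 - 2 * s * q + r with hft
  have hv := Matrix.eq_zero_of_forall_index_sum_pow_mul_eq_zero (f := p)
    (v := ![fs + s * fq + q * fr + r * ft, -fq - s * fr - q * ft, fr + s * ft, -ft]) hp
    fun j => by
      have := hx j
      simp only [septicGrad] at this
      simp [Fin.sum_univ_four]
      linear_combination this
  have h3 : ft = 0 := neg_eq_zero.1 (congrFun hv 3)
  have h2 : fr = 0 := by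
    have : fr + s * ft = 0 := congrFun hv 2
    linear_combination this - s * h3
  have h1 : fq = 0 := by
    have : -fq - s * fr - q * ft = 0 := congrFun hv 1
    linear_combination -this - s * h2 - q * h3
  have h0 : fs = 0 := by
    have : fs + s * fq + q * fr + r * ft = 0 := congrFun hv 0
    linear_combination this - s * h1 - q * h2 - r * h3
  have er : r = s ^ 3 + 2 * s * q := by linear_combination h3
  have et : t = (q + s ^ 2) * (q + 2 * s ^ 2) := by
    linear_combination h2 + 2 * s * er
  have hroot : ∀ x, (x - p 0) * (x - p 1) * (x - p 2) * (x - p 3) =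
      x ^ 4 - s * x ^ 3 + q * x ^ 2 - r * x + t := fun x => by
    rw [hs, hq, hr, ht]
    ring
  have hne : ∀ i j : Fin 4, i ≠ j → p i ≠ p j := fun i j hij h => hij (hp h)
  by_cases hs0 : s = 0
  · have hr0 : r = 0 := by rw [er, hs0]; ring
    have ht0 : t = q ^ 2 := by rw [et, hs0]; ring
    have hq0 : q = 0 := by
      rw [hfs, hs0, hr0, ht0] at h0
      refine pow_eq_zero_iff three_ne_zero |>.1 ?_
      linear_combination -h0
    have hz : ∀ i, p i = 0 := fun i => by
      have := hroot (p i)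
      rw [hs0, hr0, ht0, hq0] at this
      refine pow_eq_zero_iff four_ne_zero |>.1 ?_
      have h' : (p i - p 0) * (p i - p 1) * (p i - p 2) * (p i - p 3) = 0 := by
        fin_cases i <;> simp
      linear_combination h' - this
    exact hne 0 1 (by decide) ((hz 0).trans (hz 1).symm)
  · have hq0 : q = -s ^ 2 := by
      have e : s * (q + s ^ 2) ^ 2 = 0 := by
        rw [hfq, er, et] at h1
        linear_combination -h1 / 3
      have := pow_eq_zero_iff two_ne_zero |>.1 ((mul_eq_zero.1 e).resolve_left hs0)
      linear_combination this
    have hr0 : r = -s ^ 3 := by rw [er, hq0]; ring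
    have ht0 : t = 0 := by rw [et, hq0]; ring
    have e1 : (s - p 0) * (s - p 1) * (s - p 2) * (s - p 3) = 0 := by
      rw [hroot, hq0, hr0, ht0]; ring
    have e2 : (s - p 1) * (s - p 2) * (s - p 3) + (s - p 0) * (s - p 2) * (s - p 3) +
        (s - p 0) * (s - p 1) * (s - p 3) + (s - p 0) * (s - p 1) * (s - p 2) = 0 := by
      have : (s - p 1) * (s - p 2) * (s - p 3) + (s - p 0) * (s - p 2) * (s - p 3) +
          (s - p 0) * (s - p 1) * (s - p 3) + (s - p 0) * (s - p 1) * (s - p 2) =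
          4 * s ^ 3 - 3 * s * s ^ 2 + 2 * q * s - r := by
        clear_value s
        rw [hq, hr, hs]
        ring
      rw [this, hq0, hr0]; ring
    have e : ∀ i j k l : Fin 4, i ≠ j → i ≠ k → i ≠ l → s - p i = 0 →
        (s - p j) * (s - p k) * (s - p l) ≠ 0 := by
      intro i j k l hj hk hl hi
      rw [sub_eq_zero.1 hi]
      exact mul_ne_zero (mul_ne_zero (sub_ne_zero.2 (hne _ _ hj)) (sub_ne_zero.2 (hne _ _ hk)))
        (sub_ne_zero.2 (hne _ _ hl))
    rcases mul_eq_zero.1 e1 with e1 | e1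
    · rcases mul_eq_zero.1 e1 with e1 | e1
      · rcases mul_eq_zero.1 e1 with e1 | e1
        · refine e 0 1 2 3 (by decide) (by decide) (by decide) e1 ?_
          rw [e1] at e2; linear_combination e2
        · refine e 1 0 2 3 (by decide) (by decide) (by decide) e1 ?_
          rw [e1] at e2; linear_combination e2
      · refine e 2 0 1 3 (by decide) (by decide) (by decide) e1 ?_
        rw [e1] at e2; linear_combination e2
    · refine e 3 0 1 2 (by decide) (by decide) (by decide) e1 ?_
      rw [e1] at e2; linear_combination e2

lemma not_isCritical_one_one_one {b : ℂ} : ¬ IsCritical ![1, 1, 1, b] := by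
  intro h
  have h0 : septicGrad (1 + 1 + 1 + b) (1 * 1 + 1 * 1 + 1 * b + 1 * 1 + 1 * b + 1 * b)
    (1 * 1 * 1 + 1 * 1 * b + 1 * 1 * b + 1 * 1 * b) (1 * 1 * 1 * b) 1 = 0 :=
    h.septicGrad_eq_zero 0
  have h3 : septicGrad (1 + 1 + 1 + b) (1 * 1 + 1 * 1 + 1 * b + 1 * 1 + 1 * b + 1 * b)
    (1 * 1 * 1 + 1 * 1 * b + 1 * 1 * b + 1 * 1 * b) (1 * 1 * 1 * b) b = 0 :=
    h.septicGrad_eq_zero 3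
  unfold septicGrad at h0 h3
  refine one_ne_zero (α := ℂ) ?_
  linear_combination (-6805 / 932 * b ^ 2 - 440241 / 26096 * b - 524359 / 52192) * h0 +
    (6805 / 3728 * b ^ 3 + 501167 / 52192 * b ^ 2 + 195375 / 13048 * b + 3643 / 466) * h3

lemma not_isCritical_one_one_pair {b : ℂ} : ¬ IsCritical ![1, 1, b, b] := by
  intro h
  have h0 : septicGrad (1 + 1 + b + b) (1 * 1 + 1 * b + 1 * b + 1 * b + 1 * b + b * b)
    (1 * 1 * b + 1 * 1 * b + 1 * b * b + 1 * b * b) (1 * 1 * b * b) 1 = 0 :=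
    h.septicGrad_eq_zero 0
  have h3 : septicGrad (1 + 1 + b + b) (1 * 1 + 1 * b + 1 * b + 1 * b + 1 * b + b * b)
    (1 * 1 * b + 1 * 1 * b + 1 * b * b + 1 * b * b) (1 * 1 * b * b) b = 0 :=
    h.septicGrad_eq_zero 3
  unfold septicGrad at h0 h3
  refine one_ne_zero (α := ℂ) ?_
  linear_combination (-39472 / 699 * b ^ 5 - 10892048 / 14679 * b ^ 4 - 4042688 / 1631 * b ^ 3 -
    6772840 / 2097 * b ^ 2 - 2684064 / 1631 * b - 3352271 / 14679) * h0 +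
    (631552 / 4893 * b ^ 5 + 15964160 / 14679 * b ^ 4 + 2000384 / 699 * b ^ 3 +
    44215168 / 14679 * b ^ 2 + 5824768 / 4893 * b + 209648 / 2097) * h3

lemma eq_of_isCritical_one_one {b c : ℂ} (h : IsCritical ![1, 1, b, c]) (hb : b ≠ 1) (hc : c ≠ 1)
    (hbc : b ≠ c) : b = 0 ∧ c = -1 ∨ b = -1 ∧ c = 0 := by
  have h0 : septicGrad (1 + 1 + b + c) (1 * 1 + 1 * b + 1 * c + 1 * b + 1 * c + b * c)
    (1 * 1 * b + 1 * 1 * c + 1 * b * c + 1 * b * c) (1 * 1 * b * c) 1 = 0 :=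
    h.septicGrad_eq_zero 0
  have h2 : septicGrad (1 + 1 + b + c) (1 * 1 + 1 * b + 1 * c + 1 * b + 1 * c + b * c)
    (1 * 1 * b + 1 * 1 * c + 1 * b * c + 1 * b * c) (1 * 1 * b * c) b = 0 :=
    h.septicGrad_eq_zero 2
  have h3 : septicGrad (1 + 1 + b + c) (1 * 1 + 1 * b + 1 * c + 1 * b + 1 * c + b * c)
    (1 * 1 * b + 1 * 1 * c + 1 * b * c + 1 * b * c) (1 * 1 * b * c) c = 0 :=
    h.septicGrad_eq_zero 3
  unfold septicGrad at h0 h2 h3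
  obtain ⟨u, hu⟩ : ∃ u, u = b + c := ⟨_, rfl⟩
  obtain ⟨v, hv⟩ : ∃ v, v = b * c := ⟨_, rfl⟩
  have e6 : 15 * u ^ 4 + 16 * u ^ 3 * v + 64 * u ^ 3 + 4 * u ^ 2 * v ^ 2 + 48 * u ^ 2 * v +
      90 * u ^ 2 + 8 * u * v ^ 2 + 32 * u * v + 48 * u + 7 = 0 := by
    rw [hu, hv]
    linear_combination h0
  have e5 : 16 * u ^ 3 + 16 * u ^ 2 * v + 32 * u ^ 2 + 3 * u * v ^ 2 + 16 * u * v + 16 * u = 0 := by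
    refine (mul_eq_zero.1 ?_).resolve_left (sub_ne_zero.2 hbc)
    rw [hu, hv]
    linear_combination h3 - h2
  have e4 : u ^ 3 + u ^ 2 * v - 7 * u ^ 2 - 6 * u * v - 17 * u - v ^ 2 - 7 * v - 9 = 0 := by
    refine (mul_eq_zero.1 ?_).resolve_left
      (mul_ne_zero (sub_ne_zero.2 hbc) (mul_ne_zero (sub_ne_zero.2 hb) (sub_ne_zero.2 hc)))
    rw [hu, hv]
    linear_combination (c - 1) * h2 - (b - 1) * h3 + (b - c) * h0
  have f5 : u * ((u + 1) * ((3 * u - 5) * v + (u + 1) * (3 * u - 11))) = 0 := by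
    linear_combination e5 + 3 * u * e4
  have hu1 : u = -1 := by
    rcases mul_eq_zero.1 f5 with f | f
    · rw [f] at e6
      norm_num at e6
    by_contra hne
    have hne' : u + 1 ≠ 0 := fun h => hne (by linear_combination h)
    have f5' := (mul_eq_zero.1 f).resolve_left hne'
    have f6 : 4 * u ^ 4 + 4 * u ^ 3 * v - 9 * u ^ 3 - 4 * u ^ 2 * v - 51 * u ^ 2 - 24 * u * v -
        31 * u + 7 = 0 := by
      refine (mul_eq_zero.1 ?_).resolve_left hne'
      linear_combination e6 + (4 * u ^ 2 + 8 * u) * e4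
    have g4 : -9 * u ^ 2 - 30 * u + 39 = 0 := by
      refine (mul_eq_zero.1 ?_).resolve_left (pow_ne_zero 2 hne')
      linear_combination (3 * u - 5) ^ 2 * e4 +
        ((3 * u - 5) * v - (u + 1) * (3 * u - 11) - (u ^ 2 - 6 * u - 7) * (3 * u - 5)) * f5'
    have g6 : -3 * u ^ 2 - 18 * u - 35 = 0 := by
      refine (mul_eq_zero.1 ?_).resolve_left (pow_ne_zero 2 hne')
      linear_combination (3 * u - 5) * f6 - (4 * u ^ 3 - 4 * u ^ 2 - 24 * u) * f5'
    refine one_ne_zero (α := ℂ) ?_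
    linear_combination (-1 / 280 * u) * g4 + (3 / 280 * u - 1 / 35) * g6
  have hv0 : v = 0 := by
    rw [hu1] at e4
    rw [← sq_eq_zero_iff]
    linear_combination -e4
  rcases mul_eq_zero.1 (hv.symm.trans hv0) with hb0 | hc0
  · exact Or.inl ⟨hb0, by linear_combination hu1 - hu - hb0⟩
  · exact Or.inr ⟨by linear_combination hu1 - hu - hc0, hc0⟩

lemma IsCritical.one_one {a b c : ℂ} (h : IsCritical ![a, a, b, c]) (ha : a ≠ 0) :
    IsCritical ![1, 1, b / a, c / a] := by
  have := h.smul a⁻¹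
  convert this using 1
  ext i
  fin_cases i <;> simp [ha, div_eq_inv_mul]

lemma eq_zero_of_isCritical_triple {a b : ℂ} (h : IsCritical ![a, a, a, b]) : a = 0 := by
  by_contra ha
  have := h.one_one ha
  rw [div_self ha] at this
  exact not_isCritical_one_one_one this

lemma eq_zero_of_isCritical_pair {a b : ℂ} (h : IsCritical ![a, a, b, b]) : a = 0 := by
  by_contra ha
  exact not_isCritical_one_one_pair (h.one_one ha)

lemma isSpecial_vertex (b : ℂ) : IsSpecial ![0, 0, 0, b] := by
  refine ⟨b, 1, Or.inl ?_⟩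
  ext i
  fin_cases i <;> simp

lemma not_isCritical_zero_zero {b c : ℂ} (hb : b ≠ 0) (hc : c ≠ 0) (hbc : b ≠ c) :
    ¬ IsCritical ![0, 0, b, c] := by
  intro h
  have h0 : septicGrad (0 + 0 + b + c) (0 * 0 + 0 * b + 0 * c + 0 * b + 0 * c + b * c)
    (0 * 0 * b + 0 * 0 * c + 0 * b * c + 0 * b * c) (0 * 0 * b * c) 0 = 0 :=
    h.septicGrad_eq_zero 0
  have h2 : septicGrad (0 + 0 + b + c) (0 * 0 + 0 * b + 0 * c + 0 * b + 0 * c + b * c)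
    (0 * 0 * b + 0 * 0 * c + 0 * b * c + 0 * b * c) (0 * 0 * b * c) b = 0 :=
    h.septicGrad_eq_zero 2
  have h3 : septicGrad (0 + 0 + b + c) (0 * 0 + 0 * b + 0 * c + 0 * b + 0 * c + b * c)
    (0 * 0 * b + 0 * 0 * c + 0 * b * c + 0 * b * c) (0 * 0 * b * c) c = 0 :=
    h.septicGrad_eq_zero 3
  unfold septicGrad at h0 h2 h3
  have hv : b * c ≠ 0 := mul_ne_zero hb hc
  have e6 : (b + c) ^ 2 * (b * c) ^ 2 = 0 := by
    linear_combination h0 / 4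
  have hs : b + c = 0 := by simpa [hb, hc] using e6
  have e4 : b * c * ((b + c) ^ 2 - b * c) = 0 := by
    refine (mul_eq_zero.1 ?_).resolve_left (mul_ne_zero (sub_ne_zero.2 hbc) hv)
    linear_combination c * h2 - b * h3 + (b - c) * h0
  rw [hs] at e4
  simp [hb, hc] at e4

lemma IsCritical.isSpecial {p : Fin 4 → ℂ} (h : IsCritical p) : IsSpecial p := by
  have key : ∀ a b c : ℂ, IsCritical ![a, a, b, c] → IsSpecial ![a, a, b, c] := by
    intro a b c h
    have swap : IsCritical ![a, a, c, b] := by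
      convert h.comp (Equiv.swap 2 3) using 1
      ext i
      fin_cases i <;> rfl
    by_cases hbc : b = c
    · subst hbc
      have ha := eq_zero_of_isCritical_pair h
      have hb : b = 0 := eq_zero_of_isCritical_pair (a := b) (b := a) (by
        convert h.comp (Equiv.swap 0 2 * Equiv.swap 1 3) using 1
        ext i
        fin_cases i <;> rfl)
      rw [ha, hb]
      exact isSpecial_vertex 0
    by_cases hb : b = a
    · subst hb
      rw [eq_zero_of_isCritical_triple h]
      exact isSpecial_vertex c
    by_cases hc : c = a
    · subst hc
      have hc0 := eq_zero_of_isCritical_triple swap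
      rw [hc0]
      refine ⟨b, Equiv.swap 2 3, Or.inl ?_⟩
      ext i
      fin_cases i <;> simp [Equiv.swap_apply_of_ne_of_ne]
    by_cases ha : a = 0
    · subst ha
      exact absurd h (not_isCritical_zero_zero hb hc hbc)
    rcases eq_of_isCritical_one_one (h.one_one ha) (by rwa [Ne, div_eq_one_iff_eq ha])
      (by rwa [Ne, div_eq_one_iff_eq ha]) (by rwa [Ne, div_left_inj' ha]) with ⟨h1, h2⟩ | ⟨h1, h2⟩
    · rw [div_eq_iff ha] at h1 h2
      refine ⟨a, Equiv.swap 2 3, Or.inr ?_⟩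
      rw [h1, h2]
      ext i
      fin_cases i <;> simp [Equiv.swap_apply_of_ne_of_ne]
    · rw [div_eq_iff ha] at h1 h2
      refine ⟨a, 1, Or.inr ?_⟩
      rw [h1, h2]
      ext i
      fin_cases i <;> simp
  obtain ⟨i, j, hij, hne⟩ : ∃ i j, p i = p j ∧ i ≠ j := by
    simpa [Function.Injective] using not_injective_of_isCritical h
  obtain ⟨σ, h0, h1⟩ : ∃ σ : Equiv.Perm (Fin 4), σ 0 = i ∧ σ 1 = j := by
    clear hij
    revert i j
    decide
  have hp : p ∘ σ = ![p i, p i, p (σ 2), p (σ 3)] := by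
    ext k
    fin_cases k <;> simp [h0, h1, hij]
  refine IsSpecial.of_comp (σ := σ) ?_
  rw [hp]
  exact key _ _ _ (hp ▸ h.comp σ)

/-- Integral representatives of the singular points of `symmetricSeptic`. -/
def singularVector : Fin 16 → Fin 4 → ℤ :=
  ![![1, 0, 0, 0], ![0, 1, 0, 0], ![0, 0, 1, 0], ![0, 0, 0, 1], ![0, -1, 1, 1], ![0, 1, -1, 1],
    ![0, 1, 1, -1], ![-1, 0, 1, 1], ![1, 0, -1, 1], ![1, 0, 1, -1], ![-1, 1, 0, 1],
    ![1, -1, 0, 1], ![1, 1, 0, -1], ![-1, 1, 1, 0], ![1, -1, 1, 0], ![1, 1, -1, 0]]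

lemma exists_singularVector_eq_comp (i : Fin 16) : ∃ σ : Equiv.Perm (Fin 4),
    singularVector i = ![0, 0, 0, 1] ∘ σ ∨ singularVector i = ![1, 1, -1, 0] ∘ σ := by
  revert i
  decide

lemma exists_vertex_comp_eq (σ : Equiv.Perm (Fin 4)) :
    ∃ i, singularVector i = ![0, 0, 0, 1] ∘ σ := by
  revert σ
  decide

lemma exists_root_comp_eq (σ : Equiv.Perm (Fin 4)) :
    ∃ i, singularVector i = ![1, 1, -1, 0] ∘ σ := by
  revert σ
  decide

lemma exists_minor_ne_zero {i j : Fin 16} (h : i ≠ j) : ∃ k l,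
    singularVector i k * singularVector j l - singularVector i l * singularVector j k ≠ 0 := by
  revert i j
  decide

/-- The complex vector underlying `singularVector i`. -/
def singularRep (i : Fin 16) : Fin 4 → ℂ := fun k => singularVector i k

lemma cast_vertex_comp (σ : Equiv.Perm (Fin 4)) :
    (fun k => (((![0, 0, 0, 1] : Fin 4 → ℤ) ∘ σ) k : ℂ)) = ![0, 0, 0, 1] ∘ σ := by
  funext k
  simp only [Function.comp_apply]
  generalize σ k = m
  fin_cases m <;> simp

lemma cast_root_comp (σ : Equiv.Perm (Fin 4)) :
    (fun k => (((![1, 1, -1, 0] : Fin 4 → ℤ) ∘ σ) k : ℂ)) = ![1, 1, -1, 0] ∘ σ := by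
  funext k
  simp only [Function.comp_apply]
  generalize σ k = m
  fin_cases m <;> simp

lemma ordinaryTriplePointAt_singularRep (i : Fin 16) :
    OrdinaryTriplePointAt 7 symmetricSeptic (singularRep i) := by
  unfold singularRep
  obtain ⟨σ, h | h⟩ := exists_singularVector_eq_comp i
  · rw [h, cast_vertex_comp]
    exact ordinaryTriplePointAt_comp (rename_symmetricSeptic σ) ordinaryTriplePointAt_vertex
  · rw [h, cast_root_comp]
    exact ordinaryTriplePointAt_comp (rename_symmetricSeptic σ) ordinaryTriplePointAt_root

lemma IsSpecial.exists_eq_smul {p : Fin 4 → ℂ} (h : IsSpecial p) :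
    ∃ (c : ℂ) (i : Fin 16), p = c • singularRep i := by
  obtain ⟨c, σ, h | h⟩ := h
  · obtain ⟨i, hi⟩ := exists_vertex_comp_eq σ
    exact ⟨c, i, by rw [h, ← cast_vertex_comp, ← hi]; rfl⟩
  · obtain ⟨i, hi⟩ := exists_root_comp_eq σ
    exact ⟨c, i, by rw [h, ← cast_root_comp, ← hi]; rfl⟩

lemma singularRep_eq_of_smul_eq {c : ℂ} {i j : Fin 16} (h : c • singularRep j = singularRep i) :
    i = j := by
  by_contra hij
  obtain ⟨k, l, hkl⟩ := exists_minor_ne_zero hij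
  have hk : c * singularVector j k = singularVector i k := congrFun h k
  have hl : c * singularVector j l = singularVector i l := congrFun h l
  refine hkl ((Int.cast_eq_zero (α := ℂ)).1 ?_)
  push_cast
  rw [← hk, ← hl]
  ring

lemma singularRep_ne_zero (i : Fin 16) : singularRep i ≠ 0 := fun h => by
  have h1 : (0 : ℂ) • singularRep (i + 1) = singularRep i := by rw [h, zero_smul]
  have h2 := singularRep_eq_of_smul_eq h1
  clear h h1
  revert i
  decide

lemma singSet_symmetricSeptic : SingSet symmetricSeptic =
    Set.range fun i => Projectivization.mk ℂ (singularRep i) (singularRep_ne_zero i) := by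
  ext P
  constructor
  · intro hP
    have hc : IsCritical P.rep := fun i => SingularAt.pderiv_eq_zero hP i
    obtain ⟨c, i, h⟩ := hc.isSpecial.exists_eq_smul
    refine ⟨i, ?_⟩
    rw [← P.mk_rep, Projectivization.mk_eq_mk_iff']
    have hc0 : c ≠ 0 := by
      rintro rfl
      exact P.rep_nonzero (by rw [h, zero_smul])
    exact ⟨c⁻¹, by rw [h, inv_smul_smul₀ hc0]⟩
  · rintro ⟨i, rfl⟩
    obtain ⟨c, hc⟩ := Projectivization.exists_smul_eq_mk_rep ℂ (singularRep i)
      (singularRep_ne_zero i)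
    change SingularAt _ _
    rw [← hc]
    exact OrdinaryTriplePointAt.singularAt (ordinaryTriplePointAt_smul
      isHomogeneous_symmetricSeptic (ordinaryTriplePointAt_singularRep i) c.ne_zero)

lemma onlyTriplePoints_symmetricSeptic : OnlyTriplePoints 7 16 symmetricSeptic := by
  refine ⟨?_, ?_, ?_⟩
  · rw [singSet_symmetricSeptic]
    exact Set.finite_range _
  · rw [singSet_symmetricSeptic, ← Set.image_univ, Set.ncard_image_of_injective, Set.ncard_univ,
      Nat.card_fin]
    intro i j hij
    obtain ⟨c, hc⟩ := (Projectivization.mk_eq_mk_iff' _ _ _ _ _).1 hij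
    exact singularRep_eq_of_smul_eq hc
  · rw [singSet_symmetricSeptic]
    rintro _ ⟨i, rfl⟩
    obtain ⟨c, hc⟩ := Projectivization.exists_smul_eq_mk_rep ℂ (singularRep i)
      (singularRep_ne_zero i)
    rw [← hc]
    exact ordinaryTriplePointAt_smul isHomogeneous_symmetricSeptic
      (ordinaryTriplePointAt_singularRep i) c.ne_zero

lemma symmetricSeptic_ne_zero : symmetricSeptic ≠ 0 := by
  intro h
  have h0 : IsCritical ![1, 1, 1, 1] := fun i => by rw [h, map_zero, map_zero]
  exact not_isCritical_one_one_one h0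

end Septic

/-- Every septic surface whose only singularities are `ν` ordinary triple
points satisfies `ν ≤ 17`, and there is a septic with exactly `16` ordinary triple
points as its only singularities.  Hence `16 ≤ μ₃(7) ≤ 17`. -/
theorem mu3_of_septics :
    (∀ (ν : ℕ) (f : MvPolynomial (Fin 4) ℂ), f ≠ 0 → f.IsHomogeneous 7 →
      OnlyTriplePoints 7 ν f → ν ≤ 17) ∧
    (∃ f : MvPolynomial (Fin 4) ℂ, f ≠ 0 ∧ f.IsHomogeneous 7 ∧
      OnlyTriplePoints 7 16 f) :=
  ⟨fun _ _ _ hf h => Septic.card_triple_points_le hf h, Septic.symmetricSeptic,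
    Septic.symmetricSeptic_ne_zero, Septic.isHomogeneous_symmetricSeptic,
    Septic.onlyTriplePoints_symmetricSeptic⟩
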